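/- arXiv:1511.01252 — 5 statements merged into one kernel-verified Lean document; each statement's English description precedes it below -/
import Mathlib

section
/- Let 1 < p ≤ 2 and let n ≥ 1. For all vectors a, b ∈ ℝⁿ one has ⟨|b|^{p-2} b − |a|^{p-2} a, b − a⟩ ≥ (p−1) |b−a|² ∫₀¹ |a + t(b−a)|^{p-2} dt, where the integral is the (possibly improper, but finite) Lebesgue integral over t ∈ (0,1). -/
open MeasureTheory
open scoped RealInnerProductSpace

section

variable {E : Type*} [NormedAddCommGroup E] [InnerProductSpace ℝ E]

/-- The vector field `x ↦ ‖x‖ ^ q • x` is monotone when `-1 < q`. -/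
lemma inner_norm_rpow_smul_sub_nonneg {q : ℝ} (hq : -1 < q) (x y : E) :
    0 ≤ ⟪‖y‖ ^ q • y - ‖x‖ ^ q • x, y - x⟫ := by
  have rpow_mul_self (r : ℝ) (hr : 0 ≤ r) : r ^ q * r = r ^ (q + 1) := by
    rcases hr.eq_or_lt with rfl | hr
    · rw [mul_zero, Real.zero_rpow (by linarith)]
    · rw [Real.rpow_add_one hr.ne']
  have norm_mono : 0 ≤ (‖y‖ ^ q * ‖y‖ - ‖x‖ ^ q * ‖x‖) * (‖y‖ - ‖x‖) := by
    rw [rpow_mul_self _ (norm_nonneg _), rpow_mul_self _ (norm_nonneg _)]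
    rcases le_total ‖x‖ ‖y‖ with h | h
    · have := Real.rpow_le_rpow (norm_nonneg _) h (by linarith : 0 ≤ q + 1)
      exact mul_nonneg (by linarith) (by linarith)
    · have := Real.rpow_le_rpow (norm_nonneg _) h (by linarith : 0 ≤ q + 1)
      exact mul_nonneg_of_nonpos_of_nonpos (by linarith) (by linarith)
  have cauchy_schwarz := mul_le_mul_of_nonneg_left (real_inner_le_norm x y)
    (add_nonneg (Real.rpow_nonneg (norm_nonneg x) q) (Real.rpow_nonneg (norm_nonneg y) q))
  simp only [inner_sub_left, inner_sub_right, real_inner_smul_left,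
    real_inner_self_eq_norm_sq, real_inner_comm x y]
  nlinarith

lemma monotone_inner_norm_rpow_smul_line {q : ℝ} (hq : -1 < q) (a v : E) :
    Monotone fun t : ℝ => ⟪‖a + t • v‖ ^ q • (a + t • v), v⟫ := by
  intro s t hst
  rcases hst.eq_or_lt with rfl | hst
  · rfl
  have h := inner_norm_rpow_smul_sub_nonneg hq (a + s • v) (a + t • v)
  rw [show a + t • v - (a + s • v) = (t - s) • v by module, real_inner_smul_right,
    inner_sub_left] at h
  exact sub_nonneg.mp (nonneg_of_mul_nonneg_right h (sub_pos.mpr hst))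

lemma hasDerivAt_inner_norm_rpow_smul_line (q : ℝ) (a v : E) {t : ℝ} (h : a + t • v ≠ 0) :
    HasDerivAt (fun t : ℝ => ⟪‖a + t • v‖ ^ q • (a + t • v), v⟫)
      (‖a + t • v‖ ^ q * ‖v‖ ^ 2 + q * ‖a + t • v‖ ^ (q - 2) * ⟪a + t • v, v⟫ ^ 2) t := by
  have hpos : 0 < ‖a + t • v‖ := norm_pos_iff.mpr h
  have hc : HasDerivAt (fun t : ℝ => a + t • v) v t := by
    simpa using ((hasDerivAt_id t).smul_const v).const_add a
  have hpow (x : E) (s : ℝ) : (‖x‖ ^ 2) ^ (s / 2) = ‖x‖ ^ s := by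
    rw [← Real.rpow_natCast_mul (norm_nonneg x)]
    congr 1
    push_cast
    ring
  have hsq : HasDerivAt (fun t : ℝ => ‖a + t • v‖ ^ 2) (2 * ⟪a + t • v, v⟫) t := hc.norm_sq
  have hn := hsq.rpow_const (p := q / 2) (Or.inl (by positivity))
  rw [show q / 2 - 1 = (q - 2) / 2 by ring] at hn
  simp only [hpow] at hn
  have hi : HasDerivAt (fun t : ℝ => ⟪a + t • v, v⟫) (‖v‖ ^ 2) t := by
    simpa using hc.inner ℝ (hasDerivAt_const t v)
  simp only [real_inner_smul_left]
  exact (hn.fun_mul hi).congr_deriv (by ring)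

lemma le_deriv_inner_norm_rpow_smul_line {q : ℝ} (hq : q ≤ 0) (a v : E) {t : ℝ}
    (h : a + t • v ≠ 0) :
    (q + 1) * ‖v‖ ^ 2 * ‖a + t • v‖ ^ q ≤
      deriv (fun t : ℝ => ⟪‖a + t • v‖ ^ q • (a + t • v), v⟫) t := by
  rw [(hasDerivAt_inner_norm_rpow_smul_line q a v h).deriv]
  have hpos : 0 < ‖a + t • v‖ := norm_pos_iff.mpr h
  have hsq : ⟪a + t • v, v⟫ ^ 2 ≤ ‖a + t • v‖ ^ 2 * ‖v‖ ^ 2 := by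
    rw [← mul_pow]
    exact sq_le_sq' (neg_le_of_abs_le (abs_real_inner_le_norm _ _)) (real_inner_le_norm _ _)
  have hpow : ‖a + t • v‖ ^ q = ‖a + t • v‖ ^ (q - 2) * ‖a + t • v‖ ^ 2 := by
    rw [← Real.rpow_add_natCast hpos.ne']
    norm_num
  have hmul := mul_le_mul_of_nonpos_left
    (mul_le_mul_of_nonneg_left hsq (Real.rpow_nonneg hpos.le (q - 2))) hq
  rw [← mul_assoc (‖a + t • v‖ ^ (q - 2)) (‖a + t • v‖ ^ 2), ← hpow] at hmul
  linarith

lemma ae_add_smul_ne_zero (a : E) {v : E} (hv : v ≠ 0) :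
    ∀ᵐ t : ℝ, a + t • v ≠ 0 := by
  have hs : {t : ℝ | a + t • v = 0}.Subsingleton := fun s hs t ht =>
    smul_left_injective ℝ hv (add_left_cancel (Eq.trans hs (Eq.symm ht)))
  simpa [ae_iff] using hs.measure_zero volume

end

/-- Vector inequality (Lindqvist): for `1 < p ≤ 2`,
`⟨|b|^{p-2} b − |a|^{p-2} a, b − a⟩ ≥ (p−1)|b−a|² ∫₀¹ |a + t(b−a)|^{p-2} dt`. -/
theorem lindqvist_inequality (p : ℝ) (hp1 : 1 < p) (hp2 : p ≤ 2)
    (n : ℕ) (hn : 1 ≤ n) (a b : EuclideanSpace ℝ (Fin n)) :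
    ⟪‖b‖ ^ (p - 2) • b - ‖a‖ ^ (p - 2) • a, b - a⟫ ≥
      (p - 1) * ‖b - a‖ ^ 2 * ∫ t in Set.Ioo (0:ℝ) 1, ‖a + t • (b - a)‖ ^ (p - 2) := by
  rcases eq_or_ne a b with rfl | hab
  · simp
  have hv : b - a ≠ 0 := sub_ne_zero.mpr hab.symm
  set g : ℝ → ℝ := fun t => ⟪‖a + t • (b - a)‖ ^ (p - 2) • (a + t • (b - a)), b - a⟫ with hg
  have hmono : Monotone g := monotone_inner_norm_rpow_smul_line (by linarith) a (b - a)
  have hends : g 1 - g 0 = ⟪‖b‖ ^ (p - 2) • b - ‖a‖ ^ (p - 2) • a, b - a⟫ := by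
    simp only [hg, one_smul, zero_smul, add_zero, add_sub_cancel, inner_sub_left]
  have hint : IntegrableOn (deriv g) (Set.Ioo 0 1) :=
    ((hmono.monotoneOn _).intervalIntegrable_deriv (a := 0) (b := 1)).1.mono_set
      Set.Ioo_subset_Ioc_self
  have hderiv : ∫ t in Set.Ioo (0:ℝ) 1, deriv g t ≤ g 1 - g 0 := by
    have h := (hmono.monotoneOn (Set.uIcc 0 1)).intervalIntegral_deriv_mem_uIcc
    rw [Set.uIcc_of_le (sub_nonneg.mpr (hmono zero_le_one)),
      intervalIntegral.integral_of_le zero_le_one, integral_Ioc_eq_integral_Ioo] at h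
    exact h.2
  rw [← hends, ge_iff_le, ← integral_const_mul]
  refine le_trans (integral_mono_of_nonneg ?_ hint ?_) hderiv
  · refine Filter.Eventually.of_forall fun t => ?_
    have : 0 ≤ p - 1 := by linarith
    dsimp only [Pi.zero_apply]
    positivity
  · filter_upwards [ae_restrict_of_ae (ae_add_smul_ne_zero a hv)] with t ht
    have h := le_deriv_inner_norm_rpow_smul_line (by linarith : p - 2 ≤ 0) a (b - a) ht
    rwa [show p - 2 + 1 = p - 1 by ring] at h
end

section
/- Let 1 < p ≤ 2, n ≥ 1 and M > 0. For all vectors a, b ∈ ℝⁿ with |b − a| ≤ M one has ⟨|b|^{p-2} b − |a|^{p-2} a, b − a⟩ ≥ (p−1) (|a| + M)^{p-2} |b − a|². -/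
open scoped RealInnerProductSpace

/-- Lower bound for increments of `x ↦ x ^ (p - 2) * x` on `[0, R]`, ordered version. -/
lemma rpow_sub_two_mul_self_increment_of_le {p R r s : ℝ} (hp1 : 1 < p) (hp2 : p ≤ 2)
    (hs : 0 ≤ s) (hsr : s ≤ r) (hrR : r ≤ R) :
    (p - 1) * R ^ (p - 2) * (r - s) ≤ r ^ (p - 2) * r - s ^ (p - 2) * s := by
  rcases (hs.trans hsr).eq_or_lt with hr | hr
  · have : s = 0 := le_antisymm (hsr.trans hr.ge) hs
    simp [← hr, this]
  have hmul : ∀ x : ℝ, 0 ≤ x → x ^ (p - 2) * x = x ^ (p - 1) := fun x hx ↦ by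
    rw [show p - 1 = (p - 2) + 1 by ring, Real.rpow_add_one' hx (by linarith)]
  have hbern := rpow_one_add_le_one_add_mul_self (s := s / r - 1) (p := p - 1)
    (by linarith [div_nonneg hs hr.le]) (by linarith) (by linarith)
  rw [add_sub_cancel, Real.div_rpow hs hr.le, ← hmul s hs, ← hmul r hr.le,
    div_le_iff₀ (by positivity)] at hbern
  have htangent : (1 + (p - 1) * (s / r - 1)) * (r ^ (p - 2) * r) =
      r ^ (p - 2) * r - (p - 1) * r ^ (p - 2) * (r - s) := by
    field_simp
    ring
  have hanti : R ^ (p - 2) ≤ r ^ (p - 2) :=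
    Real.rpow_le_rpow_of_nonpos hr hrR (by linarith)
  have : (p - 1) * R ^ (p - 2) * (r - s) ≤ (p - 1) * r ^ (p - 2) * (r - s) :=
    mul_le_mul_of_nonneg_right (mul_le_mul_of_nonneg_left hanti (by linarith)) (by linarith)
  linarith

/-- Strong monotonicity of `x ↦ x ^ (p - 2) * x` on `[0, R]`. -/
lemma rpow_sub_two_mul_self_strong_monotone {p R r s : ℝ} (hp1 : 1 < p) (hp2 : p ≤ 2)
    (hr : 0 ≤ r) (hs : 0 ≤ s) (hrR : r ≤ R) (hsR : s ≤ R) :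
    (p - 1) * R ^ (p - 2) * (r - s) ^ 2 ≤ (r ^ (p - 2) * r - s ^ (p - 2) * s) * (r - s) := by
  rcases le_total s r with h | h
  · nlinarith [mul_le_mul_of_nonneg_right
      (rpow_sub_two_mul_self_increment_of_le hp1 hp2 hs h hrR) (sub_nonneg.2 h)]
  · nlinarith [mul_le_mul_of_nonneg_right
      (rpow_sub_two_mul_self_increment_of_le hp1 hp2 hr h hsR) (sub_nonneg.2 h)]

/-- Strong monotonicity of `x ↦ ‖x‖ ^ (p - 2) • x` on the closed ball of radius `R`. -/
lemma inner_rpow_smul_sub_strong_monotone {E : Type*} [NormedAddCommGroup E]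
    [InnerProductSpace ℝ E] {p R : ℝ} (hp1 : 1 < p) (hp2 : p ≤ 2) {a b : E}
    (ha : ‖a‖ ≤ R) (hb : ‖b‖ ≤ R) :
    (p - 1) * R ^ (p - 2) * ‖b - a‖ ^ 2 ≤
      ⟪‖b‖ ^ (p - 2) • b - ‖a‖ ^ (p - 2) • a, b - a⟫ := by
  have hR : 0 ≤ R := (norm_nonneg a).trans ha
  have hcs : ⟪b, a⟫ ≤ ‖b‖ * ‖a‖ := real_inner_le_norm b a
  have hslope : ∀ x : E, ‖x‖ ≤ R → x ≠ 0 → (p - 1) * R ^ (p - 2) ≤ ‖x‖ ^ (p - 2) :=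
    fun x hx hx0 ↦ (mul_le_of_le_one_left (Real.rpow_nonneg hR _) (by linarith)).trans
      (Real.rpow_le_rpow_of_nonpos (norm_pos_iff.2 hx0) hx (by linarith))
  have hb' : 0 ≤ (‖b‖ ^ (p - 2) - (p - 1) * R ^ (p - 2)) * (‖b‖ * ‖a‖ - ⟪b, a⟫) := by
    by_cases h : b = 0
    · simp [h]
    · exact mul_nonneg (sub_nonneg.2 (hslope b hb h)) (sub_nonneg.2 hcs)
  have ha' : 0 ≤ (‖a‖ ^ (p - 2) - (p - 1) * R ^ (p - 2)) * (‖b‖ * ‖a‖ - ⟪b, a⟫) := by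
    by_cases h : a = 0
    · simp [h]
    · exact mul_nonneg (sub_nonneg.2 (hslope a ha h)) (sub_nonneg.2 hcs)
  have hradial := rpow_sub_two_mul_self_strong_monotone hp1 hp2 (norm_nonneg b)
    (norm_nonneg a) hb ha
  rw [norm_sub_sq_real, inner_sub_left, inner_sub_right, inner_sub_right]
  simp only [real_inner_smul_left, real_inner_self_eq_norm_sq, real_inner_comm b a]
  linarith

/-- For `1 < p ≤ 2` and `|b − a| ≤ M`,
`⟨|b|^{p-2} b − |a|^{p-2} a, b − a⟩ ≥ (p−1)(|a|+M)^{p-2} |b−a|²`. -/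
theorem monotonicity_small_increment (p : ℝ) (hp1 : 1 < p) (hp2 : p ≤ 2)
    (n : ℕ) (hn : 1 ≤ n) (M : ℝ) (hM : 0 < M)
    (a b : EuclideanSpace ℝ (Fin n)) (hab : ‖b - a‖ ≤ M) :
    ⟪‖b‖ ^ (p - 2) • b - ‖a‖ ^ (p - 2) • a, b - a⟫ ≥
      (p - 1) * (‖a‖ + M) ^ (p - 2) * ‖b - a‖ ^ 2 :=
  inner_rpow_smul_sub_strong_monotone hp1 hp2 (by linarith)
    (by linarith [norm_le_norm_add_norm_sub' b a])
end

section
/- Let 1 < p ≤ 2, n ≥ 1 and M > 0. For all vectors a, b ∈ ℝⁿ with |b − a| > M > |a| one has ⟨|b|^{p-2} b − |a|^{p-2} a, b − a⟩ ≥ 2^{p-3} (1 − (|a|/M)^{p-1}) |b − a|^p. -/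
open scoped RealInnerProductSpace

/-- Lower bound for the monotonicity gap in terms of `r = |a|`, `s = |b|`, `d = |b - a|` and
`i = ⟪a, b⟫`. -/
lemma half_mul_le_monotonicity_gap {p r s d i : ℝ} (hp1 : 1 < p) (hp2 : p ≤ 2)
    (hr : 0 < r) (hs : 0 < s) (hrd : r < d) (hd : d ^ 2 = s ^ 2 + r ^ 2 - 2 * i)
    (hi : i ≤ s * r) :
    (d ^ (p - 2) * d ^ 2 - r ^ (p - 2) * r * d) / 2 ≤
      s ^ (p - 2) * s ^ 2 + r ^ (p - 2) * r ^ 2 - (s ^ (p - 2) + r ^ (p - 2)) * i := by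
  have hd0 : 0 < d := hr.trans hrd
  have hmul : ∀ x : ℝ, 0 < x → x ^ (p - 2) * x = x ^ (p - 1) := fun x hx => by
    rw [← Real.rpow_add_one hx.ne']; congr 1; ring
  have hmono : ∀ x y : ℝ, 0 < x → x ≤ y → x ^ (p - 2) * x ≤ y ^ (p - 2) * y :=
    fun x y hx hxy => by
      rw [hmul x hx, hmul y (hx.trans_le hxy)]
      exact Real.rpow_le_rpow hx.le hxy (by linarith)
  have hanti : ∀ x y : ℝ, 0 < x → x ≤ y → y ^ (p - 2) ≤ x ^ (p - 2) := fun x y hx hxy =>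
    Real.rpow_le_rpow_of_nonpos hx hxy (by linarith)
  have hP : 0 < r ^ (p - 2) := Real.rpow_pos_of_pos hr _
  have hS : 0 < s ^ (p - 2) := Real.rpow_pos_of_pos hs _
  have hDP := hanti r d hr hrd.le
  have hrs : 0 ≤ (s ^ (p - 2) * s - r ^ (p - 2) * r) * (s - r) := by
    rcases le_total r s with h | h
    · exact mul_nonneg (sub_nonneg.2 (hmono r s hr h)) (sub_nonneg.2 h)
    · exact mul_nonneg_of_nonpos_of_nonpos (sub_nonpos.2 (hmono s r hs h)) (sub_nonpos.2 h)
  have hcross : 0 ≤ s ^ (p - 2) * (s * r - i) := mul_nonneg hS.le (sub_nonneg.2 hi)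
  obtain rfl : i = (s ^ 2 + r ^ 2 - d ^ 2) / 2 := by linarith
  rcases le_or_gt (s - r) r with ht | ht
  · have h1 : 0 ≤ r ^ (p - 2) * (r ^ 2 - (s - r) ^ 2) := mul_nonneg hP.le (by nlinarith)
    have h2 : 0 ≤ (r ^ (p - 2) - d ^ (p - 2)) * d ^ 2 :=
      mul_nonneg (sub_nonneg.2 hDP) (sq_nonneg d)
    have h3 : 0 ≤ r ^ (p - 2) * (r * (d - r)) :=
      mul_nonneg hP.le (mul_nonneg hr.le (sub_nonneg.2 hrd.le))
    linarith
  · obtain ⟨t, rfl⟩ : ∃ t, s = r + t := ⟨s - r, by ring⟩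
    have hrt : r < t := by linarith
    have ht0 : 0 < t := hr.trans hrt
    have htd : t ≤ d := abs_le_of_sq_le_sq' (by nlinarith) hd0.le |>.2
    have h1 : 0 ≤ ((r + t) ^ (p - 2) * (r + t) - t ^ (p - 2) * t) * t :=
      mul_nonneg (sub_nonneg.2 (hmono t _ ht0 (by linarith))) ht0.le
    have h2 : 0 ≤ (t ^ (p - 2) * t - r ^ (p - 2) * r) * t :=
      mul_nonneg (sub_nonneg.2 (hmono r t hr hrt.le)) ht0.le
    have h3 : 0 ≤ (t ^ (p - 2) - d ^ (p - 2)) * d ^ 2 :=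
      mul_nonneg (sub_nonneg.2 (hanti t d ht0 htd)) (sq_nonneg d)
    have h4 : 0 ≤ (r ^ (p - 2) - t ^ (p - 2)) * (d ^ 2 - t ^ 2) :=
      mul_nonneg (sub_nonneg.2 (hanti r t hr hrt.le)) (by nlinarith)
    have h5 : 0 ≤ r ^ (p - 2) * r * (d - t) :=
      mul_nonneg (mul_nonneg hP.le hr.le) (sub_nonneg.2 htd)
    linarith

/-- For `1 < p ≤ 2` and `|b − a| > M > |a|`,
`⟨|b|^{p-2} b − |a|^{p-2} a, b − a⟩ ≥ 2^{p-3}(1 − (|a|/M)^{p-1}) |b−a|^p`. -/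
theorem monotonicity_large_increment (p : ℝ) (hp1 : 1 < p) (hp2 : p ≤ 2)
    (n : ℕ) (hn : 1 ≤ n) (M : ℝ) (hM : 0 < M)
    (a b : EuclideanSpace ℝ (Fin n)) (hab : M < ‖b - a‖) (haM : ‖a‖ < M) :
    ⟪‖b‖ ^ (p - 2) • b - ‖a‖ ^ (p - 2) • a, b - a⟫ ≥
      2 ^ (p - 3) * (1 - (‖a‖ / M) ^ (p - 1)) * ‖b - a‖ ^ p := by
  have hc : (2 : ℝ) ^ (p - 3) ≤ 1 / 2 := by
    calc (2 : ℝ) ^ (p - 3) ≤ 2 ^ (-1 : ℝ) :=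
          Real.rpow_le_rpow_of_exponent_le one_le_two (by linarith)
      _ = 1 / 2 := by rw [Real.rpow_neg_one]; norm_num
  have hd : 0 < ‖b - a‖ := hM.trans hab
  have hfactor : 0 ≤ 1 - (‖a‖ / M) ^ (p - 1) :=
    sub_nonneg.2 <| Real.rpow_le_one (by positivity) ((div_le_one hM).2 haM.le) (by linarith)
  have hpow : ∀ x : ℝ, 0 < x → x ^ p = x ^ (p - 2) * x ^ 2 := fun x hx => by
    rw [← Real.rpow_natCast x 2, ← Real.rpow_add hx]; congr 1; push_cast; ring
  have hhalf : 2 ^ (p - 3) * (1 - (‖a‖ / M) ^ (p - 1)) * ‖b - a‖ ^ p ≤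
      1 / 2 * (1 - (‖a‖ / M) ^ (p - 1)) * ‖b - a‖ ^ p := by gcongr
  refine hhalf.trans ?_
  rcases eq_or_ne a 0 with rfl | ha
  · rw [norm_zero, zero_div, Real.zero_rpow (by linarith), smul_zero, sub_zero, sub_zero, sub_zero,
      real_inner_smul_left, real_inner_self_eq_norm_sq]
    rw [sub_zero] at hd
    rw [← hpow _ hd]
    have := Real.rpow_pos_of_pos hd p
    linarith
  have hr : 0 < ‖a‖ := norm_pos_iff.2 ha
  have hs : 0 < ‖b‖ := by
    refine norm_pos_iff.2 ?_
    rintro rfl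
    rw [zero_sub, norm_neg] at hab
    exact hab.not_gt haM
  have hgap := half_mul_le_monotonicity_gap hp1 hp2 hr hs (haM.trans hab)
    (i := ⟪a, b⟫) (by rw [norm_sub_sq_real, real_inner_comm]; ring)
    ((real_inner_le_norm a b).trans_eq (mul_comm _ _))
  have hinner : ⟪‖b‖ ^ (p - 2) • b - ‖a‖ ^ (p - 2) • a, b - a⟫ =
      ‖b‖ ^ (p - 2) * ‖b‖ ^ 2 + ‖a‖ ^ (p - 2) * ‖a‖ ^ 2 -
        (‖b‖ ^ (p - 2) + ‖a‖ ^ (p - 2)) * ⟪a, b⟫ := by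
    simp only [inner_sub_left, inner_sub_right, real_inner_smul_left,
      real_inner_self_eq_norm_sq, real_inner_comm a b]
    ring
  rw [hinner]
  refine le_trans ?_ hgap
  have hratio : (‖a‖ / ‖b - a‖) ^ (p - 1) ≤ (‖a‖ / M) ^ (p - 1) :=
    Real.rpow_le_rpow (by positivity) (by gcongr) (by linarith)
  have hscale : (‖a‖ / ‖b - a‖) ^ (p - 1) * ‖b - a‖ ^ p =
      ‖a‖ ^ (p - 2) * ‖a‖ * ‖b - a‖ := by
    rw [Real.div_rpow hr.le hd.le, ← Real.rpow_add_one hr.ne',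
      show p - 2 + 1 = p - 1 by ring, div_mul_eq_mul_div, mul_div_assoc,
      ← Real.rpow_sub hd, show p - (p - 1) = 1 by ring, Real.rpow_one]
  have := mul_le_mul_of_nonneg_right hratio (Real.rpow_nonneg hd.le p)
  rw [← hpow _ hd, ← hscale]
  linarith
end

section
/- Let p ≥ 2 and n ≥ 1. For all vectors a, b ∈ ℝⁿ one has (1/2) (|a|^{p-2} + |b|^{p-2}) |a − b|² ≤ ⟨|a|^{p-2} a − |b|^{p-2} b, a − b⟩. -/
open scoped RealInnerProductSpace

/-- For `p ≥ 2`,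
`(1/2)(|a|^{p-2} + |b|^{p-2}) |a−b|² ≤ ⟨|a|^{p-2} a − |b|^{p-2} b, a − b⟩`. -/
theorem mean_pow_le_inner (p : ℝ) (hp : 2 ≤ p) (n : ℕ) (hn : 1 ≤ n)
    (a b : EuclideanSpace ℝ (Fin n)) :
    (1 / 2) * (‖a‖ ^ (p - 2) + ‖b‖ ^ (p - 2)) * ‖a - b‖ ^ 2 ≤
      ⟪‖a‖ ^ (p - 2) • a - ‖b‖ ^ (p - 2) • b, a - b⟫ := by
  have hmono : 0 ≤ (‖a‖ ^ (p - 2) - ‖b‖ ^ (p - 2)) * (‖a‖ ^ 2 - ‖b‖ ^ 2) := by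
    have hp' : 0 ≤ p - 2 := sub_nonneg.2 hp
    rcases le_total ‖a‖ ‖b‖ with h | h
    · exact mul_nonneg_of_nonpos_of_nonpos
        (sub_nonpos.2 (Real.rpow_le_rpow (norm_nonneg a) h hp'))
        (sub_nonpos.2 (pow_le_pow_left₀ (norm_nonneg a) h 2))
    · exact mul_nonneg
        (sub_nonneg.2 (Real.rpow_le_rpow (norm_nonneg b) h hp'))
        (sub_nonneg.2 (pow_le_pow_left₀ (norm_nonneg b) h 2))
  rw [norm_sub_sq_real]
  simp only [inner_sub_left, inner_sub_right, real_inner_smul_left,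
    real_inner_self_eq_norm_sq, real_inner_comm a b]
  linarith
end

section
/- (Homogeneous Korn inequality on a periodic strip.) Let 1 < p < ∞. There exists a constant C > 0, depending only on p, such that for every a ∈ ℝ and every map u : ℝ² → ℝ² which is continuously differentiable and 1-periodic in its first variable (u(y₁+1, y₂) = u(y₁, y₂) for all y), one has ∫_{S_a} ‖∇u(y)‖_F^p dy ≤ C ∫_{S_a} ‖Du(y)‖_F^p dy, where S_a = (0,1) × (a, a+1). In particular the constant C does not depend on a. -/
open MeasureTheory Matrix

/-- The Jacobian matrix of a map `u : ℝ² → ℝ²`: entry `(i, j)` is `∂uᵢ/∂yⱼ`. -/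
noncomputable def jacMat (u : ℝ × ℝ → ℝ × ℝ) (y : ℝ × ℝ) : Matrix (Fin 2) (Fin 2) ℝ :=
  !![(fderiv ℝ u y (1, 0)).1, (fderiv ℝ u y (0, 1)).1;
     (fderiv ℝ u y (1, 0)).2, (fderiv ℝ u y (0, 1)).2]

/-- The symmetric part `(A + Aᵀ)/2` of a 2×2 matrix. -/
noncomputable def symPart (A : Matrix (Fin 2) (Fin 2) ℝ) : Matrix (Fin 2) (Fin 2) ℝ :=
  (1 / 2 : ℝ) • (A + Aᵀ)

/-- The Frobenius norm of a 2×2 matrix. -/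
noncomputable def frobNorm (A : Matrix (Fin 2) (Fin 2) ℝ) : ℝ :=
  Real.sqrt (∑ i, ∑ j, (A i j) ^ 2)

open Filter Topology

/-- Second derivative of a `C²` function in direction `w`, computed along a line. -/
theorem fderiv_fderiv_apply_of_line {Φ : ℂ → ℝ} (hΦ : ContDiff ℝ 2 Φ) (z w : ℂ)
    {g₁ : ℝ → ℝ} {g₂ : ℝ}
    (h₁ : ∀ τ : ℝ, HasDerivAt (fun τ : ℝ => Φ (z + τ * w)) (g₁ τ) τ) (h₂ : HasDerivAt g₁ g₂ 0) :
    fderiv ℝ (fderiv ℝ Φ) z w w = g₂ := by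
  have hline : ∀ τ : ℝ, HasDerivAt (fun τ : ℝ => z + τ * w) w τ := fun τ => by
    simpa using ((Complex.ofRealCLM.hasDerivAt (x := τ)).mul_const w).const_add z
  have hd : Differentiable ℝ Φ := hΦ.differentiable (by norm_num)
  have hd2 : Differentiable ℝ (fderiv ℝ Φ) :=
    (hΦ.fderiv_right (m := 1) (by norm_num)).differentiable (by norm_num)
  have e₁ : ∀ τ : ℝ, g₁ τ = fderiv ℝ Φ (z + τ * w) w := fun τ =>
    (h₁ τ).unique ((hd _).hasFDerivAt.comp_hasDerivAt τ (hline τ))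
  have h3 : HasDerivAt (fun τ : ℝ => fderiv ℝ Φ (z + τ * w)) (fderiv ℝ (fderiv ℝ Φ) z w) 0 := by
    have := (hd2 (z + (0:ℝ) * w)).hasFDerivAt.comp_hasDerivAt (0:ℝ) (hline 0)
    rw [show z + ((0:ℝ) : ℂ) * w = z by simp] at this
    exact this
  have h4 : HasDerivAt g₁ (fderiv ℝ (fderiv ℝ Φ) z w w) 0 := by
    have := h3.clm_apply (hasDerivAt_const (0:ℝ) w)
    rw [funext e₁]
    simpa using this
  exact h4.unique h₂

theorem contDiff_quad_rpow {ε : ℝ} (hε : 0 < ε) (b s : ℝ) (hb : 0 ≤ b) :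
    ContDiff ℝ 2 (fun z : ℂ => (z.re ^ 2 + b * z.im ^ 2 + ε) ^ s) := by
  have h1 : ContDiff ℝ 2 (fun z : ℂ => z.re) := Complex.reCLM.contDiff
  have h2 : ContDiff ℝ 2 (fun z : ℂ => z.im) := Complex.imCLM.contDiff
  exact ContDiff.rpow_const_of_ne (by fun_prop) (fun z => by positivity)

/-- Second directional derivatives of `(x² + b y² + ε) ^ s`, in one variable. -/
theorem hasDerivAt_quad_rpow {ε : ℝ} (hε : 0 < ε) (b s : ℝ) (hb : 0 ≤ b) (x y u v τ : ℝ) :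
    HasDerivAt (fun τ : ℝ => ((x + τ * u) ^ 2 + b * (y + τ * v) ^ 2 + ε) ^ s)
      (s * ((x + τ * u) ^ 2 + b * (y + τ * v) ^ 2 + ε) ^ (s - 1) *
        (2 * (x + τ * u) * u + b * (2 * (y + τ * v) * v))) τ := by
  have hx : HasDerivAt (fun τ : ℝ => x + τ * u) u τ := by
    simpa using ((hasDerivAt_id τ).mul_const u).const_add x
  have hy : HasDerivAt (fun τ : ℝ => y + τ * v) v τ := by
    simpa using ((hasDerivAt_id τ).mul_const v).const_add y
  have := ((((hx.pow 2).add ((hy.pow 2).const_mul b)).add_const ε).rpow_const (p := s)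
    (Or.inl (by simp; positivity)))
  convert! this using 1
  simp
  ring

/-- The sum of the second derivatives of `(x² + b y² + ε) ^ s` in directions `w` and `i w`. -/
theorem hasDerivAt_quad_rpow_snd {ε : ℝ} (hε : 0 < ε) (b s : ℝ) (hb : 0 ≤ b) (x y u v : ℝ) :
    HasDerivAt (fun τ : ℝ => s * ((x + τ * u) ^ 2 + b * (y + τ * v) ^ 2 + ε) ^ (s - 1) *
        (2 * (x + τ * u) * u + b * (2 * (y + τ * v) * v)))
      (s * (s - 1) * (x ^ 2 + b * y ^ 2 + ε) ^ (s - 2) * (2 * x * u + b * (2 * y * v)) ^ 2 +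
        s * (x ^ 2 + b * y ^ 2 + ε) ^ (s - 1) * (2 * u ^ 2 + b * (2 * v ^ 2))) 0 := by
  have hx : HasDerivAt (fun τ : ℝ => x + τ * u) u 0 := by
    simpa using ((hasDerivAt_id (0:ℝ)).mul_const u).const_add x
  have hy : HasDerivAt (fun τ : ℝ => y + τ * v) v 0 := by
    simpa using ((hasDerivAt_id (0:ℝ)).mul_const v).const_add y
  have h1 := (hasDerivAt_quad_rpow hε b (s - 1) hb x y u v 0).const_mul s
  have h2 := ((hx.const_mul 2).mul_const u).add (((hy.const_mul 2).mul_const v).const_mul b)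
  have := h1.mul h2
  convert! this using 1
  simp [show s - 1 - 1 = s - 2 by ring]
  ring

/-- Laplacian of `(x² + b y² + ε) ^ s`, for `b = 1` and `b = 0`. -/
theorem lap_quad_rpow {ε : ℝ} (hε : 0 < ε) (b s : ℝ) (hb : 0 ≤ b) (z w : ℂ) :
    fderiv ℝ (fderiv ℝ (fun z : ℂ => (z.re ^ 2 + b * z.im ^ 2 + ε) ^ s)) z w w =
      s * (s - 1) * (z.re ^ 2 + b * z.im ^ 2 + ε) ^ (s - 2) *
          (2 * z.re * w.re + b * (2 * z.im * w.im)) ^ 2 +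
        s * (z.re ^ 2 + b * z.im ^ 2 + ε) ^ (s - 1) * (2 * w.re ^ 2 + b * (2 * w.im ^ 2)) := by
  refine fderiv_fderiv_apply_of_line (contDiff_quad_rpow hε b s hb) z w (fun τ => ?_)
    (hasDerivAt_quad_rpow_snd hε b s hb z.re z.im w.re w.im)
  simpa using hasDerivAt_quad_rpow hε b s hb z.re z.im w.re w.im τ

theorem lap_mul_quad_rpow {ε : ℝ} (hε : 0 < ε) (s : ℝ) (z w : ℂ) :
    fderiv ℝ (fderiv ℝ (fun z : ℂ => (z.re ^ 2 + ε) * (z.re ^ 2 + 1 * z.im ^ 2 + ε) ^ s)) z w w =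
      2 * w.re ^ 2 * (z.re ^ 2 + 1 * z.im ^ 2 + ε) ^ s +
      2 * (2 * z.re * w.re) * (s * (z.re ^ 2 + 1 * z.im ^ 2 + ε) ^ (s - 1) *
        (2 * z.re * w.re + 1 * (2 * z.im * w.im))) +
      (z.re ^ 2 + ε) * (s * (s - 1) * (z.re ^ 2 + 1 * z.im ^ 2 + ε) ^ (s - 2) *
          (2 * z.re * w.re + 1 * (2 * z.im * w.im)) ^ 2 +
        s * (z.re ^ 2 + 1 * z.im ^ 2 + ε) ^ (s - 1) * (2 * w.re ^ 2 + 1 * (2 * w.im ^ 2))) := by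
  have hx : ∀ τ : ℝ, HasDerivAt (fun τ : ℝ => z.re + τ * w.re) w.re τ := fun τ => by
    simpa using ((hasDerivAt_id τ).mul_const w.re).const_add z.re
  have h0 : ContDiff ℝ 2 (fun z : ℂ => z.re ^ 2 + ε) := by
    have h1 : ContDiff ℝ 2 (fun z : ℂ => z.re) := Complex.reCLM.contDiff
    fun_prop
  refine fderiv_fderiv_apply_of_line (h0.mul (contDiff_quad_rpow hε 1 s zero_le_one)) z w
    (g₁ := fun τ => (2 * (z.re + τ * w.re) * w.re) *
        ((z.re + τ * w.re) ^ 2 + 1 * (z.im + τ * w.im) ^ 2 + ε) ^ s +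
      ((z.re + τ * w.re) ^ 2 + ε) *
        (s * ((z.re + τ * w.re) ^ 2 + 1 * (z.im + τ * w.im) ^ 2 + ε) ^ (s - 1) *
        (2 * (z.re + τ * w.re) * w.re + 1 * (2 * (z.im + τ * w.im) * w.im))))
    (fun τ => ?_) ?_
  · have := (((hx τ).pow 2).add_const ε).mul
      (hasDerivAt_quad_rpow hε 1 s zero_le_one z.re z.im w.re w.im τ)
    convert! this using 1
    · ext τ; simp
    · simp
  · have A := (((hx 0).const_mul 2).mul_const w.re).mul
      (hasDerivAt_quad_rpow hε 1 s zero_le_one z.re z.im w.re w.im 0)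
    have B := (((hx 0).pow 2).add_const ε).mul
      (hasDerivAt_quad_rpow_snd hε 1 s zero_le_one z.re z.im w.re w.im)
    convert! A.add B using 1
    simp
    ring

/-- `C²` real-valued functions on `ℂ` with nonnegative Laplacian (tested on all directions). -/
def IsSubharmonicC2 (Φ : ℂ → ℝ) : Prop :=
  ContDiff ℝ 2 Φ ∧ ∀ z w : ℂ, 0 ≤ fderiv ℝ (fderiv ℝ Φ) z w w +
    fderiv ℝ (fderiv ℝ Φ) z (Complex.I * w) (Complex.I * w)

theorem fderiv_fderiv_const_mul_sub {f g : ℂ → ℝ} (hf : ContDiff ℝ 2 f) (hg : ContDiff ℝ 2 g)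
    (K : ℝ) (z w : ℂ) :
    fderiv ℝ (fderiv ℝ (fun z => K * f z - g z)) z w w =
      K * fderiv ℝ (fderiv ℝ f) z w w - fderiv ℝ (fderiv ℝ g) z w w := by
  have hf1 : Differentiable ℝ f := hf.differentiable (by norm_num)
  have hg1 : Differentiable ℝ g := hg.differentiable (by norm_num)
  have hf2 : Differentiable ℝ (fderiv ℝ f) :=
    (hf.fderiv_right (m := 1) (by norm_num)).differentiable (by norm_num)
  have hg2 : Differentiable ℝ (fderiv ℝ g) :=
    (hg.fderiv_right (m := 1) (by norm_num)).differentiable (by norm_num)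
  have h1 : fderiv ℝ (fun z => K * f z - g z) = fun z => K • fderiv ℝ f z - fderiv ℝ g z := by
    ext1 z
    exact (((hf1 z).hasFDerivAt.const_mul K).sub (hg1 z).hasFDerivAt).fderiv
  have h2 : fderiv ℝ (fun z => K • fderiv ℝ f z - fderiv ℝ g z) z =
      K • fderiv ℝ (fderiv ℝ f) z - fderiv ℝ (fderiv ℝ g) z :=
    (((hf2 z).hasFDerivAt.const_smul K).sub (hg2 z).hasFDerivAt).fderiv
  rw [h1, h2]
  simp

theorem exists_subharmonic_of_le_two {q : ℝ} (hq : 1 < q) (hq2 : q ≤ 2) :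
    ∃ K : ℝ, 0 ≤ K ∧ ∀ ε : ℝ, 0 < ε → ∃ Φ : ℂ → ℝ, IsSubharmonicC2 Φ ∧ (∀ x : ℝ, 0 ≤ Φ x) ∧
      ∀ z : ℂ, Φ z ≤ K * (z.re ^ 2 + ε) ^ (q / 2) -
        1 / 2 * (z.re ^ 2 + z.im ^ 2 + ε) ^ (q / 2) := by
  obtain ⟨s, rfl⟩ : ∃ s, q = 2 * s := ⟨q / 2, by ring⟩
  have hs : 0 < 2 * s - 1 := by linarith
  refine ⟨2 / (2 * s - 1), by positivity, fun ε hε => ?_⟩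
  have hc0 := contDiff_quad_rpow hε 0 s le_rfl
  have hc1 := contDiff_quad_rpow hε 1 s zero_le_one
  have hK : 1 ≤ 2 / (2 * s - 1) := by rw [le_div_iff₀ hs]; linarith
  refine ⟨fun z => 2 / (2 * s - 1) * (z.re ^ 2 + 0 * z.im ^ 2 + ε) ^ s -
    (z.re ^ 2 + 1 * z.im ^ 2 + ε) ^ s, ⟨?_, fun z w => ?_⟩, fun x => ?_, fun z => ?_⟩
  · exact (contDiff_const.mul hc0).sub hc1
  · rw [fderiv_fderiv_const_mul_sub hc0 hc1, fderiv_fderiv_const_mul_sub hc0 hc1]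
    simp only [lap_quad_rpow hε _ _ le_rfl, lap_quad_rpow hε _ _ zero_le_one]
    obtain ⟨x, y⟩ := z
    obtain ⟨u, v⟩ := w
    simp only [Complex.mul_re, Complex.mul_im, Complex.I_re, Complex.I_im]
    have hX : 0 < x ^ 2 + 0 * y ^ 2 + ε := by positivity
    have hR : 0 < x ^ 2 + 1 * y ^ 2 + ε := by positivity
    have hXR : (x ^ 2 + 1 * y ^ 2 + ε) ^ (s - 1) ≤ (x ^ 2 + 0 * y ^ 2 + ε) ^ (s - 1) :=
      Real.rpow_le_rpow_of_nonpos hX (by nlinarith [sq_nonneg y]) (by linarith)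
    have eX : (x ^ 2 + 0 * y ^ 2 + ε) ^ (s - 1) =
        (x ^ 2 + 0 * y ^ 2 + ε) ^ (s - 2) * (x ^ 2 + 0 * y ^ 2 + ε) := by
      rw [← Real.rpow_add_one hX.ne']; congr 1; ring
    have pX := Real.rpow_pos_of_pos hX (s - 2)
    have pX1 := Real.rpow_pos_of_pos hX (s - 1)
    have pR := Real.rpow_pos_of_pos hR (s - 2)
    generalize (x ^ 2 + 0 * y ^ 2 + ε) ^ (s - 2) = A at *
    generalize (x ^ 2 + 0 * y ^ 2 + ε) ^ (s - 1) = A1 at *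
    generalize (x ^ 2 + 1 * y ^ 2 + ε) ^ (s - 2) = B at *
    generalize (x ^ 2 + 1 * y ^ 2 + ε) ^ (s - 1) = B1 at *
    have hu : 0 ≤ u ^ 2 + v ^ 2 := by positivity
    have hlow : (2 * s - 1) * A1 ≤ A * (2 * (s - 1) * x ^ 2) + A1 := by
      rw [eX]; nlinarith [mul_nonneg pX.le (mul_nonneg (by linarith : 0 ≤ 1 - s) hε.le)]
    have h2 : 2 / (2 * s - 1) * ((2 * s - 1) * A1) = 2 * A1 := by field_simp
    have h3 := mul_le_mul_of_nonneg_left hlow (by positivity : 0 ≤ 2 / (2 * s - 1))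
    have h4 : 0 ≤ (1 - s) * B * (4 * (x ^ 2 + y ^ 2)) :=
      mul_nonneg (mul_nonneg (by linarith) pR.le) (by positivity)
    have h5 : 0 ≤ 2 * s * (u ^ 2 + v ^ 2) *
        (2 / (2 * s - 1) * (A * (2 * (s - 1) * x ^ 2) + A1) - 2 * B1) :=
      mul_nonneg (mul_nonneg (by linarith) hu) (by linarith)
    have h6 := mul_nonneg (mul_nonneg (by linarith : 0 ≤ s) hu) h4
    generalize 2 / (2 * s - 1) = K at *
    linarith
  · have : 0 ≤ (x ^ 2 + 0 * 0 ^ 2 + ε) ^ s := by positivity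
    simp at this ⊢
    nlinarith
  · have : 0 ≤ (z.re ^ 2 + 1 * z.im ^ 2 + ε) ^ s := by positivity
    simp at this ⊢
    linarith

theorem exists_subharmonic_of_two_le {q : ℝ} (hq2 : 2 ≤ q) :
    ∃ K : ℝ, 0 ≤ K ∧ ∀ ε : ℝ, 0 < ε → ∃ Φ : ℂ → ℝ, IsSubharmonicC2 Φ ∧ (∀ x : ℝ, 0 ≤ Φ x) ∧
      ∀ z : ℂ, Φ z ≤ K * (z.re ^ 2 + ε) ^ (q / 2) -
        1 / 2 * (z.re ^ 2 + z.im ^ 2 + ε) ^ (q / 2) := by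
  obtain ⟨s, rfl⟩ : ∃ s, q = 2 * s := ⟨q / 2, by ring⟩
  have hs : 0 ≤ s - 1 := by linarith
  refine ⟨2 * s ^ 2 * (2 * (2 * s ^ 2)) ^ (s - 1), by positivity, fun ε hε => ?_⟩
  have h0 : ContDiff ℝ 2 (fun z : ℂ => z.re ^ 2 + ε) := by
    have h1 : ContDiff ℝ 2 (fun z : ℂ => z.re) := Complex.reCLM.contDiff
    fun_prop
  have hc0 := h0.mul (contDiff_quad_rpow hε 1 (s - 1) zero_le_one)
  have hc1 := contDiff_quad_rpow hε 1 s zero_le_one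
  refine ⟨fun z => 2 * s ^ 2 * ((z.re ^ 2 + ε) * (z.re ^ 2 + 1 * z.im ^ 2 + ε) ^ (s - 1)) -
    (z.re ^ 2 + 1 * z.im ^ 2 + ε) ^ s, ⟨?_, fun z w => ?_⟩, fun x => ?_, fun z => ?_⟩
  · exact (contDiff_const.mul hc0).sub hc1
  · rw [fderiv_fderiv_const_mul_sub hc0 hc1, fderiv_fderiv_const_mul_sub hc0 hc1]
    simp only [lap_quad_rpow hε _ _ zero_le_one, lap_mul_quad_rpow hε]
    obtain ⟨x, y⟩ := z
    obtain ⟨u, v⟩ := w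
    simp only [Complex.mul_re, Complex.mul_im, Complex.I_re, Complex.I_im]
    have hR : 0 < x ^ 2 + 1 * y ^ 2 + ε := by positivity
    have e1 : (x ^ 2 + 1 * y ^ 2 + ε) ^ (s - 1) = (x ^ 2 + 1 * y ^ 2 + ε) ^ (s - 1 - 2) *
        (x ^ 2 + 1 * y ^ 2 + ε) ^ 2 := by
      rw [← Real.rpow_add_natCast hR.ne']; congr 1; push_cast; ring
    have e2 : (x ^ 2 + 1 * y ^ 2 + ε) ^ (s - 2) = (x ^ 2 + 1 * y ^ 2 + ε) ^ (s - 1 - 2) *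
        (x ^ 2 + 1 * y ^ 2 + ε) := by
      rw [← Real.rpow_add_one hR.ne']; congr 1; ring
    have e3 : (x ^ 2 + 1 * y ^ 2 + ε) ^ (s - 1 - 1) = (x ^ 2 + 1 * y ^ 2 + ε) ^ (s - 1 - 2) *
        (x ^ 2 + 1 * y ^ 2 + ε) := by
      rw [← Real.rpow_add_one hR.ne']; congr 1; ring
    have pB := Real.rpow_pos_of_pos hR (s - 1 - 2)
    rw [e1, e2, e3]
    clear e1 e2 e3
    generalize (x ^ 2 + 1 * y ^ 2 + ε) ^ (s - 1 - 2) = B at *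
    obtain ⟨R, hRdef⟩ : ∃ R, R = x ^ 2 + 1 * y ^ 2 + ε := ⟨_, rfl⟩
    have hx2 : x ^ 2 = R - y ^ 2 - ε := by rw [hRdef]; ring
    obtain ⟨r, rfl⟩ : ∃ r, s = r + 1 := ⟨s - 1, by ring⟩
    have hr : 0 ≤ r := by linarith
    rw [← hRdef] at hR ⊢
    have hN : 0 ≤ u ^ 2 + v ^ 2 := by positivity
    have t1 : 0 ≤ B * (u ^ 2 + v ^ 2) := by positivity
    have key : 0 ≤ B * (u ^ 2 + v ^ 2) * (2 * (r + 1) ^ 2 *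
        (2 * R ^ 2 + 8 * r * x ^ 2 * R + (x ^ 2 + ε) *
          (4 * r * (r - 1) * (x ^ 2 + y ^ 2) + 4 * r * R)) -
        (4 * (r + 1) * r * (x ^ 2 + y ^ 2) * R + 4 * (r + 1) * R ^ 2)) := by
      refine mul_nonneg t1 ?_
      have hz : x ^ 2 + y ^ 2 = R - ε := by rw [hRdef]; ring
      rw [hz]
      have a1 : 0 ≤ r * (r - 1) * (R - ε) + r * R := by
        have : 0 ≤ R - ε := by rw [← hz]; positivity
        have := mul_nonneg (mul_nonneg hr hr) this
        nlinarith [mul_nonneg hr hε.le]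
      have a2 : 0 ≤ (x ^ 2 + ε) * (r * (r - 1) * (R - ε) + r * R) := by positivity
      have a3 : 0 ≤ r * x ^ 2 * R := by positivity
      have a4 : 0 ≤ (r + 1) * r * ε * R := by positivity
      have a5 : 0 ≤ 2 * (r + 1) ^ 2 * (8 * (r * x ^ 2 * R) + 4 * ((x ^ 2 + ε) *
          (r * (r - 1) * (R - ε) + r * R))) := by positivity
      linarith
    linarith
  · have hR : 0 < x ^ 2 + ε := by positivity
    have e1 : (x ^ 2 + ε) ^ s = (x ^ 2 + ε) * (x ^ 2 + ε) ^ (s - 1) := by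
      rw [← Real.rpow_one_add' hR.le (by linarith)]; congr 1; ring
    have : 0 ≤ (x ^ 2 + ε) ^ s := by positivity
    simp at this ⊢
    rw [← e1]
    have h1 : 1 ≤ 2 * s ^ 2 := by nlinarith
    exact le_mul_of_one_le_left this h1
  · dsimp only
    have hR : 0 < z.re ^ 2 + 1 * z.im ^ 2 + ε := by positivity
    have hX : 0 < z.re ^ 2 + ε := by positivity
    have e1 : (z.re ^ 2 + 1 * z.im ^ 2 + ε) ^ s =
        (z.re ^ 2 + 1 * z.im ^ 2 + ε) * (z.re ^ 2 + 1 * z.im ^ 2 + ε) ^ (s - 1) := by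
      rw [← Real.rpow_one_add' hR.le (by linarith)]; congr 1; ring
    have e2 : (z.re ^ 2 + ε) ^ s = (z.re ^ 2 + ε) * (z.re ^ 2 + ε) ^ (s - 1) := by
      rw [← Real.rpow_one_add' hX.le (by linarith)]; congr 1; ring
    have pR1 := Real.rpow_pos_of_pos hR (s - 1)
    have pX1 := Real.rpow_pos_of_pos hX (s - 1)
    have hKp : 0 < 2 * s ^ 2 := by nlinarith
    rw [show 2 * s / 2 = s by ring]
    rw [show z.re ^ 2 + z.im ^ 2 + ε = z.re ^ 2 + 1 * z.im ^ 2 + ε by ring]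
    generalize z.re ^ 2 + 1 * z.im ^ 2 + ε = R at *
    generalize z.re ^ 2 + ε = X at *
    generalize 2 * s ^ 2 = K at *
    suffices K * (X * R ^ (s - 1)) ≤ K * (2 * K) ^ (s - 1) * X ^ s + 1 / 2 * R ^ s by linarith
    rcases le_total (2 * K * X) R with h | h
    · have : 0 ≤ K * (2 * K) ^ (s - 1) * X ^ s := by positivity
      rw [e1]
      nlinarith
    · have h1 : R ^ (s - 1) ≤ (2 * K * X) ^ (s - 1) := Real.rpow_le_rpow hR.le h hs
      rw [Real.mul_rpow (by positivity) hX.le] at h1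
      have : 0 ≤ R ^ s := by positivity
      rw [e2]
      have := mul_le_mul_of_nonneg_left h1 (by positivity : 0 ≤ K * X)
      linarith

theorem exists_subharmonic {q : ℝ} (hq : 1 < q) :
    ∃ K : ℝ, 0 ≤ K ∧ ∀ ε : ℝ, 0 < ε → ∃ Φ : ℂ → ℝ, IsSubharmonicC2 Φ ∧ (∀ x : ℝ, 0 ≤ Φ x) ∧
      ∀ z : ℂ, Φ z ≤ K * (z.re ^ 2 + ε) ^ (q / 2) -
        1 / 2 * (z.re ^ 2 + z.im ^ 2 + ε) ^ (q / 2) :=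
  (le_total q 2).elim (exists_subharmonic_of_le_two hq) exists_subharmonic_of_two_le

theorem hasDerivAt_integral_of_continuous {X : Type*} [TopologicalSpace X] [CompactSpace X]
    [MeasurableSpace X] [BorelSpace X] (μ : Measure X) [IsFiniteMeasure μ] {G G₁ : ℝ → X → ℝ}
    (hG : Continuous (Function.uncurry G)) (hG₁ : Continuous (Function.uncurry G₁))
    (h : ∀ t x, HasDerivAt (fun t => G t x) (G₁ t x) t) (t : ℝ) :
    HasDerivAt (fun t => ∫ x, G t x ∂μ) (∫ x, G₁ t x ∂μ) t := by
  have hGt : ∀ t, Continuous (G t) := fun t => hG.comp (Continuous.prodMk_right t)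
  have hG₁t : ∀ t, Continuous (G₁ t) := fun t => hG₁.comp (Continuous.prodMk_right t)
  have hcomp : IsCompact (Metric.closedBall t 1 ×ˢ (Set.univ : Set X)) :=
    (isCompact_closedBall t 1).prod isCompact_univ
  obtain ⟨B, hB⟩ := hcomp.exists_bound_of_continuousOn hG₁.continuousOn
  refine (hasDerivAt_integral_of_dominated_loc_of_deriv_le (bound := fun _ => B)
    (Metric.ball_mem_nhds t one_pos)
    (Eventually.of_forall fun t => (hGt t).aestronglyMeasurable)
    ((hGt t).integrable_of_hasCompactSupport (HasCompactSupport.of_compactSpace _))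
    (hG₁t t).aestronglyMeasurable
    (Eventually.of_forall fun x s hs => hB (s, x) ⟨Metric.ball_subset_closedBall hs, trivial⟩)
    (integrable_const _) (Eventually.of_forall fun x s _ => h s x)).2

/-- A convex function on `ℝ` with a finite limit at `+∞` stays above that limit. -/
theorem le_of_tendsto_of_deriv2_nonneg {M M₁ M₂ : ℝ → ℝ} (h₁ : ∀ s, HasDerivAt M (M₁ s) s)
    (h₂ : ∀ s, HasDerivAt M₁ (M₂ s) s) (hM₂ : ∀ s, 0 ≤ M₂ s) {l : ℝ}
    (hl : Tendsto M atTop (𝓝 l)) (s : ℝ) : l ≤ M s := by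
  have hmono : Monotone M₁ := monotone_of_deriv_nonneg (fun s => (h₂ s).differentiableAt)
    (fun s => by rw [(h₂ s).deriv]; exact hM₂ s)
  have hneg : ∀ s, M₁ s ≤ 0 := by
    intro s
    by_contra! hs
    have hge : ∀ t, s ≤ t → M s + M₁ s * (t - s) ≤ M t := by
      intro t hst
      have := (convex_Ici s).mul_sub_le_image_sub_of_le_deriv (f := M) (C := M₁ s)
        (fun x _ => (h₁ x).continuousAt.continuousWithinAt)
        (fun x _ => (h₁ x).differentiableAt.differentiableWithinAt)
        (fun x hx => by
          rw [(h₁ x).deriv]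
          exact hmono (interior_subset hx))
        s (Set.self_mem_Ici) t hst hst
      linarith
    have htop : Tendsto (fun t => M s + M₁ s * (t - s)) atTop atTop :=
      tendsto_atTop_add_const_left _ _
        ((tendsto_atTop_add_const_right _ _ tendsto_id).const_mul_atTop hs)
    exact not_tendsto_nhds_of_tendsto_atTop
      (tendsto_atTop_mono' _ ((eventually_ge_atTop s).mono hge) htop) _ hl
  have hanti : Antitone M := antitone_of_deriv_nonpos (fun s => (h₁ s).differentiableAt)
    (fun s => by rw [(h₁ s).deriv]; exact hneg s)
  exact hanti.le_of_tendsto hl s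

section Flow

variable {X ι : Type*}

/-- The holomorphic extension along a flow of a finite sum of eigenfunctions of that flow,
differentiated `k` times. -/
noncomputable def flowExt (s : Finset ι) (b : ι → X → ℂ) (m : ι → ℝ) (k : ℕ) (z : ℂ) (x : X) : ℂ :=
  ∑ i ∈ s, b i x * ((Complex.I * m i) ^ k * Complex.exp (Complex.I * m i * z))

theorem hasDerivAt_flowExt_line (s : Finset ι) (b : ι → X → ℂ) (m : ι → ℝ) (k : ℕ) (z d : ℂ)
    (x : X) (τ : ℝ) :
    HasDerivAt (fun τ : ℝ => flowExt s b m k (z + τ * d) x)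
      (flowExt s b m (k + 1) (z + τ * d) x * d) τ := by
  have hline : HasDerivAt (fun τ : ℝ => z + τ * d) d τ := by
    simpa using ((Complex.ofRealCLM.hasDerivAt (x := τ)).mul_const d).const_add z
  have : HasDerivAt (fun τ : ℝ => ∑ i ∈ s, b i x * ((Complex.I * m i) ^ k *
      Complex.exp (Complex.I * m i * (z + τ * d)))) (∑ i ∈ s, b i x * ((Complex.I * m i) ^ k *
      (Complex.exp (Complex.I * m i * (z + τ * d)) * (Complex.I * m i * d)))) τ :=
    HasDerivAt.fun_sum fun i _ => (((hline.const_mul _).cexp.const_mul _).const_mul _)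
  convert! this using 1
  simp only [flowExt, Finset.sum_mul]
  exact Finset.sum_congr rfl fun i _ => by ring

theorem continuous_flowExt [TopologicalSpace X] (s : Finset ι) {b : ι → X → ℂ}
    (hb : ∀ i, Continuous (b i)) (m : ι → ℝ) (k : ℕ) :
    Continuous (fun y : ℂ × X => flowExt s b m k y.1 y.2) := by
  unfold flowExt
  fun_prop

variable [TopologicalSpace X] [CompactSpace X] [MeasurableSpace X] [BorelSpace X]
  (μ : Measure X) [IsFiniteMeasure μ]

theorem hasDerivAt_integral_comp_flowExt (s : Finset ι) {b : ι → X → ℂ}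
    (hb : ∀ i, Continuous (b i)) (m : ι → ℝ) {Φ : ℂ → ℝ} (hΦ : ContDiff ℝ 2 Φ) (z d : ℂ) (τ : ℝ) :
    HasDerivAt (fun τ : ℝ => ∫ x, Φ (flowExt s b m 0 (z + τ * d) x) ∂μ)
      (∫ x, fderiv ℝ Φ (flowExt s b m 0 (z + τ * d) x) (flowExt s b m 1 (z + τ * d) x * d) ∂μ) τ ∧
    HasDerivAt (fun τ : ℝ => ∫ x, fderiv ℝ Φ (flowExt s b m 0 (z + τ * d) x)
        (flowExt s b m 1 (z + τ * d) x * d) ∂μ)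
      (∫ x, (fderiv ℝ (fderiv ℝ Φ) (flowExt s b m 0 (z + τ * d) x)
          (flowExt s b m 1 (z + τ * d) x * d) (flowExt s b m 1 (z + τ * d) x * d) +
        fderiv ℝ Φ (flowExt s b m 0 (z + τ * d) x)
          (flowExt s b m 2 (z + τ * d) x * d * d)) ∂μ) τ := by
  have hd : Differentiable ℝ Φ := hΦ.differentiable (by norm_num)
  have hC1 : ContDiff ℝ 1 (fderiv ℝ Φ) := hΦ.fderiv_right (m := 1) (by norm_num)
  have hd2 : Differentiable ℝ (fderiv ℝ Φ) := hC1.differentiable (by norm_num)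
  have c1 : Continuous (fderiv ℝ Φ) := hC1.continuous
  have c2 : Continuous (fderiv ℝ (fderiv ℝ Φ)) := hC1.continuous_fderiv (by norm_num)
  have hF : ∀ k, Continuous (fun y : ℝ × X => flowExt s b m k (z + y.1 * d) y.2) := fun k =>
    (continuous_flowExt s hb m k).comp
      (by fun_prop : Continuous fun y : ℝ × X => ((z + y.1 * d, y.2) : ℂ × X))
  have hF0 := hF 0
  have hF1 := hF 1
  have hF2 := hF 2
  have c0 := hΦ.continuous
  constructor
  · refine hasDerivAt_integral_of_continuous μ
      (G := fun τ x => Φ (flowExt s b m 0 (z + τ * d) x))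
      (G₁ := fun τ x => fderiv ℝ Φ (flowExt s b m 0 (z + τ * d) x)
        (flowExt s b m 1 (z + τ * d) x * d)) (c0.comp hF0) ?_ (fun t x => ?_) τ
    · exact (c1.comp hF0).clm_apply (hF1.mul continuous_const)
    · exact (hd _).hasFDerivAt.comp_hasDerivAt t (hasDerivAt_flowExt_line s b m 0 z d x t)
  · refine hasDerivAt_integral_of_continuous μ
      (G := fun τ x => fderiv ℝ Φ (flowExt s b m 0 (z + τ * d) x)
        (flowExt s b m 1 (z + τ * d) x * d))
      (G₁ := fun τ x => fderiv ℝ (fderiv ℝ Φ) (flowExt s b m 0 (z + τ * d) x)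
          (flowExt s b m 1 (z + τ * d) x * d) (flowExt s b m 1 (z + τ * d) x * d) +
        fderiv ℝ Φ (flowExt s b m 0 (z + τ * d) x)
          (flowExt s b m 2 (z + τ * d) x * d * d)) ?_ ?_ (fun t x => ?_) τ
    · exact (c1.comp hF0).clm_apply (hF1.mul continuous_const)
    · exact (((c2.comp hF0).clm_apply (hF1.mul continuous_const)).clm_apply
        (hF1.mul continuous_const)).add
        ((c1.comp hF0).clm_apply ((hF2.mul continuous_const).mul continuous_const))
    · exact ((hd2 _).hasFDerivAt.comp_hasDerivAt t
        (hasDerivAt_flowExt_line s b m 0 z d x t)).clm_apply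
        ((hasDerivAt_flowExt_line s b m 1 z d x t).mul_const d)

/-- If a measure-preserving flow acts on `b i` by the character `exp (i m i t)` with `m i ≥ 0`, then
the integral of a subharmonic function of `∑ b i` dominates that of the flow-invariant part. -/
theorem integral_subharmonic_flow_le (s : Finset ι) {b : ι → X → ℂ}
    (hb : ∀ i, Continuous (b i)) {m : ι → ℝ} (hm : ∀ i, 0 ≤ m i) (τ : ℝ → X → X)
    (hτ : ∀ (t : ℝ) (f : X → ℝ), ∫ x, f (τ t x) ∂μ = ∫ x, f x ∂μ)
    (hflow : ∀ i t x, b i (τ t x) = Complex.exp (Complex.I * m i * t) * b i x)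
    {Φ : ℂ → ℝ} (hΦ : IsSubharmonicC2 Φ) :
    ∫ x, Φ (∑ i ∈ s with m i = 0, b i x) ∂μ ≤ ∫ x, Φ (∑ i ∈ s, b i x) ∂μ := by
  have hD := hasDerivAt_integral_comp_flowExt μ s hb m hΦ.1
  have hC1 : ContDiff ℝ 1 (fderiv ℝ Φ) := hΦ.1.fderiv_right (m := 1) (by norm_num)
  have c1 : Continuous (fderiv ℝ Φ) := hC1.continuous
  have c2 : Continuous (fderiv ℝ (fderiv ℝ Φ)) := hC1.continuous_fderiv (by norm_num)
  have hFz : ∀ k z, Continuous (flowExt s b m k z) := fun k z =>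
    (continuous_flowExt s hb m k).comp (Continuous.prodMk_right z)
  have hinv : ∀ (z : ℂ) (t : ℝ), ∫ x, Φ (flowExt s b m 0 (z + t * 1) x) ∂μ =
      ∫ x, Φ (flowExt s b m 0 z x) ∂μ := by
    intro z t
    rw [← hτ t (fun x => Φ (flowExt s b m 0 z x))]
    refine integral_congr_ae (Eventually.of_forall fun x => ?_)
    simp only [flowExt, hflow]
    congr 1
    refine Finset.sum_congr rfl fun i _ => ?_
    rw [show Complex.I * m i * (z + t * 1) = Complex.I * m i * t + Complex.I * m i * z by ring,
      Complex.exp_add]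
    ring
  have hzero : ∀ z : ℂ, ∫ x, (fderiv ℝ (fderiv ℝ Φ) (flowExt s b m 0 z x)
        (flowExt s b m 1 z x) (flowExt s b m 1 z x) +
        fderiv ℝ Φ (flowExt s b m 0 z x) (flowExt s b m 2 z x)) ∂μ = 0 := by
    intro z
    have h1 : ∀ t : ℝ, ∫ x, fderiv ℝ Φ (flowExt s b m 0 (z + t * 1) x)
        (flowExt s b m 1 (z + t * 1) x * 1) ∂μ = 0 := by
      intro t
      have := (hD z 1 t).1
      simp only [hinv] at this
      exact this.unique (hasDerivAt_const _ _)
    have h2 := (hD z 1 0).2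
    simp only [h1] at h2
    simpa using h2.unique (hasDerivAt_const _ _)
  have hM₂ : ∀ σ : ℝ, 0 ≤ ∫ x, (fderiv ℝ (fderiv ℝ Φ) (flowExt s b m 0 (0 + σ * Complex.I) x)
          (flowExt s b m 1 (0 + σ * Complex.I) x * Complex.I)
          (flowExt s b m 1 (0 + σ * Complex.I) x * Complex.I) +
        fderiv ℝ Φ (flowExt s b m 0 (0 + σ * Complex.I) x)
          (flowExt s b m 2 (0 + σ * Complex.I) x * Complex.I * Complex.I)) ∂μ := by
    intro σ
    generalize (0 + σ * Complex.I) = z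
    refine le_of_le_of_eq ?_ ((congrArg _ (hzero z)).trans (add_zero _))
    rw [← integral_add]
    · refine integral_nonneg fun x => ?_
      have := hΦ.2 (flowExt s b m 0 z x) (flowExt s b m 1 z x)
      have e : flowExt s b m 2 z x * Complex.I * Complex.I = - flowExt s b m 2 z x := by
        rw [mul_assoc, Complex.I_mul_I]; ring
      simp only [e, map_neg, Pi.zero_apply]
      rw [mul_comm Complex.I] at this
      linarith
    · refine Continuous.integrable_of_hasCompactSupport ?_ (HasCompactSupport.of_compactSpace _)
      exact (((c2.comp (hFz 0 z)).clm_apply ((hFz 1 z).mul continuous_const)).clm_apply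
        ((hFz 1 z).mul continuous_const)).add
        ((c1.comp (hFz 0 z)).clm_apply (((hFz 2 z).mul continuous_const).mul continuous_const))
    · refine Continuous.integrable_of_hasCompactSupport ?_ (HasCompactSupport.of_compactSpace _)
      exact (((c2.comp (hFz 0 z)).clm_apply (hFz 1 z)).clm_apply (hFz 1 z)).add
        ((c1.comp (hFz 0 z)).clm_apply (hFz 2 z))
  have hnorm : ∀ (σ : ℝ) i, Complex.exp (Complex.I * m i * (0 + σ * Complex.I)) =
      ((Real.exp (-(m i * σ)) : ℝ) : ℂ) := by
    intro σ i
    push_cast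
    congr 1
    linear_combination (m i * σ : ℂ) * Complex.I_mul_I
  have hlim : Tendsto (fun σ : ℝ => ∫ x, Φ (flowExt s b m 0 (0 + σ * Complex.I) x) ∂μ) atTop
      (𝓝 (∫ x, Φ (∑ i ∈ s with m i = 0, b i x) ∂μ)) := by
    have hb' : ∀ i, ∃ B, ∀ x, ‖b i x‖ ≤ B := fun i => by
      obtain ⟨B, hB⟩ := isCompact_univ.exists_bound_of_continuousOn (hb i).continuousOn
      exact ⟨B, fun x => hB x trivial⟩
    choose B hB using hb'
    obtain ⟨D, hD⟩ := (isCompact_closedBall (0:ℂ) (∑ i ∈ s, B i)).exists_bound_of_continuousOn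
      hΦ.1.continuous.continuousOn
    refine tendsto_integral_filter_of_dominated_convergence (fun _ => D)
      (Eventually.of_forall fun σ => (hΦ.1.continuous.comp (hFz 0 _)).aestronglyMeasurable)
      ((eventually_ge_atTop 0).mono fun σ hσ => Eventually.of_forall fun x => hD _ ?_)
      (integrable_const _) (Eventually.of_forall fun x => ?_)
    · rw [mem_closedBall_zero_iff]
      refine (norm_sum_le _ _).trans (Finset.sum_le_sum fun i _ => ?_)
      rw [hnorm, pow_zero, one_mul, norm_mul, Complex.norm_real, Real.norm_eq_abs, Real.abs_exp]
      have : Real.exp (-(m i * σ)) ≤ 1 := Real.exp_le_one_iff.2 (by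
        have := mul_nonneg (hm i) hσ; linarith)
      exact (mul_le_of_le_one_right (norm_nonneg _) this).trans (hB i x)
    · refine (hΦ.1.continuous.tendsto _).comp ?_
      simp only [flowExt, hnorm, pow_zero, one_mul]
      rw [Finset.sum_filter]
      refine tendsto_finsetSum _ fun i _ => ?_
      split_ifs with h0
      · simp [h0]
      · have hpos : 0 < m i := lt_of_le_of_ne (hm i) (Ne.symm h0)
        have : Tendsto (fun σ : ℝ => ((Real.exp (-(m i * σ)) : ℝ) : ℂ)) atTop (𝓝 ((0:ℝ):ℂ)) :=
          (Complex.continuous_ofReal.tendsto _).comp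
            (Real.tendsto_exp_neg_atTop_nhds_zero.comp (tendsto_id.const_mul_atTop hpos))
        simpa using this.const_mul (b i x)
  have := le_of_tendsto_of_deriv2_nonneg (fun σ => (hD 0 Complex.I σ).1)
    (fun σ => (hD 0 Complex.I σ).2) hM₂ hlim 0
  simpa [flowExt] using this

end Flow

noncomputable local instance : MeasureSpace UnitAddCircle := ⟨AddCircle.haarAddCircle⟩

local instance : Measure.IsAddHaarMeasure (volume : Measure UnitAddCircle) :=
  inferInstanceAs (Measure.IsAddHaarMeasure AddCircle.haarAddCircle)

local instance : IsProbabilityMeasure (volume : Measure UnitAddCircle) :=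
  inferInstanceAs (IsProbabilityMeasure AddCircle.haarAddCircle)

/-- The two-dimensional torus. -/
abbrev Torus : Type := UnitAddTorus (Fin 2)

/-- The real part of a trigonometric polynomial on the torus. -/
noncomputable def trigRe (s : Finset (Fin 2 → ℤ)) (c : (Fin 2 → ℤ) → ℂ) : C(Torus, ℝ) where
  toFun x := (∑ n ∈ s, c n * UnitAddTorus.mFourier n x).re
  continuous_toFun := by fun_prop

theorem trigRe_apply (s : Finset (Fin 2 → ℤ)) (c : (Fin 2 → ℤ) → ℂ) (x : Torus) :
    trigRe s c x = (∑ n ∈ s, c n * UnitAddTorus.mFourier n x).re := rfl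

theorem mFourier_add_line (a b t : ℝ) (n : Fin 2 → ℤ) (x : Torus) :
    UnitAddTorus.mFourier n (x + fun i => ((![a, b] i * t : ℝ) : UnitAddCircle)) =
      Complex.exp (2 * Real.pi * Complex.I * ((a * n 0 + b * n 1 : ℝ) : ℂ) * t) *
        UnitAddTorus.mFourier n x := by
  simp only [UnitAddTorus.mFourier, ContinuousMap.coe_mk, Fin.prod_univ_two, Pi.add_apply,
    fourier_apply, smul_add, AddCircle.toCircle_add, Circle.coe_mul, Matrix.cons_val_zero,
    Matrix.cons_val_one]
  simp only [← fourier_apply, fourier_coe_apply]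
  have : Complex.exp (2 * Real.pi * Complex.I * ((a * n 0 + b * n 1 : ℝ) : ℂ) * t) =
      Complex.exp (2 * Real.pi * Complex.I * n 0 * ((a * t : ℝ) : ℂ) / ((1:ℝ) : ℂ)) *
      Complex.exp (2 * Real.pi * Complex.I * n 1 * ((b * t : ℝ) : ℂ) / ((1:ℝ) : ℂ)) := by
    rw [← Complex.exp_add]
    congr 1
    push_cast
    ring
  rw [this]
  ring

open ComplexConjugate in
/-- `L^q` boundedness of the Hilbert transform on the torus in an arbitrary direction, with a
constant independent of the direction. -/
theorem exists_integral_hilbert_le {q : ℝ} (hq : 1 < q) : ∃ C : ℝ, 0 ≤ C ∧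
    ∀ (a b : ℝ) (s : Finset (Fin 2 → ℤ)) (c : (Fin 2 → ℤ) → ℂ),
      ∫ x, |trigRe s (fun n => -Complex.I * (Real.sign (a * n 0 + b * n 1) : ℝ) * c n) x| ^ q ≤
        C * ∫ x, |trigRe s c x| ^ q := by
  obtain ⟨K, hK, hΦ⟩ := exists_subharmonic hq
  refine ⟨2 * K, by positivity, fun a b s c => ?_⟩
  set f := trigRe s c with hf
  set g := trigRe s (fun n => -Complex.I * (Real.sign (a * n 0 + b * n 1) : ℝ) * c n) with hg
  set l : (Fin 2 → ℤ) → ℝ := fun n => a * n 0 + b * n 1 with hl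
  set B : (Fin 2 → ℤ) → Torus → ℂ := fun n x =>
    if 0 < l n then c n * UnitAddTorus.mFourier n x else
      if l n < 0 then conj (c n * UnitAddTorus.mFourier n x) else
        ((c n * UnitAddTorus.mFourier n x).re : ℂ) with hB
  have hBc : ∀ n, Continuous (B n) := by
    intro n
    simp only [hB]
    split_ifs
    · fun_prop
    · fun_prop
    · fun_prop
  have hsum : ∀ x, ∑ n ∈ s, B n x = ⟨f x, g x⟩ := by
    intro x
    apply Complex.ext
    · simp only [hf, trigRe_apply, Complex.re_sum]
      refine Finset.sum_congr rfl fun n _ => ?_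
      simp only [hB]
      split_ifs <;> simp
    · simp only [hg, trigRe_apply, Complex.re_sum, Complex.im_sum]
      refine Finset.sum_congr rfl fun n _ => ?_
      simp only [hB]
      split_ifs with h1 h2
      · rw [show a * n 0 + b * n 1 = l n from rfl, Real.sign_of_pos h1]
        simp
      · rw [show a * n 0 + b * n 1 = l n from rfl, Real.sign_of_neg h2]
        simp
        ring
      · rw [show a * n 0 + b * n 1 = l n from rfl, show l n = 0 by linarith]
        simp
  have hreal : ∀ x, ∑ n ∈ s with 2 * Real.pi * |l n| = 0, B n x =
      ((∑ n ∈ s with 2 * Real.pi * |l n| = 0, (c n * UnitAddTorus.mFourier n x).re : ℝ) : ℂ) := by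
    intro x
    push_cast
    refine Finset.sum_congr rfl fun n hn => ?_
    have : l n = 0 := by
      have := (Finset.mem_filter.1 hn).2
      simpa [Real.pi_ne_zero] using this
    simp [hB, this]
  have key : ∀ ε : ℝ, 0 < ε → ∫ x, |g x| ^ q ≤ 2 * K * ∫ x, ((f x) ^ 2 + ε) ^ (q / 2) := by
    intro ε hε
    obtain ⟨Φ, hΦs, hΦ0, hΦu⟩ := hΦ ε hε
    have h1 := integral_subharmonic_flow_le (volume : Measure Torus) s hBc
      (m := fun n => 2 * Real.pi * |l n|) (fun n => by positivity)
      (fun t x => x + fun i => ((![a, b] i * t : ℝ) : UnitAddCircle))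
      (fun t h => integral_add_right_eq_self h _) ?_ hΦs
    · have h2 : 0 ≤ ∫ x, Φ (∑ n ∈ s, B n x) := by
        refine le_trans (integral_nonneg fun x => ?_) h1
        rw [Pi.zero_apply, hreal]
        exact hΦ0 _
      have hi : ∀ {h : Torus → ℝ}, Continuous h → Integrable h := fun hh =>
        hh.integrable_of_hasCompactSupport (HasCompactSupport.of_compactSpace _)
      have hfc : Continuous f := f.continuous
      have hgc : Continuous g := g.continuous
      have c1 : Continuous fun x => (f x ^ 2 + ε) ^ (q / 2) :=
        Continuous.rpow_const (by fun_prop) (fun x => Or.inr (by positivity))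
      have c2 : Continuous fun x => |g x| ^ q :=
        Continuous.rpow_const (by fun_prop) (fun x => Or.inr (by positivity))
      have c3 : Continuous fun x => Φ (∑ n ∈ s, B n x) :=
        hΦs.1.continuous.comp (continuous_finsetSum _ fun n _ => hBc n)
      have h3 : ∫ x, Φ (∑ n ∈ s, B n x) ≤
          ∫ x, (K * (f x ^ 2 + ε) ^ (q / 2) - 1 / 2 * |g x| ^ q) := by
        refine integral_mono (hi c3) ((hi (c1.const_mul K)).sub (hi (c2.const_mul _))) fun x => ?_
        rw [hsum]
        refine (hΦu _).trans (sub_le_sub_left (mul_le_mul_of_nonneg_left ?_ (by norm_num)) _)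
        rw [show |g x| ^ q = (g x ^ 2) ^ (q / 2) by
          rw [← sq_abs, ← Real.rpow_natCast, ← Real.rpow_mul (abs_nonneg _)]
          congr 1; push_cast; ring]
        exact Real.rpow_le_rpow (sq_nonneg _) (by nlinarith [sq_nonneg (f x)]) (by positivity)
      rw [integral_sub (hi (c1.const_mul K)) (hi (c2.const_mul _)), integral_const_mul,
        integral_const_mul] at h3
      linarith
    · intro n t x
      simp only [hB, mFourier_add_line]
      rw [show a * n 0 + b * n 1 = l n from rfl]
      split_ifs with h1 h2
      · rw [abs_of_pos h1]
        push_cast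
        ring_nf
      · rw [abs_of_neg h2]
        simp only [map_mul, ← Complex.exp_conj, Complex.conj_I, Complex.conj_ofReal, map_ofNat]
        push_cast
        ring_nf
      · rw [show l n = 0 by linarith]
        simp
  have hc : Continuous fun ε : ℝ => ∫ x, ((f x) ^ 2 + |ε|) ^ (q / 2) := by
    have := continuous_parametric_integral_of_continuous (μ := (volume : Measure Torus))
      (f := fun (ε : ℝ) x => ((f x) ^ 2 + |ε|) ^ (q / 2)) (s := Set.univ) ?_ isCompact_univ
    · simpa using this
    · have hfc : Continuous f := f.continuous
      exact Continuous.rpow_const (by fun_prop) (fun x => Or.inr (by positivity))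
  have h0 : ∫ x, |f x| ^ q = ∫ x, ((f x) ^ 2 + |(0:ℝ)|) ^ (q / 2) := by
    congr 1; ext x
    rw [abs_zero, add_zero, ← sq_abs, ← Real.rpow_natCast, ← Real.rpow_mul (abs_nonneg _)]
    congr 1; push_cast; ring
  rw [h0]
  refine ge_of_tendsto (x := 𝓝[>] (0:ℝ)) ((hc.tendsto 0).mono_left nhdsWithin_le_nhds |>.const_mul _)
    ?_
  filter_upwards [self_mem_nhdsWithin] with ε hε
  rw [abs_of_pos hε]
  exact key ε hε

theorem integral_mul_sign_cos_add (u v α : ℝ) :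
    ∫ θ in -Real.pi..Real.pi, (u * Real.cos θ + v * Real.sin θ) * Real.sign (Real.cos (θ - α)) =
      4 * (u * Real.cos α + v * Real.sin α) := by
  have hper : Function.Periodic (fun θ =>
      (u * Real.cos θ + v * Real.sin θ) * Real.sign (Real.cos (θ - α))) (2 * Real.pi) := by
    intro θ
    simp only [Real.cos_add_two_pi, Real.sin_add_two_pi, add_sub_right_comm]
  have h0 : ∫ θ in -Real.pi..Real.pi,
      (u * Real.cos θ + v * Real.sin θ) * Real.sign (Real.cos (θ - α)) =
      ∫ θ in (-(Real.pi / 2) + α)..((Real.pi / 2 + Real.pi) + α),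
        (u * Real.cos θ + v * Real.sin θ) * Real.sign (Real.cos (θ - α)) := by
    have := hper.intervalIntegral_add_eq (-Real.pi) (-(Real.pi / 2) + α)
    convert this using 2 <;> ring
  have hF : ∀ θ, HasDerivAt (fun θ => u * Real.sin θ - v * Real.cos θ)
      (u * Real.cos θ + v * Real.sin θ) θ := by
    intro θ
    have := ((Real.hasDerivAt_sin θ).const_mul u).sub ((Real.hasDerivAt_cos θ).const_mul v)
    rwa [mul_neg, sub_neg_eq_add] at this
  have hI : ∀ a b : ℝ, ∫ θ in a..b, (u * Real.cos θ + v * Real.sin θ) =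
      (u * Real.sin b - v * Real.cos b) - (u * Real.sin a - v * Real.cos a) := fun a b =>
    intervalIntegral.integral_eq_sub_of_hasDerivAt (fun θ _ => hF θ)
      (Continuous.intervalIntegrable (by fun_prop) _ _)
  have hpi := Real.pi_pos
  have e1 : Set.EqOn (fun θ => u * Real.cos θ + v * Real.sin θ)
      (fun θ => (u * Real.cos θ + v * Real.sin θ) * Real.sign (Real.cos (θ - α)))
      (Set.uIoo (-(Real.pi / 2) + α) (Real.pi / 2 + α)) := by
    intro θ hθ
    rw [Set.uIoo_of_le (by linarith)] at hθ
    have : 0 < Real.cos (θ - α) :=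
      Real.cos_pos_of_mem_Ioo ⟨by linarith [hθ.1], by linarith [hθ.2]⟩
    simp [Real.sign_of_pos this]
  have e2 : Set.EqOn (fun θ => -(u * Real.cos θ + v * Real.sin θ))
      (fun θ => (u * Real.cos θ + v * Real.sin θ) * Real.sign (Real.cos (θ - α)))
      (Set.uIoo (Real.pi / 2 + α) ((Real.pi / 2 + Real.pi) + α)) := by
    intro θ hθ
    rw [Set.uIoo_of_le (by linarith)] at hθ
    have : Real.cos (θ - α) < 0 :=
      Real.cos_neg_of_pi_div_two_lt_of_lt (by linarith [hθ.1]) (by linarith [hθ.2])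
    simp [Real.sign_of_neg this]
  have i1 : IntervalIntegrable (fun θ =>
      (u * Real.cos θ + v * Real.sin θ) * Real.sign (Real.cos (θ - α))) volume
      (-(Real.pi / 2) + α) (Real.pi / 2 + α) :=
    (Continuous.intervalIntegrable (by fun_prop) _ _).congr_uIoo e1
  have i2 : IntervalIntegrable (fun θ =>
      (u * Real.cos θ + v * Real.sin θ) * Real.sign (Real.cos (θ - α))) volume
      (Real.pi / 2 + α) ((Real.pi / 2 + Real.pi) + α) :=
    (Continuous.intervalIntegrable (by fun_prop) _ _).congr_uIoo e2
  rw [h0, ← intervalIntegral.integral_add_adjacent_intervals i1 i2,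
    ← intervalIntegral.integral_congr_uIoo e1, ← intervalIntegral.integral_congr_uIoo e2,
    intervalIntegral.integral_neg, hI, hI]
  have s1 : Real.sin (Real.pi / 2 + α) = Real.cos α := by
    rw [add_comm, Real.sin_add_pi_div_two]
  have s2 : Real.cos (Real.pi / 2 + α) = - Real.sin α := by
    rw [add_comm, Real.cos_add_pi_div_two]
  have s3 : Real.sin (-(Real.pi / 2) + α) = - Real.cos α := by
    rw [neg_add_eq_sub, Real.sin_sub_pi_div_two]
  have s4 : Real.cos (-(Real.pi / 2) + α) = Real.sin α := by
    rw [neg_add_eq_sub, Real.cos_sub_pi_div_two]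
  have s5 : Real.sin (Real.pi / 2 + Real.pi + α) = - Real.cos α := by
    rw [add_right_comm, Real.sin_add_pi, s1]
  have s6 : Real.cos (Real.pi / 2 + Real.pi + α) = Real.sin α := by
    rw [add_right_comm, Real.cos_add_pi, s2, neg_neg]
  rw [s1, s2, s3, s4, s5, s6]
  ring

theorem integral_mul_sign_line (u v x y : ℝ) :
    ∫ θ in -Real.pi..Real.pi, (u * Real.cos θ + v * Real.sin θ) *
      Real.sign (x * Real.cos θ + y * Real.sin θ) =
      4 * ((u * x + v * y) / Real.sqrt (x ^ 2 + y ^ 2)) := by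
  by_cases h : (⟨x, y⟩ : ℂ) = 0
  · have hx : x = 0 := congrArg Complex.re h
    have hy : y = 0 := congrArg Complex.im h
    simp [hx, hy]
  · have hr : 0 < ‖(⟨x, y⟩ : ℂ)‖ := norm_pos_iff.2 h
    have hn : Real.sqrt (x ^ 2 + y ^ 2) = ‖(⟨x, y⟩ : ℂ)‖ := by
      rw [Complex.norm_eq_sqrt_sq_add_sq]
    have hx : x = ‖(⟨x, y⟩ : ℂ)‖ * Real.cos (Complex.arg ⟨x, y⟩) :=
      (Complex.norm_mul_cos_arg ⟨x, y⟩).symm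
    have hy : y = ‖(⟨x, y⟩ : ℂ)‖ * Real.sin (Complex.arg ⟨x, y⟩) :=
      (Complex.norm_mul_sin_arg ⟨x, y⟩).symm
    rw [hn]
    generalize ‖(⟨x, y⟩ : ℂ)‖ = r at *
    generalize Complex.arg ⟨x, y⟩ = α at *
    have : ∀ θ, Real.sign (x * Real.cos θ + y * Real.sin θ) = Real.sign (Real.cos (θ - α)) := by
      intro θ
      have : x * Real.cos θ + y * Real.sin θ = r * Real.cos (θ - α) := by
        rw [hx, hy, Real.cos_sub]; ring
      rw [this]
      rcases lt_trichotomy (Real.cos (θ - α)) 0 with h1 | h1 | h1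
      · rw [Real.sign_of_neg h1, Real.sign_of_neg (mul_neg_of_pos_of_neg hr h1)]
      · rw [h1, mul_zero]
      · rw [Real.sign_of_pos h1, Real.sign_of_pos (mul_pos hr h1)]
    simp only [this]
    rw [integral_mul_sign_cos_add, hx, hy]
    field_simp

theorem measurable_real_sign : Measurable Real.sign := by
  unfold Real.sign
  exact Measurable.ite measurableSet_Iio measurable_const
    (Measurable.ite measurableSet_Ioi measurable_const measurable_const)

theorem norm_toLp_rpow {q : ℝ} (hq : 1 ≤ q) [Fact (1 ≤ ENNReal.ofReal q)] (f : C(Torus, ℝ)) :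
    ‖ContinuousMap.toLp (E := ℝ) (ENNReal.ofReal q) (volume : Measure Torus) ℝ f‖ ^ q =
      ∫ x, |f x| ^ q := by
  have h0 : 0 < q := by linarith
  have hae := ContinuousMap.coeFn_toLp (E := ℝ) (𝕜 := ℝ) (p := ENNReal.ofReal q)
    (volume : Measure Torus) f
  have hm := Lp.memLp (ContinuousMap.toLp (E := ℝ) (ENNReal.ofReal q) (volume : Measure Torus) ℝ f)
  rw [Lp.norm_def, hm.eLpNorm_eq_integral_rpow_norm (by simpa using h0) ENNReal.ofReal_ne_top,
    ENNReal.toReal_ofReal h0.le, ENNReal.toReal_ofReal (by positivity),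
    ← Real.rpow_mul (by positivity), inv_mul_cancel₀ h0.ne', Real.rpow_one]
  refine integral_congr_ae ?_
  filter_upwards [hae] with x hx
  rw [hx, Real.norm_eq_abs]

theorem trigRe_eq_sum (s : Finset (Fin 2 → ℤ)) (c : (Fin 2 → ℤ) → ℂ) :
    trigRe s c = ∑ n ∈ s, trigRe {n} c := by
  ext x
  simp [trigRe_apply, ContinuousMap.sum_apply]

/-- `L^q` boundedness of the Riesz transforms on the torus. -/
theorem exists_integral_riesz_le {q : ℝ} (hq : 1 < q) : ∃ C : ℝ, 0 ≤ C ∧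
    ∀ (u v : ℝ), |u| ≤ 1 → |v| ≤ 1 → ∀ (s : Finset (Fin 2 → ℤ)) (c : (Fin 2 → ℤ) → ℂ),
      ∫ x, |trigRe s (fun n => -Complex.I *
        (((u * n 0 + v * (n 1 / 2)) / Real.sqrt (n 0 ^ 2 + (n 1 / 2) ^ 2) : ℝ)) * c n) x| ^ q ≤
        C * ∫ x, |trigRe s c x| ^ q := by
  obtain ⟨C, hC, h⟩ := exists_integral_hilbert_le hq
  refine ⟨Real.pi ^ q * C, by positivity, fun u v hu hv s c => ?_⟩
  have : Fact (1 ≤ ENNReal.ofReal q) := ⟨by simpa using hq.le⟩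
  set L := ContinuousMap.toLp (E := ℝ) (ENNReal.ofReal q) (volume : Measure Torus) ℝ with hL
  have h0 : 0 < q := by linarith
  have hbd : ∀ a b : ℝ, ‖L (trigRe s (fun n =>
      -Complex.I * (Real.sign (a * n 0 + b * n 1) : ℝ) * c n))‖ ≤ C ^ q⁻¹ * ‖L (trigRe s c)‖ := by
    intro a b
    rw [← Real.rpow_le_rpow_iff (norm_nonneg _) (by positivity) h0,
      Real.mul_rpow (by positivity) (norm_nonneg _), ← Real.rpow_mul hC, inv_mul_cancel₀ h0.ne',
      Real.rpow_one, norm_toLp_rpow hq.le, norm_toLp_rpow hq.le]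
    exact h a b s c
  have hlin : ∀ (r : (Fin 2 → ℤ) → ℝ), L (trigRe s (fun n => -Complex.I * (r n : ℝ) * c n)) =
      ∑ n ∈ s, r n • L (trigRe {n} (fun n => -Complex.I * c n)) := by
    intro r
    rw [trigRe_eq_sum, map_sum]
    refine Finset.sum_congr rfl fun n _ => ?_
    rw [← map_smul]
    congr 1
    ext x
    simp only [trigRe_apply, Finset.sum_singleton, ContinuousMap.smul_apply, smul_eq_mul]
    rw [← Complex.re_ofReal_mul]
    congr 1
    ring
  have hint : ∀ n : Fin 2 → ℤ, IntervalIntegrable (fun θ : ℝ => (u * Real.cos θ + v * Real.sin θ) *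
      Real.sign (Real.cos θ * n 0 + Real.sin θ / 2 * n 1)) volume (-Real.pi) Real.pi := by
    intro n
    rw [intervalIntegrable_iff]
    refine Integrable.mul_bdd (c := 1) (intervalIntegrable_iff.1
      (Continuous.intervalIntegrable (u := fun θ => u * Real.cos θ + v * Real.sin θ)
        (by fun_prop) _ _)) ?_ ?_
    · exact (measurable_real_sign.comp (by fun_prop)).aestronglyMeasurable
    · filter_upwards with θ
      rcases Real.sign_apply_eq (Real.cos θ * n 0 + Real.sin θ / 2 * n 1) with h | h | h <;> simp [h]
  have key : (4:ℝ) • L (trigRe s (fun n => -Complex.I *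
      (((u * n 0 + v * (n 1 / 2)) / Real.sqrt (n 0 ^ 2 + (n 1 / 2) ^ 2) : ℝ)) * c n)) =
      ∫ θ in -Real.pi..Real.pi, (u * Real.cos θ + v * Real.sin θ) • L (trigRe s (fun n =>
        -Complex.I * (Real.sign (Real.cos θ * n 0 + Real.sin θ / 2 * n 1) : ℝ) * c n)) := by
    simp_rw [hlin, Finset.smul_sum, smul_smul]
    rw [intervalIntegral.integral_finsetSum fun n _ =>
      ⟨(hint n).1.smul_const _, (hint n).2.smul_const _⟩]
    refine Finset.sum_congr rfl fun n _ => ?_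
    rw [intervalIntegral.integral_smul_const]
    congr 1
    rw [← integral_mul_sign_line]
    congr 1; ext θ; congr 2; ring
  have hn := intervalIntegral.norm_integral_le_of_norm_le_const (a := -Real.pi) (b := Real.pi)
    (f := fun θ => (u * Real.cos θ + v * Real.sin θ) • L (trigRe s (fun n =>
        -Complex.I * (Real.sign (Real.cos θ * n 0 + Real.sin θ / 2 * n 1) : ℝ) * c n)))
    (C := 2 * (C ^ q⁻¹ * ‖L (trigRe s c)‖)) (fun θ _ => by
      rw [norm_smul]
      refine mul_le_mul ?_ (hbd _ _) (norm_nonneg _) (by norm_num)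
      have h1 : |u * Real.cos θ| ≤ 1 := by
        rw [abs_mul]; exact mul_le_one₀ hu (abs_nonneg _) (Real.abs_cos_le_one θ)
      have h2 : |v * Real.sin θ| ≤ 1 := by
        rw [abs_mul]; exact mul_le_one₀ hv (abs_nonneg _) (Real.abs_sin_le_one θ)
      rw [Real.norm_eq_abs]
      linarith [abs_add_le (u * Real.cos θ) (v * Real.sin θ)])
  rw [← key, norm_smul, show |Real.pi - -Real.pi| = 2 * Real.pi by
    rw [abs_of_nonneg (by linarith [Real.pi_pos])]; ring] at hn
  simp only [Real.norm_ofNat] at hn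
  have hfin : ‖L (trigRe s (fun n => -Complex.I *
      (((u * n 0 + v * (n 1 / 2)) / Real.sqrt (n 0 ^ 2 + (n 1 / 2) ^ 2) : ℝ)) * c n))‖ ≤
      Real.pi * (C ^ q⁻¹ * ‖L (trigRe s c)‖) := by linarith
  rw [← norm_toLp_rpow hq.le, ← norm_toLp_rpow hq.le]
  refine (Real.rpow_le_rpow (norm_nonneg _) hfin h0.le).trans (le_of_eq ?_)
  rw [Real.mul_rpow Real.pi_pos.le (by positivity), Real.mul_rpow (by positivity) (norm_nonneg _),
    ← Real.rpow_mul hC, inv_mul_cancel₀ h0.ne', Real.rpow_one, mul_assoc]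

/-- `L^q` boundedness of the second order Riesz transforms on the torus. -/
theorem exists_integral_riesz_two_le {q : ℝ} (hq : 1 < q) : ∃ C : ℝ, 0 ≤ C ∧
    ∀ (u v : ℝ), |u| ≤ 1 → |v| ≤ 1 → ∀ (s : Finset (Fin 2 → ℤ)) (c : (Fin 2 → ℤ) → ℂ),
      ∫ x, |trigRe s (fun n => (((u * n 0 + v * (n 1 / 2)) * (n 1 / 2) /
        ((n 0 : ℝ) ^ 2 + (n 1 / 2) ^ 2) : ℝ)) * c n) x| ^ q ≤ C * ∫ x, |trigRe s c x| ^ q := by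
  obtain ⟨C, hC, h⟩ := exists_integral_riesz_le hq
  refine ⟨C * C, by positivity, fun u v hu hv s c => ?_⟩
  have h1 := h 0 1 (by simp) (by simp) s c
  refine le_trans (le_of_eq ?_) ((h u v hu hv s _).trans
    ((mul_le_mul_of_nonneg_left h1 hC).trans (le_of_eq (by ring))))
  refine integral_congr_ae (Eventually.of_forall fun x => ?_)
  simp only [trigRe_apply]
  rw [← abs_neg, ← Complex.neg_re, ← Finset.sum_neg_distrib]
  congr 4
  ext n
  have : (((u * n 0 + v * (n 1 / 2)) * (n 1 / 2) / ((n 0 : ℝ) ^ 2 + (n 1 / 2) ^ 2) : ℝ)) =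
      ((u * n 0 + v * (n 1 / 2)) / Real.sqrt (n 0 ^ 2 + (n 1 / 2) ^ 2)) *
      ((0 * n 0 + 1 * (n 1 / 2)) / Real.sqrt (n 0 ^ 2 + (n 1 / 2) ^ 2)) := by
    rw [div_mul_div_comm, Real.mul_self_sqrt (by positivity)]
    ring
  rw [this, Complex.ofReal_mul]
  linear_combination (-(((u * n 0 + v * (n 1 / 2)) / Real.sqrt (n 0 ^ 2 + (n 1 / 2) ^ 2) : ℝ) : ℂ) *
    (((0 * n 0 + 1 * (n 1 / 2)) / Real.sqrt (n 0 ^ 2 + (n 1 / 2) ^ 2) : ℝ) : ℂ) * c n *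
    UnitAddTorus.mFourier n x) * Complex.I_sq

theorem add_rpow_le_two_rpow_mul {a b p : ℝ} (ha : 0 ≤ a) (hb : 0 ≤ b) (hp : 1 ≤ p) :
    (a + b) ^ p ≤ 2 ^ (p - 1) * (a ^ p + b ^ p) := by
  lift a to NNReal using ha
  lift b to NNReal using hb
  exact_mod_cast NNReal.rpow_add_le_mul_rpow_add_rpow a b hp

theorem abs_integral_mul_le {α : Type*} [MeasurableSpace α] {μ : Measure α} {p q : ℝ}
    (hpq : p.HolderConjugate q) {f g : α → ℝ} (hf : MemLp f (ENNReal.ofReal p) μ)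
    (hg : MemLp g (ENNReal.ofReal q) μ) :
    |∫ x, f x * g x ∂μ| ≤ (∫ x, |f x| ^ p ∂μ) ^ (1 / p) * (∫ x, |g x| ^ q ∂μ) ^ (1 / q) := by
  refine (norm_integral_le_integral_norm (fun x => f x * g x)).trans ?_
  simpa only [norm_mul, Real.norm_eq_abs] using integral_mul_norm_le_Lp_mul_Lq hpq hf hg

theorem norm_Lp_eq_integral {q : ℝ} (hq : 0 < q) [Fact (1 ≤ ENNReal.ofReal q)]
    (G : Lp ℂ (ENNReal.ofReal q) (volume : Measure Torus)) :
    ‖G‖ = (∫ x, ‖G x‖ ^ q) ^ (1 / q) := by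
  rw [Lp.norm_def, (Lp.memLp G).eLpNorm_eq_integral_rpow_norm (by simpa using hq)
    ENNReal.ofReal_ne_top, ENNReal.toReal_ofReal hq.le, ENNReal.toReal_ofReal (by positivity),
    one_div]

theorem integral_re_rpow_le_norm {q : ℝ} (hq : 0 < q) [Fact (1 ≤ ENNReal.ofReal q)]
    (G : Lp ℂ (ENNReal.ofReal q) (volume : Measure Torus)) :
    (∫ x, |(G x).re| ^ q) ^ (1 / q) ≤ ‖G‖ := by
  rw [norm_Lp_eq_integral hq]
  refine Real.rpow_le_rpow (integral_nonneg fun x => by positivity) ?_ (by positivity)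
  refine integral_mono_of_nonneg (Eventually.of_forall fun x => by positivity) ?_
    (Eventually.of_forall fun x =>
      Real.rpow_le_rpow (abs_nonneg _) (Complex.abs_re_le_norm _) hq.le)
  have := (Lp.memLp G).integrable_norm_rpow (by simpa using hq) ENNReal.ofReal_ne_top
  rwa [ENNReal.toReal_ofReal hq.le] at this

/-- An `L^p` bound by duality against trigonometric polynomials. -/
theorem integral_rpow_le_of_trigRe {p q : ℝ} (hpq : p.HolderConjugate q) {M : ℝ} (hM : 0 ≤ M)
    {h : Torus → ℝ} (hm : Measurable h) {B : ℝ} (hB : ∀ x, |h x| ≤ B)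
    (H : ∀ s c, |∫ x, h x * trigRe s c x| ≤ M * (∫ x, |trigRe s c x| ^ q) ^ (1 / q)) :
    ∫ x, |h x| ^ p ≤ M ^ p := by
  have hp0 := hpq.pos
  have hq0 := hpq.symm.pos
  have : Fact (1 ≤ ENNReal.ofReal q) := ⟨by simpa using hpq.symm.lt.le⟩
  have hh : MemLp h (ENNReal.ofReal p) (volume : Measure Torus) :=
    MemLp.of_bound hm.aestronglyMeasurable B (Eventually.of_forall hB)
  have hre : ∀ G : Lp ℂ (ENNReal.ofReal q) (volume : Measure Torus),
      MemLp (fun x => (G x).re) (ENNReal.ofReal q) (volume : Measure Torus) :=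
    fun G => (Lp.memLp G).re
  have hint : ∀ G : Lp ℂ (ENNReal.ofReal q) (volume : Measure Torus),
      Integrable (fun x => h x * (G x).re) := fun G =>
    ((hre G).integrable (Fact.out)).bdd_mul hm.aestronglyMeasurable
      (Eventually.of_forall hB)
  set Hp := (∫ x, |h x| ^ p) ^ (1 / p) with hHp
  have hHp0 : 0 ≤ Hp := Real.rpow_nonneg (integral_nonneg fun x => by positivity) _
  have hspan : ∀ P ∈ Submodule.span ℂ
      (Set.range (@UnitAddTorus.mFourierLp (Fin 2) _ (ENNReal.ofReal q) _)),
      |∫ x, h x * (P x).re| ≤ M * ‖P‖ := by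
    intro P hP
    obtain ⟨c, rfl⟩ := Finsupp.mem_span_range_iff_exists_finsupp.1 hP
    have hae : ⇑(c.sum fun i a => a • UnitAddTorus.mFourierLp (ENNReal.ofReal q) i) =ᵐ[volume]
        fun x => ∑ n ∈ c.support, c n * UnitAddTorus.mFourier n x := by
      have : (c.sum fun i a => a • UnitAddTorus.mFourierLp (ENNReal.ofReal q) i) =
          ContinuousMap.toLp (E := ℂ) (ENNReal.ofReal q) (volume : Measure Torus) ℂ
            (∑ n ∈ c.support, c n • UnitAddTorus.mFourier n) := by
        simp [Finsupp.sum, map_sum]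
      rw [this]
      refine (ContinuousMap.coeFn_toLp (E := ℂ) (𝕜 := ℂ) (volume : Measure Torus) _).trans ?_
      refine Eventually.of_forall fun x => ?_
      simp [ContinuousMap.sum_apply]
    have e1 : ∫ x, h x * ((c.sum fun i a => a • UnitAddTorus.mFourierLp (ENNReal.ofReal q) i :
        Lp ℂ (ENNReal.ofReal q) (volume : Measure Torus)) x).re =
        ∫ x, h x * trigRe c.support c x := by
      refine integral_congr_ae ?_
      filter_upwards [hae] with x hx
      rw [hx, trigRe_apply]
    have e2 : ∫ x, |trigRe c.support c x| ^ q =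
        ∫ x, |((c.sum fun i a => a • UnitAddTorus.mFourierLp (ENNReal.ofReal q) i :
        Lp ℂ (ENNReal.ofReal q) (volume : Measure Torus)) x).re| ^ q := by
      refine integral_congr_ae ?_
      filter_upwards [hae] with x hx
      rw [hx, trigRe_apply]
    rw [e1]
    refine (H _ _).trans (mul_le_mul_of_nonneg_left ?_ hM)
    rw [e2]
    exact integral_re_rpow_le_norm hq0 _
  have hall : ∀ G : Lp ℂ (ENNReal.ofReal q) (volume : Measure Torus),
      |∫ x, h x * (G x).re| ≤ M * ‖G‖ := by
    intro G
    refine le_of_forall_pos_le_add fun δ hδ => ?_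
    have hG : G ∈ (Submodule.span ℂ (Set.range (@UnitAddTorus.mFourierLp (Fin 2) _
        (ENNReal.ofReal q) _))).topologicalClosure := by
      rw [UnitAddTorus.span_mFourierLp_closure_eq_top ENNReal.ofReal_ne_top]; trivial
    obtain ⟨P, hP, hd⟩ := Metric.mem_closure_iff.1 hG (δ / (M + Hp + 1)) (by positivity)
    have h1 := hspan P hP
    have h2 : |∫ x, h x * ((G - P : Lp ℂ (ENNReal.ofReal q) (volume : Measure Torus)) x).re| ≤
        Hp * ‖G - P‖ :=
      (abs_integral_mul_le hpq hh (hre (G - P))).trans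
        (mul_le_mul_of_nonneg_left (integral_re_rpow_le_norm hq0 _) hHp0)
    have h3 : ∫ x, h x * (G x).re = (∫ x, h x * (P x).re) +
        ∫ x, h x * ((G - P : Lp ℂ (ENNReal.ofReal q) (volume : Measure Torus)) x).re := by
      rw [← integral_add (hint _) (hint _)]
      refine integral_congr_ae ?_
      filter_upwards [Lp.coeFn_sub G P] with x hx
      rw [hx, Pi.sub_apply, Complex.sub_re]
      ring
    rw [dist_eq_norm] at hd
    have h4 : ‖P‖ ≤ ‖G‖ + ‖G - P‖ := by
      have := norm_sub_le G (G - P)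
      simpa using this
    have h5 : (M + Hp) * ‖G - P‖ ≤ δ := by
      have := mul_le_mul_of_nonneg_left hd.le (by positivity : 0 ≤ M + Hp)
      refine this.trans ?_
      rw [← mul_div_assoc, div_le_iff₀ (by positivity)]
      nlinarith
    rw [h3]
    have := abs_add_le (∫ x, h x * (P x).re)
      (∫ x, h x * ((G - P : Lp ℂ (ENNReal.ofReal q) (volume : Measure Torus)) x).re)
    nlinarith [mul_le_mul_of_nonneg_left h4 hM]
  set g : Torus → ℝ := fun x => Real.sign (h x) * |h x| ^ (p - 1) with hg
  have hgm : Measurable g := by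
    have : Measurable fun x => |h x| ^ (p - 1) := by fun_prop
    exact (measurable_real_sign.comp hm).mul this
  have hgabs : ∀ x, |g x| = |h x| ^ (p - 1) := by
    intro x
    rcases eq_or_ne (h x) 0 with h0 | h0
    · simp [hg, h0, Real.zero_rpow (by linarith [hpq.lt] : p - 1 ≠ 0)]
    · rw [hg]
      simp only [abs_mul, abs_of_nonneg (Real.rpow_nonneg (abs_nonneg (h x)) (p - 1))]
      rcases Real.sign_apply_eq_of_ne_zero _ h0 with h1 | h1 <;> simp [h1]
  have hgq : ∀ x, |g x| ^ q = |h x| ^ p := by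
    intro x
    rw [hgabs, ← Real.rpow_mul (abs_nonneg _), hpq.sub_one_mul_conj]
  have hhg : ∀ x, h x * g x = |h x| ^ p := by
    intro x
    rcases eq_or_ne (h x) 0 with h0 | h0
    · simp [h0, Real.zero_rpow hp0.ne']
    · have : h x * Real.sign (h x) = |h x| := by
        rcases lt_or_gt_of_ne h0 with h1 | h1
        · rw [Real.sign_of_neg h1, abs_of_neg h1]; ring
        · rw [Real.sign_of_pos h1, abs_of_pos h1]; ring
      simp only [hg]
      rw [← mul_assoc, this, mul_comm, ← Real.rpow_add_one (by simpa using h0)]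
      congr 1; ring
  have hgL : MemLp (fun x => (g x : ℂ)) (ENNReal.ofReal q) (volume : Measure Torus) := by
    refine MemLp.of_bound (by fun_prop) (B ^ (p - 1)) (Eventually.of_forall fun x => ?_)
    rw [Complex.norm_real, Real.norm_eq_abs, hgabs]
    exact Real.rpow_le_rpow (abs_nonneg _) (hB x) (by linarith [hpq.lt])
  have hfin := hall (hgL.toLp _)
  have hc := hgL.coeFn_toLp
  rw [norm_Lp_eq_integral hq0] at hfin
  have e1 : ∫ x, h x * ((hgL.toLp _ : Lp ℂ (ENNReal.ofReal q) (volume : Measure Torus)) x).re =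
      ∫ x, |h x| ^ p := by
    refine integral_congr_ae ?_
    filter_upwards [hc] with x hx
    rw [hx, Complex.ofReal_re, hhg]
  have e2 : ∫ x, ‖(hgL.toLp _ : Lp ℂ (ENNReal.ofReal q) (volume : Measure Torus)) x‖ ^ q =
      ∫ x, |h x| ^ p := by
    refine integral_congr_ae ?_
    filter_upwards [hc] with x hx
    rw [hx, Complex.norm_real, Real.norm_eq_abs, hgq]
  rw [e1, e2] at hfin
  have hI0 : 0 ≤ ∫ x, |h x| ^ p := integral_nonneg fun x => by positivity
  rw [abs_of_nonneg hI0] at hfin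
  rcases hI0.eq_or_lt with h0 | h0
  · rw [← h0]; positivity
  · have h1 : (∫ x, |h x| ^ p) = (∫ x, |h x| ^ p) ^ (1 / p) * (∫ x, |h x| ^ p) ^ (1 / q) := by
      rw [← Real.rpow_add h0, one_div, one_div, hpq.inv_add_inv_eq_one, Real.rpow_one]
    have h2 : (∫ x, |h x| ^ p) ^ (1 / p) ≤ M := by
      have hpos : 0 < (∫ x, |h x| ^ p) ^ (1 / q) := Real.rpow_pos_of_pos h0 _
      refine le_of_mul_le_mul_right ?_ hpos
      rw [← h1]; exact hfin
    have h3 := Real.rpow_le_rpow (by positivity) h2 hp0.le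
    rwa [← Real.rpow_mul hI0, one_div, inv_mul_cancel₀ hp0.ne', Real.rpow_one] at h3

/-- The multiplier of a product of two Riesz transforms, with a factor `1 / 2` on the second
frequency. -/
noncomputable def rieszMult (u v : ℝ) (n : Fin 2 → ℤ) : ℝ :=
  (u * n 0 + v * (n 1 / 2)) * (n 1 / 2) / ((n 0 : ℝ) ^ 2 + (n 1 / 2) ^ 2)

theorem integral_mul_trigRe {f : Torus → ℝ} (hm : Measurable f) {B : ℝ} (hB : ∀ x, |f x| ≤ B)
    (s : Finset (Fin 2 → ℤ)) (c : (Fin 2 → ℤ) → ℂ) :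
    ∫ x, f x * trigRe s c x =
      (∑ n ∈ s, c n * ∫ x, (f x : ℂ) * UnitAddTorus.mFourier n x).re := by
  have hi : ∀ n, Integrable fun x => (f x : ℂ) * UnitAddTorus.mFourier n x := by
    intro n
    refine Integrable.of_bound (by fun_prop) B (Eventually.of_forall fun x => ?_)
    rw [norm_mul, Complex.norm_real]
    refine (mul_le_of_le_one_right (norm_nonneg _) ?_).trans (hB x)
    exact ((UnitAddTorus.mFourier n).norm_coe_le_norm x).trans UnitAddTorus.mFourier_norm.le
  simp_rw [← integral_const_mul]
  rw [← integral_finsetSum _ fun n _ => (hi n).const_mul _]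
  rw [← RCLike.re_eq_complex_re, ← integral_re (integrable_finsetSum _ fun n _ =>
    (hi n).const_mul _)]
  refine integral_congr_ae (Eventually.of_forall fun x => ?_)
  simp only [trigRe_apply, RCLike.re_eq_complex_re]
  rw [← Complex.re_ofReal_mul, Finset.mul_sum]
  congr 2; ext n; ring

/-- `L^p` estimate for second order Riesz transforms of bounded functions, in weak form. -/
theorem exists_integral_le_of_rieszMult {p : ℝ} (hp : 1 < p) : ∃ K : ℝ, 0 ≤ K ∧
    ∀ h f₁ f₂ : Torus → ℝ, Measurable h → Measurable f₁ → Measurable f₂ →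
      (∃ B, ∀ x, |h x| ≤ B) → (∃ B, ∀ x, |f₁ x| ≤ B) → (∃ B, ∀ x, |f₂ x| ≤ B) →
      (∀ n, ∫ x, (h x : ℂ) * UnitAddTorus.mFourier n x =
        rieszMult 1 0 n * (∫ x, (f₁ x : ℂ) * UnitAddTorus.mFourier n x) +
        rieszMult 0 1 n * ∫ x, (f₂ x : ℂ) * UnitAddTorus.mFourier n x) →
      ∫ x, |h x| ^ p ≤ K * ((∫ x, |f₁ x| ^ p) + ∫ x, |f₂ x| ^ p) := by
  set q := p.conjExponent with hq
  have hpq : p.HolderConjugate q := Real.HolderConjugate.conjExponent hp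
  have hp0 := hpq.pos
  have hq0 := hpq.symm.pos
  obtain ⟨C, hC, hR⟩ := exists_integral_riesz_two_le hpq.symm.lt
  refine ⟨(C ^ (1 / q)) ^ p * 2 ^ (p - 1), by positivity, fun h f₁ f₂ hm hm₁ hm₂ ⟨B, hB⟩
    ⟨B₁, hB₁⟩ ⟨B₂, hB₂⟩ H => ?_⟩
  set F₁ := (∫ x, |f₁ x| ^ p) ^ (1 / p) with hF₁
  set F₂ := (∫ x, |f₂ x| ^ p) ^ (1 / p) with hF₂
  have i1 : 0 ≤ ∫ x, |f₁ x| ^ p := integral_nonneg fun x => by positivity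
  have i2 : 0 ≤ ∫ x, |f₂ x| ^ p := integral_nonneg fun x => by positivity
  have hF₁0 : 0 ≤ F₁ := Real.rpow_nonneg i1 _
  have hF₂0 : 0 ≤ F₂ := Real.rpow_nonneg i2 _
  have hL : ∀ {f : Torus → ℝ} {B : ℝ}, Measurable f → (∀ x, |f x| ≤ B) →
      MemLp f (ENNReal.ofReal p) (volume : Measure Torus) := fun hm hB =>
    MemLp.of_bound hm.aestronglyMeasurable _ (Eventually.of_forall hB)
  have hT : ∀ s c, MemLp (trigRe s c) (ENNReal.ofReal q) (volume : Measure Torus) := fun s c =>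
    MemLp.of_bound (trigRe s c).continuous.aestronglyMeasurable ‖trigRe s c‖
      (Eventually.of_forall fun x => (trigRe s c).norm_coe_le_norm x)
  have hbound : ∀ (u v : ℝ), |u| ≤ 1 → |v| ≤ 1 → ∀ s c,
      (∫ x, |trigRe s (fun n => (rieszMult u v n : ℝ) * c n) x| ^ q) ^ (1 / q) ≤
      C ^ (1 / q) * (∫ x, |trigRe s c x| ^ q) ^ (1 / q) := by
    intro u v hu hv s c
    rw [← Real.mul_rpow hC (integral_nonneg fun x => by positivity)]
    exact Real.rpow_le_rpow (integral_nonneg fun x => by positivity) (hR u v hu hv s c)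
      (by positivity)
  have key := integral_rpow_le_of_trigRe hpq (M := C ^ (1 / q) * (F₁ + F₂)) (by positivity) hm hB
    (fun s c => by
      have e : ∫ x, h x * trigRe s c x =
          (∫ x, f₁ x * trigRe s (fun n => (rieszMult 1 0 n : ℝ) * c n) x) +
          ∫ x, f₂ x * trigRe s (fun n => (rieszMult 0 1 n : ℝ) * c n) x := by
        rw [integral_mul_trigRe hm hB, integral_mul_trigRe hm₁ hB₁, integral_mul_trigRe hm₂ hB₂,
          ← Complex.add_re, ← Finset.sum_add_distrib]
        congr 2; ext n
        rw [H]; ring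
      rw [e]
      refine (abs_add_le _ _).trans ?_
      have a1 := (abs_integral_mul_le hpq (hL hm₁ hB₁) (hT s _)).trans
        (mul_le_mul_of_nonneg_left (hbound 1 0 (by simp) (by simp) s c) hF₁0)
      have a2 := (abs_integral_mul_le hpq (hL hm₂ hB₂) (hT s _)).trans
        (mul_le_mul_of_nonneg_left (hbound 0 1 (by simp) (by simp) s c) hF₂0)
      refine (add_le_add a1 a2).trans (le_of_eq (by ring)))
  refine key.trans ?_
  rw [Real.mul_rpow (by positivity) (by positivity), mul_assoc]
  refine mul_le_mul_of_nonneg_left ?_ (by positivity)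
  have hj := add_rpow_le_two_rpow_mul hF₁0 hF₂0 hp.le
  rw [hF₁, hF₂, one_div]
  rwa [hF₁, hF₂, ← Real.rpow_mul i1, ← Real.rpow_mul i2, one_div, inv_mul_cancel₀ hp0.ne',
    Real.rpow_one, Real.rpow_one] at hj

/-- The lower left corner of the fundamental domain of the torus used for `torusChart`. -/
noncomputable def torusCorner : Fin 2 → ℝ := ![0, -1/4]

/-- A measurable fundamental domain chart of the torus with image
`(0, 1] × (-1/2, 3/2]`, the second variable being scaled to have period `2`. -/
noncomputable def torusChart (τ : Torus) : ℝ × ℝ :=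
  ((UnitAddTorus.measurableEquivPiIoc torusCorner τ).1 0,
    2 * (UnitAddTorus.measurableEquivPiIoc torusCorner τ).1 1)

theorem measurable_torusChart : Measurable torusChart := by
  have h := (UnitAddTorus.measurableEquivPiIoc torusCorner).measurable
  have h2 : Measurable fun τ => (UnitAddTorus.measurableEquivPiIoc torusCorner τ).1 := by fun_prop
  exact ((measurable_pi_apply 0).comp h2).prodMk (((measurable_pi_apply 1).comp h2).const_mul 2)

theorem torusChart_coe {z : Fin 2 → ℝ}
    (hz : ∀ i, z i ∈ Set.Ioc (torusCorner i) (torusCorner i + 1)) :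
    torusChart (fun i => (z i : UnitAddCircle)) = (z 0, 2 * z 1) := by
  have h := (UnitAddTorus.measurableEquivPiIoc torusCorner).apply_symm_apply ⟨z, hz⟩
  rw [UnitAddTorus.coe_symm_measurableEquivPiIoc_apply] at h
  simp only [torusChart]
  rw [h]

/-- The rectangle `(0, 1] × (a, b]`. -/
def rect (a b : ℝ) : Set (ℝ × ℝ) := Set.Ioc 0 1 ×ˢ Set.Ioc a b

theorem measurableSet_rect (a b : ℝ) : MeasurableSet (rect a b) :=
  measurableSet_Ioc.prod measurableSet_Ioc

theorem volume_rect_ne_top (a b : ℝ) : volume (rect a b) ≠ ⊤ := by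
  rw [rect, Measure.volume_eq_prod, Measure.prod_prod]
  simp

theorem torusChart_mem (τ : Torus) : torusChart τ ∈ rect (-1/2) (3/2) := by
  have h0 := (UnitAddTorus.measurableEquivPiIoc torusCorner τ).2 0
  have h1 := (UnitAddTorus.measurableEquivPiIoc torusCorner τ).2 1
  simp only [torusCorner, Matrix.cons_val_zero, Matrix.cons_val_one, zero_add] at h0 h1
  refine ⟨h0, ?_, ?_⟩
  · have := h1.1
    simp only [torusChart, torusCorner]
    linarith
  · have := h1.2
    simp only [torusChart, torusCorner]
    linarith

theorem integral_comp_torusChart {E : Type*} [NormedAddCommGroup E] [NormedSpace ℝ E]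
    {Ψ : ℝ × ℝ → E} (hΨ : StronglyMeasurable Ψ) {B : ℝ}
    (hB : ∀ z ∈ rect (-1/2) (3/2), ‖Ψ z‖ ≤ B) :
    ∫ τ, Ψ (torusChart τ) = (1 / 2 : ℝ) • ∫ z in rect (-1/2) (3/2), Ψ z := by
  rw [UnitAddTorus.integral_preimage _ torusCorner]
  have hms : MeasurableSet {x : Fin 2 → ℝ | ∀ i, x i ∈
      Set.Ioc (torusCorner i) (torusCorner i + 1)} := by
    rw [Set.ofPred_forall]
    exact MeasurableSet.iInter fun i => measurableSet_Ioc.preimage (measurable_pi_apply i)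
  rw [setIntegral_congr_fun (g := fun z => (fun w : ℝ × ℝ => Ψ (w.1, 2 * w.2))
    (MeasurableEquiv.finTwoArrow z)) hms (fun z hz => by
      simp only [torusChart_coe hz]; rfl)]
  have hset : {x : Fin 2 → ℝ | ∀ i, x i ∈
      Set.Ioc (torusCorner i) (torusCorner i + 1)} =
      MeasurableEquiv.finTwoArrow ⁻¹' (Set.Ioc (0:ℝ) 1 ×ˢ Set.Ioc (-1/4 : ℝ) (3/4)) := by
    ext z
    simp only [Set.mem_ofPred_eq, Fin.forall_fin_two, Set.mem_preimage, Set.mem_prod]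
    simp only [torusCorner, Matrix.cons_val_zero, Matrix.cons_val_one, zero_add]
    norm_num [MeasurableEquiv.finTwoArrow]
  rw [hset]
  refine ((volume_preserving_finTwoArrow ℝ).setIntegral_preimage_emb
    MeasurableEquiv.finTwoArrow.measurableEmbedding (fun w : ℝ × ℝ => Ψ (w.1, 2 * w.2))
    (Set.Ioc (0:ℝ) 1 ×ˢ Set.Ioc (-1/4 : ℝ) (3/4))).trans ?_
  have hsm : StronglyMeasurable fun w : ℝ × ℝ => Ψ (w.1, 2 * w.2) :=
    hΨ.comp_measurable (by fun_prop)
  have hi : IntegrableOn Ψ (rect (-1/2) (3/2)) :=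
    IntegrableOn.of_bound (volume_rect_ne_top _ _).lt_top hΨ.aestronglyMeasurable B
      ((ae_restrict_iff' (measurableSet_rect _ _)).2 (Eventually.of_forall hB))
  have hi2 : IntegrableOn (fun w : ℝ × ℝ => Ψ (w.1, 2 * w.2))
      (Set.Ioc (0:ℝ) 1 ×ˢ Set.Ioc (-1/4 : ℝ) (3/4)) := by
    refine IntegrableOn.of_bound (volume_rect_ne_top _ _).lt_top hsm.aestronglyMeasurable B
      ((ae_restrict_iff' (measurableSet_rect _ _)).2 (Eventually.of_forall fun z hz => hB _ ?_))
    exact ⟨hz.1, by linarith [hz.2.1], by linarith [hz.2.2]⟩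
  rw [Measure.volume_eq_prod, setIntegral_prod _ hi2, rect, setIntegral_prod _ hi, ← integral_smul]
  refine setIntegral_congr_fun measurableSet_Ioc fun x _ => ?_
  simp only
  rw [← intervalIntegral.integral_of_le (by norm_num),
    ← intervalIntegral.integral_of_le (by norm_num)]
  have := intervalIntegral.integral_comp_mul_left (a := -1/4) (b := 3/4)
    (fun y => Ψ (x, y)) (two_ne_zero (α := ℝ))
  rw [this]
  norm_num

/-- The exponentials that are `1`-periodic in `x` and `2`-periodic in `y`. -/
noncomputable def stripExp (n : Fin 2 → ℤ) (z : ℝ × ℝ) : ℂ :=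
  Complex.exp (2 * Real.pi * Complex.I * (n 0 * z.1 + n 1 / 2 * z.2 : ℝ))

theorem continuous_stripExp (n : Fin 2 → ℤ) : Continuous (stripExp n) := by
  unfold stripExp; fun_prop

theorem norm_stripExp (n : Fin 2 → ℤ) (z : ℝ × ℝ) : ‖stripExp n z‖ = 1 := by
  rw [stripExp, show (2 * Real.pi * Complex.I * (n 0 * z.1 + n 1 / 2 * z.2 : ℝ) : ℂ) =
    ((2 * Real.pi * (n 0 * z.1 + n 1 / 2 * z.2) : ℝ) : ℂ) * Complex.I by push_cast; ring]
  exact Complex.norm_exp_ofReal_mul_I _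

theorem stripExp_torusChart (n : Fin 2 → ℤ) (τ : Torus) :
    stripExp n (torusChart τ) = UnitAddTorus.mFourier n τ := by
  set e := UnitAddTorus.measurableEquivPiIoc torusCorner
  have h : τ = fun i => (((e τ).1 i : ℝ) : UnitAddCircle) := by
    conv_lhs => rw [← e.symm_apply_apply τ]
    exact UnitAddTorus.coe_symm_measurableEquivPiIoc_apply _ _
  conv_rhs => rw [h]
  simp only [UnitAddTorus.mFourier, ContinuousMap.coe_mk, Fin.prod_univ_two, fourier_coe_apply]
  rw [← Complex.exp_add, stripExp, torusChart]
  congr 1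
  push_cast
  ring

theorem exists_strip_integral_le_of_rieszMult {p : ℝ} (hp : 1 < p) : ∃ K : ℝ, 0 ≤ K ∧
    ∀ h f₁ f₂ : ℝ × ℝ → ℝ, Measurable h → Measurable f₁ → Measurable f₂ →
      (∃ B, ∀ z ∈ rect (-1/2) (3/2), |h z| ≤ B) →
      (∃ B, ∀ z ∈ rect (-1/2) (3/2), |f₁ z| ≤ B) →
      (∃ B, ∀ z ∈ rect (-1/2) (3/2), |f₂ z| ≤ B) →
      (∀ n, ∫ z in rect (-1/2) (3/2), (h z : ℂ) * stripExp n z =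
        rieszMult 1 0 n * (∫ z in rect (-1/2) (3/2),
          (f₁ z : ℂ) * stripExp n z) +
        rieszMult 0 1 n * ∫ z in rect (-1/2) (3/2),
          (f₂ z : ℂ) * stripExp n z) →
      ∫ z in rect (-1/2) (3/2), |h z| ^ p ≤
        K * ((∫ z in rect (-1/2) (3/2), |f₁ z| ^ p) +
          ∫ z in rect (-1/2) (3/2), |f₂ z| ^ p) := by
  obtain ⟨K, hK, H⟩ := exists_integral_le_of_rieszMult hp
  refine ⟨K, hK, fun h f₁ f₂ hm hm₁ hm₂ hB hB₁ hB₂ hF => ?_⟩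
  have e1 : ∀ {f : ℝ × ℝ → ℝ}, Measurable f → (∃ B, ∀ z ∈ rect (-1/2) (3/2), |f z| ≤ B) →
      ∫ τ, |f (torusChart τ)| ^ p = (1 / 2 : ℝ) *
        ∫ z in rect (-1/2) (3/2), |f z| ^ p := by
    rintro f hf ⟨B, hB⟩
    have hmm : Measurable fun z => |f z| ^ p := by fun_prop
    refine integral_comp_torusChart (Ψ := fun z => |f z| ^ p) hmm.stronglyMeasurable
      (B := B ^ p) fun z hz => ?_
    rw [Real.norm_of_nonneg (by positivity)]
    exact Real.rpow_le_rpow (abs_nonneg _) (hB z hz) (by linarith)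
  have e2 : ∀ {f : ℝ × ℝ → ℝ}, Measurable f → (∃ B, ∀ z ∈ rect (-1/2) (3/2), |f z| ≤ B) → ∀ n,
      ∫ τ, (f (torusChart τ) : ℂ) * UnitAddTorus.mFourier n τ = (1 / 2 : ℝ) •
        ∫ z in rect (-1/2) (3/2), (f z : ℂ) * stripExp n z := by
    rintro f hf ⟨B, hB⟩ n
    simp_rw [← stripExp_torusChart]
    have hmm : Measurable fun z => (f z : ℂ) * stripExp n z := by
      have := (continuous_stripExp n).measurable
      fun_prop
    refine integral_comp_torusChart (Ψ := fun z => (f z : ℂ) * stripExp n z)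
      hmm.stronglyMeasurable (B := B) fun z hz => ?_
    rw [norm_mul, norm_stripExp, mul_one, Complex.norm_real]
    exact hB z hz
  have key := H (fun τ => h (torusChart τ)) (fun τ => f₁ (torusChart τ))
    (fun τ => f₂ (torusChart τ)) (hm.comp measurable_torusChart) (hm₁.comp measurable_torusChart)
    (hm₂.comp measurable_torusChart) (hB.imp fun B hB τ => hB _ (torusChart_mem τ))
    (hB₁.imp fun B hB τ => hB _ (torusChart_mem τ))
    (hB₂.imp fun B hB τ => hB _ (torusChart_mem τ)) (fun n => by
      rw [e2 hm hB, e2 hm₁ hB₁, e2 hm₂ hB₂, hF n]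
      simp only [Complex.real_smul]
      ring)
  rw [e1 hm hB, e1 hm₁ hB₁, e1 hm₂ hB₂] at key
  linarith

theorem Continuous.integrableOn_rect {E : Type*} [NormedAddCommGroup E] {F : ℝ × ℝ → E}
    (hF : Continuous F) (a b : ℝ) : IntegrableOn F (rect a b) :=
  (hF.continuousOn.integrableOn_compact (isCompact_Icc.prod isCompact_Icc)).mono_set
    (Set.prod_mono Set.Ioc_subset_Icc_self Set.Ioc_subset_Icc_self)

theorem setIntegral_rect_eq {E : Type*} [NormedAddCommGroup E] [NormedSpace ℝ E] {F : ℝ × ℝ → E}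
    (hF : Continuous F) {a b : ℝ} (hab : a ≤ b) :
    ∫ z in rect a b, F z = ∫ x in (0:ℝ)..1, ∫ y in a..b, F (x, y) := by
  have := hF.integrableOn_rect a b
  rw [rect, Measure.volume_eq_prod, setIntegral_prod _ this,
    intervalIntegral.integral_of_le zero_le_one]
  simp_rw [intervalIntegral.integral_of_le hab]

theorem setIntegral_rect_eq_swap {E : Type*} [NormedAddCommGroup E] [NormedSpace ℝ E]
    {F : ℝ × ℝ → E} (hF : Continuous F) {a b : ℝ} (hab : a ≤ b) :
    ∫ z in rect a b, F z = ∫ y in a..b, ∫ x in (0:ℝ)..1, F (x, y) := by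
  have hi := hF.integrableOn_rect a b
  rw [rect, Measure.volume_eq_prod, ← Measure.prod_restrict, integral_prod_symm,
    intervalIntegral.integral_of_le hab]
  · simp_rw [intervalIntegral.integral_of_le zero_le_one]
  · rw [Measure.prod_restrict]
    exact hi

/-- Partial derivative in the first variable. -/
noncomputable def dx {E : Type*} [NormedAddCommGroup E] [NormedSpace ℝ E] (f : ℝ × ℝ → E)
    (z : ℝ × ℝ) : E := fderiv ℝ f z (1, 0)

/-- Partial derivative in the second variable. -/
noncomputable def dy {E : Type*} [NormedAddCommGroup E] [NormedSpace ℝ E] (f : ℝ × ℝ → E)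
    (z : ℝ × ℝ) : E := fderiv ℝ f z (0, 1)

section Partial

variable {E : Type*} [NormedAddCommGroup E] [NormedSpace ℝ E] {f : ℝ × ℝ → E}

theorem continuous_dx (hf : ContDiff ℝ 1 f) : Continuous (dx f) :=
  (hf.continuous_fderiv one_ne_zero).clm_apply continuous_const

theorem continuous_dy (hf : ContDiff ℝ 1 f) : Continuous (dy f) :=
  (hf.continuous_fderiv one_ne_zero).clm_apply continuous_const

theorem hasDerivAt_dx (hf : ContDiff ℝ 1 f) (x y : ℝ) :
    HasDerivAt (fun t => f (t, y)) (dx f (x, y)) x := by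
  have h := (hf.differentiable one_ne_zero (x, y)).hasFDerivAt
  exact h.comp_hasDerivAt x ((hasDerivAt_id x).prodMk (hasDerivAt_const x y))

theorem hasDerivAt_dy (hf : ContDiff ℝ 1 f) (x y : ℝ) :
    HasDerivAt (fun t => f (x, t)) (dy f (x, y)) y := by
  have h := (hf.differentiable one_ne_zero (x, y)).hasFDerivAt
  exact h.comp_hasDerivAt y ((hasDerivAt_const y x).prodMk (hasDerivAt_id y))

theorem dx_eq_of_hasDerivAt (hf : ContDiff ℝ 1 f) {x y : ℝ} {e : E}
    (h : HasDerivAt (fun t => f (t, y)) e x) : dx f (x, y) = e :=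
  (hasDerivAt_dx hf x y).unique h

theorem dy_eq_of_hasDerivAt (hf : ContDiff ℝ 1 f) {x y : ℝ} {e : E}
    (h : HasDerivAt (fun t => f (x, t)) e y) : dy f (x, y) = e :=
  (hasDerivAt_dy hf x y).unique h

theorem integral_dx [CompleteSpace E] (hf : ContDiff ℝ 1 f) (a b y : ℝ) :
    ∫ x in a..b, dx f (x, y) = f (b, y) - f (a, y) :=
  intervalIntegral.integral_eq_sub_of_hasDerivAt (fun x _ => hasDerivAt_dx hf x y)
    (Continuous.intervalIntegrable ((continuous_dx hf).comp (by fun_prop)) _ _)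

theorem integral_dy [CompleteSpace E] (hf : ContDiff ℝ 1 f) (a b x : ℝ) :
    ∫ y in a..b, dy f (x, y) = f (x, b) - f (x, a) :=
  intervalIntegral.integral_eq_sub_of_hasDerivAt (fun y _ => hasDerivAt_dy hf x y)
    (Continuous.intervalIntegrable ((continuous_dy hf).comp (by fun_prop)) _ _)

end Partial

theorem contDiff_stripExp (n : Fin 2 → ℤ) : ContDiff ℝ 1 (stripExp n) := by
  unfold stripExp
  have h0 : ContDiff ℝ 1 (fun z : ℝ × ℝ => (n 0 * z.1 + n 1 / 2 * z.2 : ℝ)) := by fun_prop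
  have h : ContDiff ℝ 1 (fun z : ℝ × ℝ => ((n 0 * z.1 + n 1 / 2 * z.2 : ℝ) : ℂ)) :=
    Complex.ofRealCLM.contDiff.comp h0
  exact (contDiff_const.mul h).cexp

theorem stripExp_one_eq (n : Fin 2 → ℤ) (y : ℝ) : stripExp n (1, y) = stripExp n (0, y) := by
  unfold stripExp
  rw [Complex.exp_eq_exp_iff_exists_int]
  refine ⟨n 0, ?_⟩
  push_cast
  ring

theorem hasDerivAt_stripExp_fst (n : Fin 2 → ℤ) (x y : ℝ) :
    HasDerivAt (fun t => stripExp n (t, y)) (2 * Real.pi * Complex.I * n 0 * stripExp n (x, y))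
      x := by
  unfold stripExp
  have h : HasDerivAt (fun t : ℝ => ((n 0 * t + n 1 / 2 * y : ℝ) : ℂ)) ((n 0 : ℝ) : ℂ) x := by
    have h1 : HasDerivAt (fun t : ℝ => (n 0 * t + n 1 / 2 * y : ℝ)) (n 0 : ℝ) x := by
      simpa using ((hasDerivAt_id x).const_mul (n 0 : ℝ)).add_const (n 1 / 2 * y : ℝ)
    exact h1.ofReal_comp
  convert (h.const_mul (2 * Real.pi * Complex.I)).cexp using 1
  push_cast
  ring

theorem hasDerivAt_stripExp_snd (n : Fin 2 → ℤ) (x y : ℝ) :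
    HasDerivAt (fun t => stripExp n (x, t))
      (2 * Real.pi * Complex.I * (n 1 / 2) * stripExp n (x, y)) y := by
  unfold stripExp
  have h : HasDerivAt (fun t : ℝ => ((n 0 * x + n 1 / 2 * t : ℝ) : ℂ)) ((n 1 / 2 : ℝ) : ℂ) y := by
    have h1 : HasDerivAt (fun t : ℝ => (n 0 * x + n 1 / 2 * t : ℝ)) (n 1 / 2 : ℝ) y := by
      simpa using ((hasDerivAt_id y).const_mul (n 1 / 2 : ℝ)).const_add (n 0 * x : ℝ)
    exact h1.ofReal_comp
  convert (h.const_mul (2 * Real.pi * Complex.I)).cexp using 1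
  push_cast
  ring

section Parts

variable {f : ℝ × ℝ → ℝ}

theorem contDiff_ofReal_mul_stripExp (hf : ContDiff ℝ 1 f) (n : Fin 2 → ℤ) :
    ContDiff ℝ 1 (fun z => (f z : ℂ) * stripExp n z) :=
  (Complex.ofRealCLM.contDiff.comp hf).mul (contDiff_stripExp n)

theorem integral_dx_mul_stripExp (hf : ContDiff ℝ 1 f) (hp : ∀ y, f (1, y) = f (0, y))
    (n : Fin 2 → ℤ) {a b : ℝ} (hab : a ≤ b) :
    ∫ z in rect a b, ((dx f z : ℝ) : ℂ) * stripExp n z =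
      -(2 * Real.pi * Complex.I * n 0) * ∫ z in rect a b, (f z : ℂ) * stripExp n z := by
  have hF := contDiff_ofReal_mul_stripExp hf n
  have hd : ∀ z, dx (fun z => (f z : ℂ) * stripExp n z) z =
      ((dx f z : ℝ) : ℂ) * stripExp n z + 2 * Real.pi * Complex.I * n 0 * (f z * stripExp n z) := by
    rintro ⟨x, y⟩
    refine dx_eq_of_hasDerivAt hF ?_
    refine ((hasDerivAt_dx hf x y).ofReal_comp.mul
      (hasDerivAt_stripExp_fst n x y)).congr_deriv ?_
    ring
  have h0 : ∫ z in rect a b, dx (fun z => (f z : ℂ) * stripExp n z) z = 0 := by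
    rw [setIntegral_rect_eq_swap (continuous_dx hF) hab]
    simp_rw [integral_dx hF, hp, stripExp_one_eq]
    simp
  have c1 : Continuous fun z => ((dx f z : ℝ) : ℂ) * stripExp n z :=
    (Complex.continuous_ofReal.comp (continuous_dx hf)).mul (continuous_stripExp n)
  simp_rw [hd] at h0
  rw [integral_add (c1.integrableOn_rect _ _) ((hF.continuous.const_mul _).integrableOn_rect _ _),
    integral_const_mul] at h0
  linear_combination h0

theorem integral_dy_mul_stripExp (hf : ContDiff ℝ 1 f) (n : Fin 2 → ℤ) {a b : ℝ} (hab : a ≤ b) :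
    ∫ z in rect a b, ((dy f z : ℝ) : ℂ) * stripExp n z =
      (∫ x in (0:ℝ)..1, (f (x, b) : ℂ) * stripExp n (x, b)) -
      (∫ x in (0:ℝ)..1, (f (x, a) : ℂ) * stripExp n (x, a)) -
      (2 * Real.pi * Complex.I * (n 1 / 2)) * ∫ z in rect a b, (f z : ℂ) * stripExp n z := by
  have hF := contDiff_ofReal_mul_stripExp hf n
  have hd : ∀ z, dy (fun z => (f z : ℂ) * stripExp n z) z =
      ((dy f z : ℝ) : ℂ) * stripExp n z + 2 * Real.pi * Complex.I * (n 1 / 2) * (f z * stripExp n z) := by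
    rintro ⟨x, y⟩
    refine dy_eq_of_hasDerivAt hF ?_
    refine ((hasDerivAt_dy hf x y).ofReal_comp.mul
      (hasDerivAt_stripExp_snd n x y)).congr_deriv ?_
    ring
  have h0 : ∫ z in rect a b, dy (fun z => (f z : ℂ) * stripExp n z) z =
      (∫ x in (0:ℝ)..1, (f (x, b) : ℂ) * stripExp n (x, b)) -
      (∫ x in (0:ℝ)..1, (f (x, a) : ℂ) * stripExp n (x, a)) := by
    rw [setIntegral_rect_eq (continuous_dy hF) hab]
    simp_rw [integral_dy hF]
    have hc := hF.continuous
    refine intervalIntegral.integral_sub (Continuous.intervalIntegrable ?_ _ _)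
      (Continuous.intervalIntegrable ?_ _ _)
    · exact hc.comp (by fun_prop : Continuous fun x : ℝ => (x, b))
    · exact hc.comp (by fun_prop : Continuous fun x : ℝ => (x, a))
  have c1 : Continuous fun z => ((dy f z : ℝ) : ℂ) * stripExp n z :=
    (Complex.continuous_ofReal.comp (continuous_dy hf)).mul (continuous_stripExp n)
  simp_rw [hd] at h0
  rw [integral_add (c1.integrableOn_rect _ _) ((hF.continuous.const_mul _).integrableOn_rect _ _),
    integral_const_mul] at h0
  linear_combination h0

end Parts

/-- The function given by `A` for `y ≤ 0`, by `M` for `0 < y ≤ 1` and by `C` for `1 < y`. -/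
noncomputable def glue {E : Type*} (A M C : ℝ × ℝ → E) (z : ℝ × ℝ) : E :=
  if z.2 ≤ 0 then A z else if z.2 ≤ 1 then M z else C z

theorem measurable_glue {A M C : ℝ × ℝ → ℝ} (hA : Continuous A) (hM : Continuous M)
    (hC : Continuous C) : Measurable (glue A M C) :=
  Measurable.ite (measurableSet_le measurable_snd measurable_const) hA.measurable
    (Measurable.ite (measurableSet_le measurable_snd measurable_const) hM.measurable hC.measurable)

theorem setIntegral_glue {E : Type*} [NormedAddCommGroup E] [NormedSpace ℝ E]
    {A M C : ℝ × ℝ → E} (hA : Continuous A) (hM : Continuous M) (hC : Continuous C) :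
    ∫ z in rect (-1/2) (3/2), glue A M C z =
      (∫ z in rect (-1/2) 0, A z) + (∫ z in rect 0 1, M z) + ∫ z in rect 1 (3/2), C z := by
  have e1 : Set.EqOn (glue A M C) A (rect (-1/2) 0) := fun z hz => if_pos hz.2.2
  have e2 : Set.EqOn (glue A M C) M (rect 0 1) := fun z hz => by
    rw [glue, if_neg (not_le.2 hz.2.1), if_pos hz.2.2]
  have e3 : Set.EqOn (glue A M C) C (rect 1 (3/2)) := fun z hz => by
    have h1 := hz.2.1
    rw [glue, if_neg (by linarith), if_neg (by linarith)]
  have u : rect (-1/2) (3/2) = (rect (-1/2) 0 ∪ rect 0 1) ∪ rect 1 (3/2) := by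
    simp only [rect, ← Set.prod_union]
    rw [Set.Ioc_union_Ioc_eq_Ioc (by norm_num) (by norm_num),
      Set.Ioc_union_Ioc_eq_Ioc (by norm_num) (by norm_num)]
  have i1 : IntegrableOn (glue A M C) (rect (-1/2) 0) :=
    (hA.integrableOn_rect _ _).congr_fun e1.symm (measurableSet_rect _ _)
  have i2 : IntegrableOn (glue A M C) (rect 0 1) :=
    (hM.integrableOn_rect _ _).congr_fun e2.symm (measurableSet_rect _ _)
  have i3 : IntegrableOn (glue A M C) (rect 1 (3/2)) :=
    (hC.integrableOn_rect _ _).congr_fun e3.symm (measurableSet_rect _ _)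
  rw [u, setIntegral_union _ (measurableSet_rect _ _) (i1.union i2) i3,
    setIntegral_union _ (measurableSet_rect _ _) i1 i2,
    setIntegral_congr_fun (measurableSet_rect _ _) e1,
    setIntegral_congr_fun (measurableSet_rect _ _) e2,
    setIntegral_congr_fun (measurableSet_rect _ _) e3]
  · rw [Set.disjoint_left]
    intro z h1 h2
    linarith [h1.2.2, h2.2.1]
  · rw [Set.disjoint_left]
    rintro z (h1 | h1) h2
    · linarith [h1.2.2, h2.2.1]
    · linarith [h1.2.2, h2.2.1]

theorem exists_bound_glue {A M C : ℝ × ℝ → ℝ} (hA : Continuous A) (hM : Continuous M)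
    (hC : Continuous C) (a b : ℝ) : ∃ B, ∀ z ∈ rect a b, |glue A M C z| ≤ B := by
  have hk : IsCompact (Set.Icc (0:ℝ) 1 ×ˢ Set.Icc a b) := isCompact_Icc.prod isCompact_Icc
  obtain ⟨B₁, h₁⟩ := hk.exists_bound_of_continuousOn hA.continuousOn
  obtain ⟨B₂, h₂⟩ := hk.exists_bound_of_continuousOn hM.continuousOn
  obtain ⟨B₃, h₃⟩ := hk.exists_bound_of_continuousOn hC.continuousOn
  refine ⟨max B₁ (max B₂ B₃), fun z hz => ?_⟩
  have hz' : z ∈ Set.Icc (0:ℝ) 1 ×ˢ Set.Icc a b :=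
    ⟨Set.Ioc_subset_Icc_self hz.1, Set.Ioc_subset_Icc_self hz.2⟩
  have := h₁ z hz'
  have := h₂ z hz'
  have := h₃ z hz'
  unfold glue
  split_ifs
  · exact le_max_of_le_left (h₁ z hz')
  · exact le_max_of_le_right (le_max_of_le_left (h₂ z hz'))
  · exact le_max_of_le_right (le_max_of_le_right (h₃ z hz'))

theorem glue_mul_stripExp (A M C : ℝ × ℝ → ℝ) (n : Fin 2 → ℤ) :
    (fun z => ((glue A M C z : ℝ) : ℂ) * stripExp n z) = glue (fun z => (A z : ℂ) * stripExp n z)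
      (fun z => (M z : ℂ) * stripExp n z) (fun z => (C z : ℂ) * stripExp n z) := by
  ext z
  unfold glue
  split_ifs <;> rfl

/-- Continuous, piecewise `C¹` functions on the strip, `1`-periodic in the first variable and
vanishing on the boundary lines `y = -1/2` and `y = 3/2`. -/
structure IsStripPiecewise (A M C : ℝ × ℝ → ℝ) : Prop where
  contDiff_left : ContDiff ℝ 1 A
  contDiff_mid : ContDiff ℝ 1 M
  contDiff_right : ContDiff ℝ 1 C
  periodic_left : ∀ y, A (1, y) = A (0, y)
  periodic_mid : ∀ y, M (1, y) = M (0, y)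
  periodic_right : ∀ y, C (1, y) = C (0, y)
  left_zero : ∀ x, A (x, -1/2) = 0
  left_eq_mid : ∀ x, A (x, 0) = M (x, 0)
  mid_eq_right : ∀ x, C (x, 1) = M (x, 1)
  right_zero : ∀ x, C (x, 3/2) = 0

namespace IsStripPiecewise

variable {A M C : ℝ × ℝ → ℝ}

theorem integral_glue_mul_stripExp (hA : Continuous A) (hM : Continuous M) (hC : Continuous C)
    (n : Fin 2 → ℤ) :
    ∫ z in rect (-1/2) (3/2), ((glue A M C z : ℝ) : ℂ) * stripExp n z =
      (∫ z in rect (-1/2) 0, (A z : ℂ) * stripExp n z) +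
      (∫ z in rect 0 1, (M z : ℂ) * stripExp n z) +
      ∫ z in rect 1 (3/2), (C z : ℂ) * stripExp n z := by
  rw [glue_mul_stripExp]
  have := continuous_stripExp n
  exact setIntegral_glue (by fun_prop) (by fun_prop) (by fun_prop)

theorem integral_dx (h : IsStripPiecewise A M C) (n : Fin 2 → ℤ) :
    ∫ z in rect (-1/2) (3/2), ((glue (dx A) (dx M) (dx C) z : ℝ) : ℂ) * stripExp n z =
      -(2 * Real.pi * Complex.I) * n 0 *
        ∫ z in rect (-1/2) (3/2), ((glue A M C z : ℝ) : ℂ) * stripExp n z := by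
  rw [integral_glue_mul_stripExp (continuous_dx h.contDiff_left) (continuous_dx h.contDiff_mid)
    (continuous_dx h.contDiff_right), integral_glue_mul_stripExp h.contDiff_left.continuous
    h.contDiff_mid.continuous h.contDiff_right.continuous,
    integral_dx_mul_stripExp h.contDiff_left h.periodic_left n (by norm_num),
    integral_dx_mul_stripExp h.contDiff_mid h.periodic_mid n (by norm_num),
    integral_dx_mul_stripExp h.contDiff_right h.periodic_right n (by norm_num)]
  ring

theorem integral_dy (h : IsStripPiecewise A M C) (n : Fin 2 → ℤ) :
    ∫ z in rect (-1/2) (3/2), ((glue (dy A) (dy M) (dy C) z : ℝ) : ℂ) * stripExp n z =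
      -(2 * Real.pi * Complex.I) * (n 1 / 2) *
        ∫ z in rect (-1/2) (3/2), ((glue A M C z : ℝ) : ℂ) * stripExp n z := by
  rw [integral_glue_mul_stripExp (continuous_dy h.contDiff_left) (continuous_dy h.contDiff_mid)
    (continuous_dy h.contDiff_right), integral_glue_mul_stripExp h.contDiff_left.continuous
    h.contDiff_mid.continuous h.contDiff_right.continuous,
    integral_dy_mul_stripExp h.contDiff_left n (by norm_num),
    integral_dy_mul_stripExp h.contDiff_mid n (by norm_num),
    integral_dy_mul_stripExp h.contDiff_right n (by norm_num)]
  simp only [h.left_zero, h.left_eq_mid, h.mid_eq_right, h.right_zero]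
  simp only [Complex.ofReal_zero, zero_mul, intervalIntegral.integral_zero]
  ring

end IsStripPiecewise

/-- Korn inequality for compactly supported piecewise `C¹` fields on a periodic strip. -/
theorem exists_integral_dy_le_of_isStripPiecewise {p : ℝ} (hp : 1 < p) : ∃ K : ℝ, 0 ≤ K ∧
    ∀ A₁ M₁ C₁ A₂ M₂ C₂ : ℝ × ℝ → ℝ, IsStripPiecewise A₁ M₁ C₁ → IsStripPiecewise A₂ M₂ C₂ →
      ∫ z in rect 0 1, |dy M₁ z| ^ p ≤
        K * ((∫ z in rect (-1/2) (3/2), |glue (dx A₁ - dy A₂) (dx M₁ - dy M₂)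
            (dx C₁ - dy C₂) z| ^ p) +
          ∫ z in rect (-1/2) (3/2), |glue (dy A₁ + dx A₂) (dy M₁ + dx M₂)
            (dy C₁ + dx C₂) z| ^ p) := by
  obtain ⟨K, hK, H⟩ := exists_strip_integral_le_of_rieszMult hp
  refine ⟨K, hK, fun A₁ M₁ C₁ A₂ M₂ C₂ h₁ h₂ => ?_⟩
  have cA₁x := continuous_dx h₁.contDiff_left
  have cA₁y := continuous_dy h₁.contDiff_left
  have cM₁x := continuous_dx h₁.contDiff_mid
  have cM₁y := continuous_dy h₁.contDiff_mid
  have cC₁x := continuous_dx h₁.contDiff_right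
  have cC₁y := continuous_dy h₁.contDiff_right
  have cA₂x := continuous_dx h₂.contDiff_left
  have cA₂y := continuous_dy h₂.contDiff_left
  have cM₂x := continuous_dx h₂.contDiff_mid
  have cM₂y := continuous_dy h₂.contDiff_mid
  have cC₂x := continuous_dx h₂.contDiff_right
  have cC₂y := continuous_dy h₂.contDiff_right
  have key := H (glue (dy A₁) (dy M₁) (dy C₁)) (glue (dx A₁ - dy A₂) (dx M₁ - dy M₂) (dx C₁ - dy C₂))
    (glue (dy A₁ + dx A₂) (dy M₁ + dx M₂) (dy C₁ + dx C₂))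
    (measurable_glue cA₁y cM₁y cC₁y)
    (measurable_glue (cA₁x.sub cA₂y) (cM₁x.sub cM₂y) (cC₁x.sub cC₂y))
    (measurable_glue (cA₁y.add cA₂x) (cM₁y.add cM₂x) (cC₁y.add cC₂x))
    (exists_bound_glue cA₁y cM₁y cC₁y _ _)
    (exists_bound_glue (cA₁x.sub cA₂y) (cM₁x.sub cM₂y) (cC₁x.sub cC₂y) _ _)
    (exists_bound_glue (cA₁y.add cA₂x) (cM₁y.add cM₂x) (cC₁y.add cC₂x) _ _) (fun n => ?_)
  · refine le_trans ?_ key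
    have hp0 : 0 ≤ p := by linarith
    have e : (fun z => |glue (dy A₁) (dy M₁) (dy C₁) z| ^ p) = glue (fun z => |dy A₁ z| ^ p)
        (fun z => |dy M₁ z| ^ p) (fun z => |dy C₁ z| ^ p) := by
      ext z
      unfold glue
      split_ifs <;> rfl
    rw [e, setIntegral_glue (cA₁y.abs.rpow_const fun _ => Or.inr hp0)
      (cM₁y.abs.rpow_const fun _ => Or.inr hp0) (cC₁y.abs.rpow_const fun _ => Or.inr hp0)]
    have i1 : 0 ≤ ∫ z in rect (-1/2) 0, |dy A₁ z| ^ p := integral_nonneg fun z => by positivity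
    have i2 : 0 ≤ ∫ z in rect 1 (3/2), |dy C₁ z| ^ p := integral_nonneg fun z => by positivity
    linarith
  · set V₁ := ∫ z in rect (-1/2) (3/2), ((glue A₁ M₁ C₁ z : ℝ) : ℂ) * stripExp n z
    set V₂ := ∫ z in rect (-1/2) (3/2), ((glue A₂ M₂ C₂ z : ℝ) : ℂ) * stripExp n z
    have x₁ := h₁.integral_dx n
    have y₁ := h₁.integral_dy n
    have x₂ := h₂.integral_dx n
    have y₂ := h₂.integral_dy n
    have hi : ∀ {A M C : ℝ × ℝ → ℝ}, Continuous A → Continuous M → Continuous C →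
        IntegrableOn (fun z => ((glue A M C z : ℝ) : ℂ) * stripExp n z) (rect (-1/2) (3/2)) := by
      intro A M C hA hM hC
      obtain ⟨B, hB⟩ := exists_bound_glue hA hM hC (-1/2) (3/2)
      have m1 := measurable_glue hA hM hC
      have m2 := (continuous_stripExp n).measurable
      refine IntegrableOn.of_bound (volume_rect_ne_top _ _).lt_top
        (Measurable.aestronglyMeasurable (by fun_prop)) B
        ((ae_restrict_iff' (measurableSet_rect _ _)).2 (Eventually.of_forall fun z hz => ?_))
      rw [norm_mul, norm_stripExp, mul_one, Complex.norm_real]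
      exact hB z hz
    have s1 : ∫ z in rect (-1/2) (3/2),
        ((glue (dx A₁ - dy A₂) (dx M₁ - dy M₂) (dx C₁ - dy C₂) z : ℝ) : ℂ) *
        stripExp n z =
        (∫ z in rect (-1/2) (3/2), ((glue (dx A₁) (dx M₁) (dx C₁) z : ℝ) : ℂ) * stripExp n z)
        - ∫ z in rect (-1/2) (3/2), ((glue (dy A₂) (dy M₂) (dy C₂) z : ℝ) : ℂ) * stripExp n z := by
      rw [← integral_sub (hi cA₁x cM₁x cC₁x) (hi cA₂y cM₂y cC₂y)]
      congr 1; ext z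
      rw [← sub_mul, ← Complex.ofReal_sub]
      congr 2
      unfold glue
      split_ifs <;> rfl
    have s2 : ∫ z in rect (-1/2) (3/2),
        ((glue (dy A₁ + dx A₂) (dy M₁ + dx M₂) (dy C₁ + dx C₂) z : ℝ) : ℂ) *
        stripExp n z =
        (∫ z in rect (-1/2) (3/2), ((glue (dy A₁) (dy M₁) (dy C₁) z : ℝ) : ℂ) * stripExp n z)
        + ∫ z in rect (-1/2) (3/2), ((glue (dx A₂) (dx M₂) (dx C₂) z : ℝ) : ℂ) * stripExp n z := by
      rw [← integral_add (hi cA₁y cM₁y cC₁y) (hi cA₂x cM₂x cC₂x)]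
      congr 1; ext z
      rw [← add_mul, ← Complex.ofReal_add]
      congr 2
      unfold glue
      split_ifs <;> rfl
    rw [s1, s2, x₁, y₁, x₂, y₂]
    by_cases h0 : ((n 0 : ℝ) ^ 2 + (n 1 / 2 : ℝ) ^ 2) = 0
    · have hn1 : (n 1 : ℝ) = 0 := by nlinarith [sq_nonneg (n 0 : ℝ), sq_nonneg (n 1 / 2 : ℝ)]
      have hn1' : (n 1 : ℂ) = 0 := by exact_mod_cast hn1
      simp [rieszMult, hn1, hn1']
    · have h0' : ((n 0 : ℂ) ^ 2 + (n 1 / 2 : ℂ) ^ 2) ≠ 0 := by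
        intro h
        apply h0
        exact_mod_cast h
      have e1 : (rieszMult 1 0 n : ℂ) * ((n 0 : ℂ) ^ 2 + (n 1 / 2 : ℂ) ^ 2) = n 0 * (n 1 / 2) := by
        simp only [rieszMult]
        push_cast
        rw [div_mul_cancel₀ _ h0']
        ring
      have e2 : (rieszMult 0 1 n : ℂ) * ((n 0 : ℂ) ^ 2 + (n 1 / 2 : ℂ) ^ 2) = (n 1 / 2) ^ 2 := by
        simp only [rieszMult]
        push_cast
        rw [div_mul_cancel₀ _ h0']
        ring
      refine mul_right_cancel₀ h0' ?_
      linear_combination (2 * Real.pi * Complex.I) * ((n 0 * V₁ - n 1 / 2 * V₂) * e1 +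
        (n 1 / 2 * V₁ + n 0 * V₂) * e2)

theorem setIntegral_rect_comp_le {G : ℝ × ℝ → ℝ} (hG : Continuous G) (h0 : ∀ z, 0 ≤ G z)
    {a b s k : ℝ} (hab : a ≤ b) (hk : 1 ≤ k) (h1 : 0 ≤ s - k * b) (h2 : s - k * a ≤ 1) :
    ∫ z in rect a b, G (z.1, s - k * z.2) ≤ ∫ z in rect 0 1, G z := by
  rw [setIntegral_rect_eq (by fun_prop) hab, setIntegral_rect_eq hG zero_le_one]
  refine intervalIntegral.integral_mono_on zero_le_one (Continuous.intervalIntegrable ?_ _ _)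
    (Continuous.intervalIntegrable ?_ _ _) fun x _ => ?_
  · exact intervalIntegral.continuous_parametric_intervalIntegral_of_continuous'
      (by fun_prop) _ _
  · exact intervalIntegral.continuous_parametric_intervalIntegral_of_continuous'
      (by fun_prop) _ _
  · have hc : Continuous fun y => G (x, y) := by fun_prop
    have hkb : s - k * b ≤ s - k * a := by nlinarith
    have e := intervalIntegral.integral_comp_sub_mul (a := a) (b := b) (fun y => G (x, y))
      (by linarith : k ≠ 0) s
    simp only at e ⊢
    rw [e, smul_eq_mul]
    have n0 : 0 ≤ ∫ y in (s - k * b)..(s - k * a), G (x, y) :=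
      intervalIntegral.integral_nonneg hkb fun y _ => h0 _
    refine (mul_le_of_le_one_left n0 (inv_le_one_of_one_le₀ hk)).trans ?_
    exact intervalIntegral.integral_mono_interval h1 hkb h2
      (Eventually.of_forall fun y => h0 _) (hc.intervalIntegrable _ _)

theorem setIntegral_abs_rpow_le_of_le {p : ℝ} (hp : 1 ≤ p) {F S : ℝ × ℝ → ℝ} (hF : Continuous F)
    (hS : Continuous S) (hS0 : ∀ z, 0 ≤ S z) {a b s t : ℝ} (hab : a ≤ b)
    (h1 : 0 ≤ s - b) (h2 : s - a ≤ 1) (h3 : 0 ≤ t - 2 * b) (h4 : t - 2 * a ≤ 1)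
    (h : ∀ z ∈ rect a b, |F z| ≤ 8 * (S (z.1, s - z.2) + S (z.1, t - 2 * z.2))) :
    ∫ z in rect a b, |F z| ^ p ≤ 2 * (8 ^ p * 2 ^ (p - 1)) * ∫ z in rect 0 1, S z ^ p := by
  have hp0 : 0 ≤ p := by linarith
  have cS : Continuous fun z => S z ^ p := hS.rpow_const fun _ => Or.inr hp0
  have nS : ∀ z, 0 ≤ S z ^ p := fun z => Real.rpow_nonneg (hS0 z) p
  have c1 : Continuous fun z : ℝ × ℝ => S (z.1, s - 1 * z.2) ^ p :=
    cS.comp (by fun_prop : Continuous fun z : ℝ × ℝ => (z.1, s - 1 * z.2))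
  have c2 : Continuous fun z : ℝ × ℝ => S (z.1, t - 2 * z.2) ^ p :=
    cS.comp (by fun_prop : Continuous fun z : ℝ × ℝ => (z.1, t - 2 * z.2))
  have i1 := setIntegral_rect_comp_le cS nS (s := s) (k := 1) hab le_rfl (by linarith)
    (by linarith)
  have i2 := setIntegral_rect_comp_le cS nS (s := t) (k := 2) hab one_le_two h3 h4
  calc ∫ z in rect a b, |F z| ^ p
      ≤ ∫ z in rect a b, 8 ^ p * 2 ^ (p - 1) *
        (S (z.1, s - 1 * z.2) ^ p + S (z.1, t - 2 * z.2) ^ p) := by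
        refine setIntegral_mono_on ((hF.abs.rpow_const fun _ => Or.inr hp0).integrableOn_rect _ _)
          ((continuous_const.mul (c1.add c2)).integrableOn_rect _ _) (measurableSet_rect _ _)
          fun z hz => ?_
        have n1 := hS0 (z.1, s - z.2)
        have n2 := hS0 (z.1, t - 2 * z.2)
        refine (Real.rpow_le_rpow (abs_nonneg _) (h z hz) hp0).trans ?_
        rw [Real.mul_rpow (by norm_num) (by positivity), mul_assoc, one_mul]
        gcongr
        exact add_rpow_le_two_rpow_mul n1 n2 hp
    _ = 8 ^ p * 2 ^ (p - 1) * ((∫ z in rect a b, S (z.1, s - 1 * z.2) ^ p) +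
        ∫ z in rect a b, S (z.1, t - 2 * z.2) ^ p) := by
        rw [integral_const_mul, integral_add (c1.integrableOn_rect _ _) (c2.integrableOn_rect _ _)]
    _ ≤ 8 ^ p * 2 ^ (p - 1) * ((∫ z in rect 0 1, S z ^ p) + ∫ z in rect 0 1, S z ^ p) := by
        gcongr
    _ = _ := by ring

/-- Higher order reflection, multiplied by an affine cutoff in the second variable. -/
noncomputable def stripRefl (α β s t c d : ℝ) (w : ℝ × ℝ → ℝ) (z : ℝ × ℝ) : ℝ :=
  (α + β * z.2) * (c * w (z.1, s - z.2) + d * w (z.1, t - 2 * z.2))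

section Refl

variable {α β s t : ℝ} {w w₁ w₂ : ℝ × ℝ → ℝ}

theorem contDiff_stripRefl (hw : ContDiff ℝ 1 w) (α β s t c d : ℝ) :
    ContDiff ℝ 1 (stripRefl α β s t c d w) := by
  unfold stripRefl
  fun_prop

theorem dx_stripRefl (hw : ContDiff ℝ 1 w) (α β s t c d : ℝ) (z : ℝ × ℝ) :
    dx (stripRefl α β s t c d w) z =
      (α + β * z.2) * (c * dx w (z.1, s - z.2) + d * dx w (z.1, t - 2 * z.2)) := by
  obtain ⟨x, y⟩ := z
  refine dx_eq_of_hasDerivAt (contDiff_stripRefl hw ..) ?_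
  exact (((hasDerivAt_dx hw x (s - y)).const_mul c).add
    ((hasDerivAt_dx hw x (t - 2 * y)).const_mul d)).const_mul (α + β * y)

theorem dy_stripRefl (hw : ContDiff ℝ 1 w) (α β s t c d : ℝ) (z : ℝ × ℝ) :
    dy (stripRefl α β s t c d w) z = β * (c * w (z.1, s - z.2) + d * w (z.1, t - 2 * z.2)) -
      (α + β * z.2) * (c * dy w (z.1, s - z.2) + 2 * d * dy w (z.1, t - 2 * z.2)) := by
  obtain ⟨x, y⟩ := z
  refine dy_eq_of_hasDerivAt (contDiff_stripRefl hw ..) ?_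
  have h1 : HasDerivAt (fun r => w (x, s - r)) (dy w (x, s - y) * (-1)) y :=
    (hasDerivAt_dy hw x (s - y)).comp y ((hasDerivAt_id y).const_sub s)
  have h2 : HasDerivAt (fun r => w (x, t - 2 * r)) (dy w (x, t - 2 * y) * (-(2 * 1))) y :=
    (hasDerivAt_dy hw x (t - 2 * y)).comp (h := fun r => t - 2 * r) y
      (((hasDerivAt_id y).const_mul 2).const_sub t)
  have h3 : HasDerivAt (fun r : ℝ => α + β * r) (β * 1) y :=
    ((hasDerivAt_id y).const_mul β).const_add α
  refine (h3.mul ((h1.const_mul c).add (h2.const_mul d))).congr_deriv ?_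
  simp only [Pi.add_apply]
  ring

/-- The sum of the strain components and of the components of the displacement `(w₁, w₂)`. -/
noncomputable def strainMass (w₁ w₂ : ℝ × ℝ → ℝ) (z : ℝ × ℝ) : ℝ :=
  |dx w₁ z| + |dy w₂ z| + |dy w₁ z + dx w₂ z| + |w₁ z| + |w₂ z|

theorem strainMass_nonneg (w₁ w₂ : ℝ × ℝ → ℝ) (z : ℝ × ℝ) : 0 ≤ strainMass w₁ w₂ z := by
  unfold strainMass
  positivity

theorem continuous_strainMass (h₁ : ContDiff ℝ 1 w₁) (h₂ : ContDiff ℝ 1 w₂) :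
    Continuous (strainMass w₁ w₂) := by
  have := continuous_dx h₁
  have := continuous_dy h₁
  have := continuous_dx h₂
  have := continuous_dy h₂
  have := h₁.continuous
  have := h₂.continuous
  unfold strainMass
  fun_prop

theorem abs_mul_le_of_abs_le {a b k : ℝ} (h : |a| ≤ k) : |a * b| ≤ k * |b| := by
  rw [abs_mul]
  gcongr

theorem abs_dx_sub_dy_stripRefl_le (h₁ : ContDiff ℝ 1 w₁) (h₂ : ContDiff ℝ 1 w₂) {z : ℝ × ℝ}
    (hχ : |α + β * z.2| ≤ 1) (hβ : |β| ≤ 2) :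
    |dx (stripRefl α β s t 3 (-2) w₁) z - dy (stripRefl α β s t (-3) 4 w₂) z| ≤
      8 * (strainMass w₁ w₂ (z.1, s - z.2) + strainMass w₁ w₂ (z.1, t - 2 * z.2)) := by
  rw [dx_stripRefl h₁, dy_stripRefl h₂]
  unfold strainMass
  generalize (z.1, s - z.2) = z₁
  generalize (z.1, t - 2 * z.2) = z₂
  generalize α + β * z.2 = χ at *
  have e : χ * (3 * dx w₁ z₁ + -2 * dx w₁ z₂) - (β * (-3 * w₂ z₁ + 4 * w₂ z₂) -
      χ * (-3 * dy w₂ z₁ + 2 * 4 * dy w₂ z₂)) =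
      3 * (χ * dx w₁ z₁) - 2 * (χ * dx w₁ z₂) - 3 * (χ * dy w₂ z₁) + 8 * (χ * dy w₂ z₂) +
      3 * (β * w₂ z₁) - 4 * (β * w₂ z₂) := by ring
  rw [e]
  have b1 := abs_le.1 (abs_mul_le_of_abs_le (b := dx w₁ z₁) hχ)
  have b2 := abs_le.1 (abs_mul_le_of_abs_le (b := dx w₁ z₂) hχ)
  have b3 := abs_le.1 (abs_mul_le_of_abs_le (b := dy w₂ z₁) hχ)
  have b4 := abs_le.1 (abs_mul_le_of_abs_le (b := dy w₂ z₂) hχ)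
  have b5 := abs_le.1 (abs_mul_le_of_abs_le (b := w₂ z₁) hβ)
  have b6 := abs_le.1 (abs_mul_le_of_abs_le (b := w₂ z₂) hβ)
  have := abs_nonneg (dx w₁ z₁)
  have := abs_nonneg (dx w₁ z₂)
  have := abs_nonneg (dy w₂ z₁)
  have := abs_nonneg (dy w₂ z₂)
  have := abs_nonneg (w₂ z₁)
  have := abs_nonneg (w₂ z₂)
  have := abs_nonneg (w₁ z₁)
  have := abs_nonneg (w₁ z₂)
  have := abs_nonneg (dy w₁ z₁ + dx w₂ z₁)
  have := abs_nonneg (dy w₁ z₂ + dx w₂ z₂)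
  rw [abs_le]
  constructor <;> linarith

theorem abs_dy_add_dx_stripRefl_le (h₁ : ContDiff ℝ 1 w₁) (h₂ : ContDiff ℝ 1 w₂) {z : ℝ × ℝ}
    (hχ : |α + β * z.2| ≤ 1) (hβ : |β| ≤ 2) :
    |dy (stripRefl α β s t 3 (-2) w₁) z + dx (stripRefl α β s t (-3) 4 w₂) z| ≤
      8 * (strainMass w₁ w₂ (z.1, s - z.2) + strainMass w₁ w₂ (z.1, t - 2 * z.2)) := by
  rw [dy_stripRefl h₁, dx_stripRefl h₂]
  unfold strainMass
  generalize (z.1, s - z.2) = z₁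
  generalize (z.1, t - 2 * z.2) = z₂
  generalize α + β * z.2 = χ at *
  have e : β * (3 * w₁ z₁ + -2 * w₁ z₂) - χ * (3 * dy w₁ z₁ + 2 * -2 * dy w₁ z₂) +
      χ * (-3 * dx w₂ z₁ + 4 * dx w₂ z₂) =
      3 * (β * w₁ z₁) - 2 * (β * w₁ z₂) - 3 * (χ * (dy w₁ z₁ + dx w₂ z₁)) +
      4 * (χ * (dy w₁ z₂ + dx w₂ z₂)) := by ring
  rw [e]
  have b1 := abs_le.1 (abs_mul_le_of_abs_le (b := dy w₁ z₁ + dx w₂ z₁) hχ)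
  have b2 := abs_le.1 (abs_mul_le_of_abs_le (b := dy w₁ z₂ + dx w₂ z₂) hχ)
  have b5 := abs_le.1 (abs_mul_le_of_abs_le (b := w₁ z₁) hβ)
  have b6 := abs_le.1 (abs_mul_le_of_abs_le (b := w₁ z₂) hβ)
  have := abs_nonneg (dx w₁ z₁)
  have := abs_nonneg (dx w₁ z₂)
  have := abs_nonneg (dy w₂ z₁)
  have := abs_nonneg (dy w₂ z₂)
  have := abs_nonneg (w₂ z₁)
  have := abs_nonneg (w₂ z₂)
  have := abs_nonneg (w₁ z₁)
  have := abs_nonneg (w₁ z₂)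
  have := abs_nonneg (dy w₁ z₁ + dx w₂ z₁)
  have := abs_nonneg (dy w₁ z₂ + dx w₂ z₂)
  rw [abs_le]
  constructor <;> linarith

theorem isStripPiecewise_stripRefl (hw : ContDiff ℝ 1 w) (hper : ∀ y, w (1, y) = w (0, y)) {c d : ℝ}
    (hcd : c + d = 1) :
    IsStripPiecewise (stripRefl 1 2 0 0 c d w) w (stripRefl 3 (-2) 2 3 c d w) where
  contDiff_left := contDiff_stripRefl hw ..
  contDiff_mid := hw
  contDiff_right := contDiff_stripRefl hw ..
  periodic_left y := by simp [stripRefl, hper]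
  periodic_mid := hper
  periodic_right y := by simp [stripRefl, hper]
  left_zero x := by
    simp only [stripRefl]
    norm_num
  left_eq_mid x := by
    simp only [stripRefl]
    norm_num
    linear_combination w (x, 0) * hcd
  mid_eq_right x := by
    simp only [stripRefl]
    norm_num
    linear_combination w (x, 1) * hcd
  right_zero x := by
    simp only [stripRefl]
    norm_num

end Refl

theorem integral_glue_rpow_le {p : ℝ} (hp : 1 ≤ p) {A M C S : ℝ × ℝ → ℝ} (hA : Continuous A)
    (hM : Continuous M) (hC : Continuous C) (hS : Continuous S) (hS0 : ∀ z, 0 ≤ S z)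
    (h₁ : ∀ z ∈ rect (-1/2) 0, |A z| ≤ 8 * (S (z.1, 0 - z.2) + S (z.1, 0 - 2 * z.2)))
    (h₂ : ∀ z, |M z| ≤ S z)
    (h₃ : ∀ z ∈ rect 1 (3/2), |C z| ≤ 8 * (S (z.1, 2 - z.2) + S (z.1, 3 - 2 * z.2))) :
    ∫ z in rect (-1/2) (3/2), |glue A M C z| ^ p ≤
      (4 * (8 ^ p * 2 ^ (p - 1)) + 1) * ∫ z in rect 0 1, S z ^ p := by
  have hp0 : 0 ≤ p := by linarith
  have e : (fun z => |glue A M C z| ^ p) = glue (fun z => |A z| ^ p)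
      (fun z => |M z| ^ p) (fun z => |C z| ^ p) := by
    ext z
    unfold glue
    split_ifs <;> rfl
  have cM := hM.abs.rpow_const fun _ => Or.inr hp0
  rw [e, setIntegral_glue (hA.abs.rpow_const fun _ => Or.inr hp0) cM
    (hC.abs.rpow_const fun _ => Or.inr hp0)]
  have i1 := setIntegral_abs_rpow_le_of_le hp hA hS hS0 (by norm_num) (by norm_num) (by norm_num)
    (by norm_num) (by norm_num) h₁
  have i3 := setIntegral_abs_rpow_le_of_le hp hC hS hS0 (by norm_num) (by norm_num) (by norm_num)
    (by norm_num) (by norm_num) h₃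
  have i2 : ∫ z in rect 0 1, |M z| ^ p ≤ ∫ z in rect 0 1, S z ^ p :=
    setIntegral_mono (cM.integrableOn_rect _ _)
      ((hS.rpow_const fun _ => Or.inr hp0).integrableOn_rect _ _)
      fun z => Real.rpow_le_rpow (abs_nonneg _) (h₂ z) hp0
  linarith

/-- Inhomogeneous Korn inequality on the periodic strip. -/
theorem exists_integral_dy_le_strainMass {p : ℝ} (hp : 1 < p) : ∃ K : ℝ, 0 ≤ K ∧
    ∀ w₁ w₂ : ℝ × ℝ → ℝ, ContDiff ℝ 1 w₁ → ContDiff ℝ 1 w₂ → (∀ y, w₁ (1, y) = w₁ (0, y)) →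
      (∀ y, w₂ (1, y) = w₂ (0, y)) →
      ∫ z in rect 0 1, |dy w₁ z| ^ p ≤ K * ∫ z in rect 0 1, strainMass w₁ w₂ z ^ p := by
  obtain ⟨K, hK, H⟩ := exists_integral_dy_le_of_isStripPiecewise hp
  refine ⟨K * (2 * (4 * (8 ^ p * 2 ^ (p - 1)) + 1)), by positivity, fun w₁ w₂ h₁ h₂ p₁ p₂ => ?_⟩
  refine (H _ _ _ _ _ _ (isStripPiecewise_stripRefl h₁ p₁ (c := 3) (d := -2) (by norm_num))
    (isStripPiecewise_stripRefl h₂ p₂ (c := -3) (d := 4) (by norm_num))).trans ?_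
  have hS := continuous_strainMass h₁ h₂
  have hS0 := strainMass_nonneg w₁ w₂
  have cx {w : ℝ × ℝ → ℝ} (hw : ContDiff ℝ 1 w) (α β s t c d : ℝ) :=
    continuous_dx (contDiff_stripRefl hw α β s t c d)
  have cy {w : ℝ × ℝ → ℝ} (hw : ContDiff ℝ 1 w) (α β s t c d : ℝ) :=
    continuous_dy (contDiff_stripRefl hw α β s t c d)
  have hl : ∀ z ∈ rect (-1/2) 0, |1 + 2 * z.2| ≤ 1 := fun z hz => by
    rw [abs_le]
    constructor <;> linarith [hz.2.1, hz.2.2]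
  have hr : ∀ z ∈ rect 1 (3/2), |3 + -2 * z.2| ≤ 1 := fun z hz => by
    rw [abs_le]
    constructor <;> linarith [hz.2.1, hz.2.2]
  have g1 := integral_glue_rpow_le hp.le ((cx h₁ 1 2 0 0 3 (-2)).sub (cy h₂ 1 2 0 0 (-3) 4))
    ((continuous_dx h₁).sub (continuous_dy h₂))
    ((cx h₁ 3 (-2) 2 3 3 (-2)).sub (cy h₂ 3 (-2) 2 3 (-3) 4)) hS hS0
    (fun z hz => abs_dx_sub_dy_stripRefl_le h₁ h₂ (hl z hz) (by norm_num))
    (fun z => (abs_sub _ _).trans (by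
      unfold strainMass
      linarith [abs_nonneg (dy w₁ z + dx w₂ z), abs_nonneg (w₁ z), abs_nonneg (w₂ z)]))
    (fun z hz => abs_dx_sub_dy_stripRefl_le h₁ h₂ (hr z hz) (by norm_num))
  have g2 := integral_glue_rpow_le hp.le ((cy h₁ 1 2 0 0 3 (-2)).add (cx h₂ 1 2 0 0 (-3) 4))
    ((continuous_dy h₁).add (continuous_dx h₂))
    ((cy h₁ 3 (-2) 2 3 3 (-2)).add (cx h₂ 3 (-2) 2 3 (-3) 4)) hS hS0
    (fun z hz => abs_dy_add_dx_stripRefl_le h₁ h₂ (hl z hz) (by norm_num))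
    (fun z => by
      rw [Pi.add_apply]
      unfold strainMass
      linarith [abs_nonneg (dx w₁ z), abs_nonneg (dy w₂ z), abs_nonneg (w₁ z), abs_nonneg (w₂ z)])
    (fun z hz => abs_dy_add_dx_stripRefl_le h₁ h₂ (hr z hz) (by norm_num))
  rw [mul_assoc]
  refine mul_le_mul_of_nonneg_left ?_ hK
  refine (add_le_add g1 g2).trans_eq ?_
  ring

theorem intervalIntegral_swap {F : ℝ × ℝ → ℝ} (hF : Continuous F) (a b c d : ℝ) :
    ∫ x in a..b, ∫ y in c..d, F (x, y) = ∫ y in c..d, ∫ x in a..b, F (x, y) := by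
  refine intervalIntegral_intervalIntegral_swap (F := fun x y => F (x, y)) ?_
  exact (hF.continuousOn.integrableOn_compact
    (isCompact_uIcc.prod isCompact_uIcc)).mono_set (Set.prod_mono Set.uIoc_subset_uIcc
      Set.uIoc_subset_uIcc)

theorem abs_intervalIntegral_le_integral_abs {f : ℝ → ℝ} (hf : Continuous f) {a b : ℝ}
    (ha : 0 ≤ a) (hab : a ≤ b) (hb : b ≤ 1) : |∫ x in a..b, f x| ≤ ∫ x in (0:ℝ)..1, |f x| :=
  (intervalIntegral.abs_integral_le_integral_abs hab).trans
    (intervalIntegral.integral_mono_interval ha hab hb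
      (Eventually.of_forall fun _ => abs_nonneg _) (hf.abs.intervalIntegrable _ _))

theorem abs_sub_le_integral_abs_deriv {g g' : ℝ → ℝ} (hg : ∀ x, HasDerivAt g (g' x) x)
    (hg' : Continuous g') {x t : ℝ} (hx : x ∈ Set.Icc (0:ℝ) 1) (ht : t ∈ Set.Icc (0:ℝ) 1) :
    |g x - g t| ≤ ∫ s in (0:ℝ)..1, |g' s| := by
  have key : ∀ {a b : ℝ}, a ≤ b → a ∈ Set.Icc (0:ℝ) 1 → b ∈ Set.Icc (0:ℝ) 1 →
      |g b - g a| ≤ ∫ s in (0:ℝ)..1, |g' s| := by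
    intro a b hab ha hb
    rw [← intervalIntegral.integral_eq_sub_of_hasDerivAt (fun x _ => hg x)
      (hg'.intervalIntegrable _ _)]
    exact abs_intervalIntegral_le_integral_abs hg' ha.1 hab hb.2
  rcases le_total t x with h | h
  · exact key h ht hx
  · rw [abs_sub_comm]
    exact key h hx ht

theorem abs_sub_weighted_average_le {g g' φ : ℝ → ℝ} (hg : ∀ x, HasDerivAt g (g' x) x)
    (hg' : Continuous g') (hφ : Continuous φ) (hφ0 : ∀ t ∈ Set.Icc (0:ℝ) 1, 0 ≤ φ t)
    (hφ1 : ∫ t in (0:ℝ)..1, φ t = 1) {x : ℝ} (hx : x ∈ Set.Icc (0:ℝ) 1) :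
    |g x - ∫ t in (0:ℝ)..1, φ t * g t| ≤ ∫ s in (0:ℝ)..1, |g' s| := by
  have cg : Continuous g := continuous_iff_continuousAt.2 fun x => (hg x).continuousAt
  have e : g x - ∫ t in (0:ℝ)..1, φ t * g t = ∫ t in (0:ℝ)..1, φ t * (g x - g t) := by
    simp_rw [mul_sub]
    rw [intervalIntegral.integral_sub, intervalIntegral.integral_mul_const, hφ1, one_mul]
    all_goals exact Continuous.intervalIntegrable (by fun_prop) _ _
  rw [e]
  refine (intervalIntegral.abs_integral_le_integral_abs zero_le_one).trans ?_
  calc ∫ t in (0:ℝ)..1, |φ t * (g x - g t)|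
      ≤ ∫ t in (0:ℝ)..1, φ t * ∫ s in (0:ℝ)..1, |g' s| := by
        refine intervalIntegral.integral_mono_on zero_le_one
          (Continuous.intervalIntegrable (by fun_prop) _ _)
          (Continuous.intervalIntegrable (by fun_prop) _ _) fun t ht => ?_
        rw [abs_mul, abs_of_nonneg (hφ0 t ht)]
        exact mul_le_mul_of_nonneg_left (abs_sub_le_integral_abs_deriv hg hg' hx ht) (hφ0 t ht)
    _ = _ := by rw [intervalIntegral.integral_mul_const, hφ1, one_mul]

/-- The sum of the absolute values of the strain components of `(u₁, u₂)`. -/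
noncomputable def strain (u₁ u₂ : ℝ × ℝ → ℝ) (z : ℝ × ℝ) : ℝ :=
  |dx u₁ z| + |dy u₂ z| + |dy u₁ z + dx u₂ z|

theorem strain_nonneg (u₁ u₂ : ℝ × ℝ → ℝ) (z : ℝ × ℝ) : 0 ≤ strain u₁ u₂ z := by
  unfold strain
  positivity

section Poincare

variable {u₁ u₂ : ℝ × ℝ → ℝ}

theorem continuous_strain (h₁ : ContDiff ℝ 1 u₁) (h₂ : ContDiff ℝ 1 u₂) :
    Continuous (strain u₁ u₂) := by
  have := continuous_dx h₁
  have := continuous_dy h₁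
  have := continuous_dx h₂
  have := continuous_dy h₂
  unfold strain
  fun_prop

theorem abs_dx_le_strain (z : ℝ × ℝ) : |dx u₁ z| ≤ strain u₁ u₂ z := by
  unfold strain
  linarith [abs_nonneg (dy u₂ z), abs_nonneg (dy u₁ z + dx u₂ z)]

theorem abs_dy_le_strain (z : ℝ × ℝ) : |dy u₂ z| ≤ strain u₁ u₂ z := by
  unfold strain
  linarith [abs_nonneg (dx u₁ z), abs_nonneg (dy u₁ z + dx u₂ z)]

theorem abs_dy_add_dx_le_strain (z : ℝ × ℝ) : |dy u₁ z + dx u₂ z| ≤ strain u₁ u₂ z := by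
  unfold strain
  linarith [abs_nonneg (dx u₁ z), abs_nonneg (dy u₂ z)]

theorem abs_sub_mean_le (h₁ : ContDiff ℝ 1 u₁) (h₂ : ContDiff ℝ 1 u₂)
    (hp : ∀ y, u₂ (1, y) = u₂ (0, y)) {x y : ℝ} (hx : x ∈ Set.Icc (0:ℝ) 1)
    (hy : y ∈ Set.Icc (0:ℝ) 1) :
    |u₁ (x, y) - ∫ t in (0:ℝ)..1, u₁ (t, 0)| ≤
      (∫ t in (0:ℝ)..1, strain u₁ u₂ (t, y)) +
        ∫ t in (0:ℝ)..1, ∫ s in (0:ℝ)..1, strain u₁ u₂ (t, s) := by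
  have cS := continuous_strain h₁ h₂
  have c1 := continuous_dx h₁
  have c2 := continuous_dy h₁
  have c3 := continuous_dx h₂
  have c4 := h₁.continuous
  have b1 : |u₁ (x, y) - ∫ t in (0:ℝ)..1, u₁ (t, y)| ≤
      ∫ t in (0:ℝ)..1, strain u₁ u₂ (t, y) := by
    have := abs_sub_weighted_average_le (φ := fun _ => 1) (fun x => hasDerivAt_dx h₁ x y)
      (by fun_prop) continuous_const (by simp) (by simp) hx
    simp only [one_mul] at this
    refine this.trans (intervalIntegral.integral_mono_on zero_le_one
      (Continuous.intervalIntegrable (by fun_prop) _ _)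
      (Continuous.intervalIntegrable (by fun_prop) _ _) fun t _ => abs_dx_le_strain _)
  have e2 : (∫ t in (0:ℝ)..1, u₁ (t, y)) - ∫ t in (0:ℝ)..1, u₁ (t, 0) =
      ∫ s in (0:ℝ)..y, ∫ t in (0:ℝ)..1, (dy u₁ (t, s) + dx u₂ (t, s)) := by
    have e3 : ∀ s, ∫ t in (0:ℝ)..1, (dy u₁ (t, s) + dx u₂ (t, s)) =
        ∫ t in (0:ℝ)..1, dy u₁ (t, s) := by
      intro s
      rw [intervalIntegral.integral_add, integral_dx h₂, hp, sub_self, add_zero]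
      all_goals exact Continuous.intervalIntegrable (by fun_prop) _ _
    simp_rw [e3]
    rw [← intervalIntegral_swap c2]
    simp_rw [integral_dy h₁]
    rw [intervalIntegral.integral_sub]
    all_goals exact Continuous.intervalIntegrable (by fun_prop) _ _
  have b2 : |(∫ t in (0:ℝ)..1, u₁ (t, y)) - ∫ t in (0:ℝ)..1, u₁ (t, 0)| ≤
      ∫ t in (0:ℝ)..1, ∫ s in (0:ℝ)..1, strain u₁ u₂ (t, s) := by
    rw [e2, intervalIntegral_swap cS]
    refine (abs_intervalIntegral_le_integral_abs (by fun_prop) le_rfl hy.1 hy.2).trans ?_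
    refine intervalIntegral.integral_mono_on zero_le_one
      (Continuous.intervalIntegrable (by fun_prop) _ _)
      (Continuous.intervalIntegrable (by fun_prop) _ _) fun s _ => ?_
    refine (intervalIntegral.abs_integral_le_integral_abs zero_le_one).trans ?_
    exact intervalIntegral.integral_mono_on zero_le_one
      (Continuous.intervalIntegrable (by fun_prop) _ _)
      (Continuous.intervalIntegrable (by fun_prop) _ _) fun t _ => abs_dy_add_dx_le_strain _
  calc |u₁ (x, y) - ∫ t in (0:ℝ)..1, u₁ (t, 0)|
      = |(u₁ (x, y) - ∫ t in (0:ℝ)..1, u₁ (t, y)) +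
          ((∫ t in (0:ℝ)..1, u₁ (t, y)) - ∫ t in (0:ℝ)..1, u₁ (t, 0))| := by ring_nf
    _ ≤ _ := (abs_add_le _ _).trans (add_le_add b1 b2)

theorem hasDerivAt_parabola (y : ℝ) :
    HasDerivAt (fun y : ℝ => 6 * y * (1 - y)) (6 - 12 * y) y := by
  have h := ((hasDerivAt_id y).const_mul 6).mul ((hasDerivAt_id y).const_sub 1)
  refine h.congr_deriv ?_
  simp only [id]
  ring

theorem integral_parabola : ∫ y in (0:ℝ)..1, 6 * y * (1 - y) = 1 := by
  have h : ∀ y : ℝ, HasDerivAt (fun y : ℝ => 3 * y ^ 2 - 2 * y ^ 3) (6 * y * (1 - y)) y := by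
    intro y
    refine (((hasDerivAt_pow 2 y).const_mul 3).sub
      ((hasDerivAt_pow 3 y).const_mul 2)).congr_deriv ?_
    push_cast
    ring
  rw [intervalIntegral.integral_eq_sub_of_hasDerivAt (fun x _ => h x)
    (Continuous.intervalIntegrable (by fun_prop) _ _)]
  norm_num

theorem abs_sub_weighted_mean_le (h₁ : ContDiff ℝ 1 u₁) (h₂ : ContDiff ℝ 1 u₂)
    (hp : ∀ y, u₂ (1, y) = u₂ (0, y)) {x y : ℝ} (hx : x ∈ Set.Icc (0:ℝ) 1)
    (hy : y ∈ Set.Icc (0:ℝ) 1) :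
    |u₂ (x, y) - ∫ s in (0:ℝ)..1, 6 * s * (1 - s) * u₂ (0, s)| ≤
      (∫ s in (0:ℝ)..1, strain u₁ u₂ (x, s)) +
        14 * ∫ t in (0:ℝ)..1, ∫ s in (0:ℝ)..1, strain u₁ u₂ (t, s) := by
  have cS := continuous_strain h₁ h₂
  have c1 := continuous_dx h₁
  have c2 := continuous_dy h₁
  have c3 := continuous_dx h₂
  have c4 := continuous_dy h₂
  have c5 := h₁.continuous
  have c6 := h₂.continuous
  set J := ∫ t in (0:ℝ)..1, ∫ s in (0:ℝ)..1, strain u₁ u₂ (t, s) with hJ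
  set c := ∫ t in (0:ℝ)..1, u₁ (t, 0)
  have hφ : ∀ s ∈ Set.Icc (0:ℝ) 1, 0 ≤ 6 * s * (1 - s) := fun s hs =>
    mul_nonneg (by linarith [hs.1]) (by linarith [hs.2])
  have b1 : |u₂ (x, y) - ∫ s in (0:ℝ)..1, 6 * s * (1 - s) * u₂ (x, s)| ≤
      ∫ s in (0:ℝ)..1, strain u₁ u₂ (x, s) := by
    refine (abs_sub_weighted_average_le (φ := fun s => 6 * s * (1 - s))
      (fun y => hasDerivAt_dy h₂ x y) (by fun_prop) (by fun_prop) hφ integral_parabola hy).trans ?_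
    exact intervalIntegral.integral_mono_on zero_le_one
      (Continuous.intervalIntegrable (by fun_prop) _ _)
      (Continuous.intervalIntegrable (by fun_prop) _ _) fun t _ => abs_dy_le_strain _
  have e2 : (∫ s in (0:ℝ)..1, 6 * s * (1 - s) * u₂ (x, s)) -
      ∫ s in (0:ℝ)..1, 6 * s * (1 - s) * u₂ (0, s) =
      ∫ t in (0:ℝ)..x, ∫ s in (0:ℝ)..1, 6 * s * (1 - s) * dx u₂ (t, s) := by
    rw [intervalIntegral_swap (F := fun z => 6 * z.2 * (1 - z.2) * dx u₂ z) (by fun_prop)]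
    simp_rw [intervalIntegral.integral_const_mul, integral_dx h₂, mul_sub]
    rw [intervalIntegral.integral_sub]
    all_goals exact Continuous.intervalIntegrable (by fun_prop) _ _
  have parts : ∀ t, ∫ s in (0:ℝ)..1, 6 * s * (1 - s) * dy u₁ (t, s) =
      -∫ s in (0:ℝ)..1, (6 - 12 * s) * (u₁ (t, s) - c) := by
    intro t
    rw [intervalIntegral.integral_mul_deriv_eq_deriv_mul (fun s _ => hasDerivAt_parabola s)
      (fun s _ => (hasDerivAt_dy h₁ t s).sub_const c)
      (Continuous.intervalIntegrable (by fun_prop) _ _)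
      (Continuous.intervalIntegrable (by fun_prop) _ _)]
    simp
  have b3 : ∀ t ∈ Set.Icc (0:ℝ) 1, |∫ s in (0:ℝ)..1, 6 * s * (1 - s) * dx u₂ (t, s)| ≤
      2 * (∫ s in (0:ℝ)..1, strain u₁ u₂ (t, s)) + 12 * J := by
    intro t ht
    have e : ∫ s in (0:ℝ)..1, 6 * s * (1 - s) * dx u₂ (t, s) =
        ∫ s in (0:ℝ)..1, (6 * s * (1 - s) * (dy u₁ (t, s) + dx u₂ (t, s)) +
          (6 - 12 * s) * (u₁ (t, s) - c)) := by
      simp_rw [mul_add]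
      rw [intervalIntegral.integral_add, intervalIntegral.integral_add, parts]
      · ring
      all_goals exact Continuous.intervalIntegrable (by fun_prop) _ _
    rw [e]
    refine (intervalIntegral.abs_integral_le_integral_abs zero_le_one).trans ?_
    calc _ ≤ ∫ s in (0:ℝ)..1, (2 * strain u₁ u₂ (t, s) +
          (6 * (∫ r in (0:ℝ)..1, strain u₁ u₂ (r, s)) + 6 * J)) := by
          refine intervalIntegral.integral_mono_on zero_le_one
            (Continuous.intervalIntegrable (by fun_prop) _ _)
            (Continuous.intervalIntegrable (by fun_prop) _ _) fun s hs => ?_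
          refine (abs_add_le _ _).trans (add_le_add ?_ ?_)
          · rw [abs_mul, abs_of_nonneg (hφ s hs)]
            refine mul_le_mul ?_ (abs_dy_add_dx_le_strain _) (abs_nonneg _) (by norm_num)
            nlinarith [sq_nonneg (s - 1 / 2)]
          · rw [abs_mul, ← mul_add]
            refine mul_le_mul ?_ (abs_sub_mean_le h₁ h₂ hp ht hs) (abs_nonneg _) (by norm_num)
            rw [abs_le]
            constructor <;> linarith [hs.1, hs.2]
      _ = _ := by
          rw [intervalIntegral.integral_add, intervalIntegral.integral_add,
            intervalIntegral.integral_const_mul, intervalIntegral.integral_const_mul,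
            ← intervalIntegral_swap cS, ← hJ]
          · simp
            ring
          all_goals exact Continuous.intervalIntegrable (by fun_prop) _ _
  have b2 : |(∫ s in (0:ℝ)..1, 6 * s * (1 - s) * u₂ (x, s)) -
      ∫ s in (0:ℝ)..1, 6 * s * (1 - s) * u₂ (0, s)| ≤ 14 * J := by
    rw [e2]
    refine (abs_intervalIntegral_le_integral_abs (by fun_prop) le_rfl hx.1 hx.2).trans ?_
    calc _ ≤ ∫ t in (0:ℝ)..1, (2 * (∫ s in (0:ℝ)..1, strain u₁ u₂ (t, s)) + 12 * J) :=
          intervalIntegral.integral_mono_on zero_le_one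
            (Continuous.intervalIntegrable (by fun_prop) _ _)
            (Continuous.intervalIntegrable (by fun_prop) _ _) b3
      _ = _ := by
          rw [intervalIntegral.integral_add, intervalIntegral.integral_const_mul, ← hJ]
          · simp
            ring
          all_goals exact Continuous.intervalIntegrable (by fun_prop) _ _
  calc |u₂ (x, y) - ∫ s in (0:ℝ)..1, 6 * s * (1 - s) * u₂ (0, s)|
      = |(u₂ (x, y) - ∫ s in (0:ℝ)..1, 6 * s * (1 - s) * u₂ (x, s)) +
          ((∫ s in (0:ℝ)..1, 6 * s * (1 - s) * u₂ (x, s)) -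
            ∫ s in (0:ℝ)..1, 6 * s * (1 - s) * u₂ (0, s))| := by rw [sub_add_sub_cancel]
    _ ≤ _ := (abs_add_le _ _).trans (add_le_add b1 b2)

end Poincare

theorem rpow_integral_le_integral_rpow {p : ℝ} (hp : 1 ≤ p) {k : ℝ → ℝ} (hk : Continuous k)
    (hk0 : ∀ x, 0 ≤ k x) : (∫ x in (0:ℝ)..1, k x) ^ p ≤ ∫ x in (0:ℝ)..1, k x ^ p := by
  have : IsProbabilityMeasure (volume.restrict (Set.Ioc (0:ℝ) 1)) := ⟨by simp⟩
  have hc : Continuous fun x => k x ^ p := hk.rpow_const fun _ => Or.inr (by linarith)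
  rw [intervalIntegral.integral_of_le zero_le_one, intervalIntegral.integral_of_le zero_le_one]
  exact (convexOn_rpow hp).map_integral_le
    (Real.continuous_rpow_const (by linarith)).continuousOn isClosed_Ici
    (Eventually.of_forall hk0) (hk.intervalIntegrable 0 1).1 (hc.intervalIntegrable 0 1).1

theorem add_four_rpow_le {p : ℝ} (hp : 1 ≤ p) {a b c d : ℝ} (ha : 0 ≤ a) (hb : 0 ≤ b)
    (hc : 0 ≤ c) (hd : 0 ≤ d) :
    (a + b + c + d) ^ p ≤ 2 ^ (p - 1) * 2 ^ (p - 1) * (a ^ p + b ^ p + c ^ p + d ^ p) := by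
  have h1 := add_rpow_le_two_rpow_mul (add_nonneg ha hb) (add_nonneg hc hd) hp
  have h2 := add_rpow_le_two_rpow_mul ha hb hp
  have h3 := add_rpow_le_two_rpow_mul hc hd hp
  rw [add_assoc (a + b)]
  calc _ ≤ _ := h1
    _ ≤ 2 ^ (p - 1) * (2 ^ (p - 1) * (a ^ p + b ^ p) + 2 ^ (p - 1) * (c ^ p + d ^ p)) := by gcongr
    _ = _ := by ring

/-- A Poincaré–Korn inequality: up to constants, the displacement is controlled by the strain. -/
theorem exists_integral_strainMass_le {p : ℝ} (hp : 1 ≤ p) {u₁ u₂ : ℝ × ℝ → ℝ}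
    (h₁ : ContDiff ℝ 1 u₁) (h₂ : ContDiff ℝ 1 u₂) (hp₂ : ∀ y, u₂ (1, y) = u₂ (0, y)) :
    ∃ c₁ c₂ : ℝ, ∫ z in rect 0 1, strainMass (fun z => u₁ z - c₁) (fun z => u₂ z - c₂) z ^ p ≤
      2 ^ (p - 1) * 2 ^ (p - 1) * (3 + 15 ^ p) * ∫ z in rect 0 1, strain u₁ u₂ z ^ p := by
  have hp0 : 0 ≤ p := by linarith
  have cS := continuous_strain h₁ h₂
  have nS := strain_nonneg u₁ u₂
  have cSp : Continuous fun z => strain u₁ u₂ z ^ p := cS.rpow_const fun _ => Or.inr hp0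
  set c₁ := ∫ t in (0:ℝ)..1, u₁ (t, 0)
  set c₂ := ∫ s in (0:ℝ)..1, 6 * s * (1 - s) * u₂ (0, s)
  refine ⟨c₁, c₂, ?_⟩
  set R : ℝ → ℝ := fun y => ∫ t in (0:ℝ)..1, strain u₁ u₂ (t, y)
  set Q : ℝ → ℝ := fun x => ∫ s in (0:ℝ)..1, strain u₁ u₂ (x, s)
  set J := ∫ t in (0:ℝ)..1, Q t
  set I := ∫ z in rect 0 1, strain u₁ u₂ z ^ p
  have cR : Continuous R := by fun_prop
  have cQ : Continuous Q := by fun_prop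
  have nR : ∀ y, 0 ≤ R y := fun y => intervalIntegral.integral_nonneg zero_le_one fun _ _ => nS _
  have nQ : ∀ y, 0 ≤ Q y := fun y => intervalIntegral.integral_nonneg zero_le_one fun _ _ => nS _
  have nJ : 0 ≤ J := intervalIntegral.integral_nonneg zero_le_one fun _ _ => nQ _
  have cRp : Continuous fun y => R y ^ p := cR.rpow_const fun _ => Or.inr hp0
  have cQp : Continuous fun y => Q y ^ p := cQ.rpow_const fun _ => Or.inr hp0
  have bR : ∫ y in (0:ℝ)..1, R y ^ p ≤ I := by
    simp only [I]
    rw [setIntegral_rect_eq_swap cSp zero_le_one]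
    exact intervalIntegral.integral_mono_on zero_le_one (cRp.intervalIntegrable _ _)
      (Continuous.intervalIntegrable (by fun_prop) _ _)
      fun y _ => rpow_integral_le_integral_rpow hp (by fun_prop) fun t => nS _
  have bQ : ∫ y in (0:ℝ)..1, Q y ^ p ≤ I := by
    simp only [I]
    rw [setIntegral_rect_eq cSp zero_le_one]
    exact intervalIntegral.integral_mono_on zero_le_one (cQp.intervalIntegrable _ _)
      (Continuous.intervalIntegrable (by fun_prop) _ _)
      fun y _ => rpow_integral_le_integral_rpow hp (by fun_prop) fun t => nS _
  have bJ : J ^ p ≤ I := (rpow_integral_le_integral_rpow hp cQ nQ).trans bQ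
  have e₁ : ContDiff ℝ 1 fun z => u₁ z - c₁ := h₁.sub contDiff_const
  have e₂ : ContDiff ℝ 1 fun z => u₂ z - c₂ := h₂.sub contDiff_const
  have cM := continuous_strainMass e₁ e₂
  have pw : ∀ z ∈ rect 0 1, strainMass (fun z => u₁ z - c₁) (fun z => u₂ z - c₂) z ^ p ≤
      2 ^ (p - 1) * 2 ^ (p - 1) *
        (strain u₁ u₂ z ^ p + R z.2 ^ p + Q z.1 ^ p + (15 * J) ^ p) := by
    rintro ⟨x, y⟩ hz
    have hx := Set.Ioc_subset_Icc_self hz.1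
    have hy := Set.Ioc_subset_Icc_self hz.2
    have a1 := abs_sub_mean_le h₁ h₂ hp₂ hx hy
    have a2 := abs_sub_weighted_mean_le h₁ h₂ hp₂ hx hy
    refine (Real.rpow_le_rpow (strainMass_nonneg _ _ _) ?_ hp0).trans
      (add_four_rpow_le hp (nS _) (nR _) (nQ _) (by positivity))
    have d1 : dx (fun z => u₁ z - c₁) (x, y) = dx u₁ (x, y) := by simp [dx, fderiv_sub_const]
    have d2 : dy (fun z => u₁ z - c₁) (x, y) = dy u₁ (x, y) := by simp [dy, fderiv_sub_const]
    have d3 : dx (fun z => u₂ z - c₂) (x, y) = dx u₂ (x, y) := by simp [dx, fderiv_sub_const]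
    have d4 : dy (fun z => u₂ z - c₂) (x, y) = dy u₂ (x, y) := by simp [dy, fderiv_sub_const]
    unfold strainMass
    rw [d1, d2, d3, d4]
    change strain u₁ u₂ (x, y) + _ + _ ≤ _
    change _ ≤ R y + J at a1
    change _ ≤ Q x + 14 * J at a2
    linarith
  have cR2 : Continuous fun z : ℝ × ℝ => R z.2 ^ p := cRp.comp continuous_snd
  have cQ2 : Continuous fun z : ℝ × ℝ => Q z.1 ^ p := cQp.comp continuous_fst
  refine (setIntegral_mono_on ((cM.rpow_const fun _ => Or.inr hp0).integrableOn_rect _ _)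
    (Continuous.integrableOn_rect (by fun_prop) _ _) (measurableSet_rect _ _) pw).trans ?_
  rw [integral_const_mul, integral_add, integral_add, integral_add]
  · rw [setIntegral_rect_eq cR2 zero_le_one, setIntegral_rect_eq_swap cQ2 zero_le_one,
      setIntegral_rect_eq continuous_const zero_le_one, Real.mul_rpow (by norm_num) nJ]
    simp only [intervalIntegral.integral_const, sub_zero, one_smul]
    rw [mul_assoc _ (3 + (15:ℝ) ^ p)]
    refine mul_le_mul_of_nonneg_left ?_ (by positivity)
    have : (15:ℝ) ^ p * J ^ p ≤ 15 ^ p * I := by gcongr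
    change I + _ + _ + _ ≤ _
    linarith
  all_goals exact Continuous.integrableOn_rect (by fun_prop) _ _

/-- The full partial derivative `∂₂u₁` is controlled by the strain on the periodic unit strip. -/
theorem exists_integral_dy_le_strain {p : ℝ} (hp : 1 < p) : ∃ K : ℝ, 0 ≤ K ∧
    ∀ u₁ u₂ : ℝ × ℝ → ℝ, ContDiff ℝ 1 u₁ → ContDiff ℝ 1 u₂ → (∀ y, u₁ (1, y) = u₁ (0, y)) →
      (∀ y, u₂ (1, y) = u₂ (0, y)) →
      ∫ z in rect 0 1, |dy u₁ z| ^ p ≤ K * ∫ z in rect 0 1, strain u₁ u₂ z ^ p := by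
  obtain ⟨K, hK, H⟩ := exists_integral_dy_le_strainMass hp
  refine ⟨K * (2 ^ (p - 1) * 2 ^ (p - 1) * (3 + 15 ^ p)), by positivity,
    fun u₁ u₂ h₁ h₂ p₁ p₂ => ?_⟩
  obtain ⟨c₁, c₂, h⟩ := exists_integral_strainMass_le hp.le h₁ h₂ p₂
  have := H (fun z => u₁ z - c₁) (fun z => u₂ z - c₂) (h₁.sub contDiff_const)
    (h₂.sub contDiff_const) (fun y => by rw [p₁]) (fun y => by rw [p₂])
  have d2 : dy (fun z => u₁ z - c₁) = dy u₁ := by ext z; simp [dy, fderiv_sub_const]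
  rw [d2] at this
  rw [mul_assoc]
  exact this.trans (mul_le_mul_of_nonneg_left h hK)

theorem setIntegral_Ioo_prod_Ioo_eq {F : ℝ × ℝ → ℝ} (hF : Continuous F) (a : ℝ) :
    ∫ z in Set.Ioo (0:ℝ) 1 ×ˢ Set.Ioo a (a + 1), F z = ∫ z in rect 0 1, F (z.1, z.2 + a) := by
  have h : (Set.Ioo (0:ℝ) 1 ×ˢ Set.Ioo a (a + 1) : Set (ℝ × ℝ)) =ᵐ[volume] rect a (a + 1) :=
    Measure.set_prod_ae_eq Ioo_ae_eq_Ioc Ioo_ae_eq_Ioc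
  rw [setIntegral_congr_set h, setIntegral_rect_eq hF (by linarith),
    setIntegral_rect_eq (by fun_prop) zero_le_one]
  congr 1
  ext x
  rw [intervalIntegral.integral_comp_add_right (fun y => F (x, y)), zero_add, add_comm a 1]

theorem frobNorm_nonneg (A : Matrix (Fin 2) (Fin 2) ℝ) : 0 ≤ frobNorm A :=
  Real.sqrt_nonneg _

theorem frobNorm_eq (a b c d : ℝ) :
    frobNorm !![a, b; c, d] = Real.sqrt (a ^ 2 + b ^ 2 + (c ^ 2 + d ^ 2)) := by
  simp [frobNorm, Fin.sum_univ_two]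

theorem symPart_eq (a b c d : ℝ) :
    symPart !![a, b; c, d] = !![a, (b + c) / 2; (b + c) / 2, d] := by
  ext i j
  fin_cases i <;> fin_cases j <;> simp [symPart] <;> ring

theorem frobNorm_le_sum_abs (a b c d : ℝ) :
    frobNorm !![a, b; c, d] ≤ |a| + |d| + |b + c| + 2 * |b| := by
  have hc : |c| ≤ |b + c| + |b| := by
    calc |c| = |(b + c) - b| := by rw [add_sub_cancel_left]
      _ ≤ _ := abs_sub _ _
  rw [frobNorm_eq, Real.sqrt_le_left (by positivity)]
  rw [← sq_abs a, ← sq_abs b, ← sq_abs c, ← sq_abs d]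
  have h : |a| + |b| + |c| + |d| ≤ |a| + |d| + |b + c| + 2 * |b| := by linarith
  refine le_trans ?_ (pow_le_pow_left₀ (by positivity) h 2)
  have ha := abs_nonneg a
  have hb := abs_nonneg b
  have hc := abs_nonneg c
  have hd := abs_nonneg d
  nlinarith [mul_nonneg ha hb, mul_nonneg ha hc, mul_nonneg ha hd, mul_nonneg hb hc,
    mul_nonneg hb hd, mul_nonneg hc hd]

theorem sum_abs_le_frobNorm_symPart (a b c d : ℝ) :
    |a| + |d| + |b + c| ≤ 4 * frobNorm (symPart !![a, b; c, d]) := by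
  rw [symPart_eq, frobNorm_eq]
  have h1 : |a| ≤ Real.sqrt (a ^ 2 + ((b + c) / 2) ^ 2 + (((b + c) / 2) ^ 2 + d ^ 2)) :=
    Real.abs_le_sqrt (by nlinarith [sq_nonneg ((b + c) / 2), sq_nonneg d])
  have h2 : |d| ≤ Real.sqrt (a ^ 2 + ((b + c) / 2) ^ 2 + (((b + c) / 2) ^ 2 + d ^ 2)) :=
    Real.abs_le_sqrt (by nlinarith [sq_nonneg ((b + c) / 2), sq_nonneg a])
  have h3 : |(b + c) / 2| ≤ Real.sqrt (a ^ 2 + ((b + c) / 2) ^ 2 + (((b + c) / 2) ^ 2 + d ^ 2)) :=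
    Real.abs_le_sqrt (by nlinarith [sq_nonneg ((b + c) / 2), sq_nonneg a, sq_nonneg d])
  rw [abs_div, abs_two] at h3
  linarith

theorem continuous_frobNorm : Continuous frobNorm := by
  unfold frobNorm
  fun_prop

theorem continuous_symPart : Continuous symPart := by
  unfold symPart
  fun_prop

theorem continuous_jacMat {u : ℝ × ℝ → ℝ × ℝ} (hu : ContDiff ℝ 1 u) : Continuous (jacMat u) := by
  have h1 := continuous_dx hu
  have h2 := continuous_dy hu
  unfold dx at h1
  unfold dy at h2
  unfold jacMat
  refine continuous_matrix fun i j => ?_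
  fin_cases i <;> fin_cases j <;> simp <;> fun_prop

theorem jacMat_eq {u : ℝ × ℝ → ℝ × ℝ} (hu : ContDiff ℝ 1 u) (a : ℝ) (z : ℝ × ℝ) :
    jacMat u (z.1, z.2 + a) =
      !![dx (fun z => (u (z.1, z.2 + a)).1) z, dy (fun z => (u (z.1, z.2 + a)).1) z;
         dx (fun z => (u (z.1, z.2 + a)).2) z, dy (fun z => (u (z.1, z.2 + a)).2) z] := by
  obtain ⟨x, y⟩ := z
  have hs : ContDiff ℝ 1 fun z : ℝ × ℝ => u (z.1, z.2 + a) := hu.comp (by fun_prop)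
  have h1 := hasDerivAt_dx hu x (y + a)
  have h2 : HasDerivAt (fun t => u (x, t + a)) (dy u (x, y + a)) y :=
    (hasDerivAt_dy hu x (y + a)).comp_add_const y a
  rw [dx_eq_of_hasDerivAt hs.fst h1.fst, dx_eq_of_hasDerivAt hs.snd h1.snd,
    dy_eq_of_hasDerivAt hs.fst h2.fst, dy_eq_of_hasDerivAt hs.snd h2.snd]
  rfl

/-- Homogeneous Korn inequality on the periodic strip `S_a = (0,1) × (a, a+1)`:
there is `C = C(p) > 0` (independent of `a`) with
`∫_{S_a} ‖∇u‖_F^p ≤ C ∫_{S_a} ‖Du‖_F^p` for every `C¹` map `u` 1-periodic in `y₁`. -/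
theorem korn_inequality_periodic_strip (p : ℝ) (hp : 1 < p) :
    ∃ C : ℝ, 0 < C ∧ ∀ (a : ℝ) (u : ℝ × ℝ → ℝ × ℝ), ContDiff ℝ 1 u →
      (∀ y : ℝ × ℝ, u (y.1 + 1, y.2) = u y) →
      (∫ y in Set.Ioo (0:ℝ) 1 ×ˢ Set.Ioo a (a + 1), frobNorm (jacMat u y) ^ p) ≤
        C * ∫ y in Set.Ioo (0:ℝ) 1 ×ˢ Set.Ioo a (a + 1),
          frobNorm (symPart (jacMat u y)) ^ p := by
  obtain ⟨K, hK, H⟩ := exists_integral_dy_le_strain hp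
  have hp0 : 0 ≤ p := by linarith
  refine ⟨2 ^ (p - 1) * (1 + 2 ^ p * K) * 4 ^ p, by positivity, fun a u hu hper => ?_⟩
  have cJ := continuous_jacMat hu
  have cF : Continuous fun z => frobNorm (jacMat u z) ^ p :=
    (continuous_frobNorm.comp cJ).rpow_const fun _ => Or.inr hp0
  have cD : Continuous fun z => frobNorm (symPart (jacMat u z)) ^ p :=
    (continuous_frobNorm.comp (continuous_symPart.comp cJ)).rpow_const fun _ => Or.inr hp0
  rw [setIntegral_Ioo_prod_Ioo_eq cF, setIntegral_Ioo_prod_Ioo_eq cD]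
  have hs : ContDiff ℝ 1 fun z : ℝ × ℝ => u (z.1, z.2 + a) := hu.comp (by fun_prop)
  have hper' : ∀ y, u (1, y + a) = u (0, y + a) := fun y => by
    simpa using hper (0, y + a)
  set u₁ : ℝ × ℝ → ℝ := fun z => (u (z.1, z.2 + a)).1 with hu₁
  set u₂ : ℝ × ℝ → ℝ := fun z => (u (z.1, z.2 + a)).2 with hu₂
  have h₁ : ContDiff ℝ 1 u₁ := hs.fst
  have h₂ : ContDiff ℝ 1 u₂ := hs.snd
  have key := H u₁ u₂ h₁ h₂ (fun y => by simp only [hu₁, hper']) (fun y => by simp only [hu₂, hper'])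
  have cSp : Continuous fun z => strain u₁ u₂ z ^ p :=
    (continuous_strain h₁ h₂).rpow_const fun _ => Or.inr hp0
  have cB : Continuous fun z => |dy u₁ z| ^ p :=
    (continuous_dy h₁).abs.rpow_const fun _ => Or.inr hp0
  have shift : Continuous fun z : ℝ × ℝ => (z.1, z.2 + a) := by fun_prop
  have upper : ∫ z in rect 0 1, frobNorm (jacMat u (z.1, z.2 + a)) ^ p ≤
      ∫ z in rect 0 1, 2 ^ (p - 1) * (strain u₁ u₂ z ^ p + 2 ^ p * |dy u₁ z| ^ p) := by
    refine setIntegral_mono ((cF.comp shift).integrableOn_rect _ _)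
      (Continuous.integrableOn_rect (by fun_prop) _ _) fun z => ?_
    simp only
    rw [jacMat_eq hu a z, ← Real.mul_rpow zero_le_two (abs_nonneg _)]
    refine (Real.rpow_le_rpow (frobNorm_nonneg _) (frobNorm_le_sum_abs _ _ _ _) hp0).trans ?_
    exact add_rpow_le_two_rpow_mul (strain_nonneg u₁ u₂ z) (by positivity) hp.le
  have lower : ∫ z in rect 0 1, strain u₁ u₂ z ^ p ≤
      4 ^ p * ∫ z in rect 0 1, frobNorm (symPart (jacMat u (z.1, z.2 + a))) ^ p := by
    rw [← integral_const_mul]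
    refine setIntegral_mono (cSp.integrableOn_rect _ _)
      ((continuous_const.mul (cD.comp shift)).integrableOn_rect _ _) fun z => ?_
    simp only
    rw [← Real.mul_rpow (by norm_num) (frobNorm_nonneg _), jacMat_eq hu a z]
    exact Real.rpow_le_rpow (strain_nonneg u₁ u₂ z) (sum_abs_le_frobNorm_symPart _ _ _ _) hp0
  rw [integral_const_mul, integral_add (cSp.integrableOn_rect _ _)
    (Continuous.integrableOn_rect (by fun_prop) _ _), integral_const_mul] at upper
  calc _ ≤ _ := upper
    _ ≤ 2 ^ (p - 1) * ((∫ z in rect 0 1, strain u₁ u₂ z ^ p) +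
        2 ^ p * (K * ∫ z in rect 0 1, strain u₁ u₂ z ^ p)) := by gcongr
    _ = 2 ^ (p - 1) * (1 + 2 ^ p * K) * ∫ z in rect 0 1, strain u₁ u₂ z ^ p := by ring
    _ ≤ 2 ^ (p - 1) * (1 + 2 ^ p * K) * (4 ^ p *
        ∫ z in rect 0 1, frobNorm (symPart (jacMat u (z.1, z.2 + a))) ^ p) := by gcongr
    _ = _ := by ring
end
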